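/- Let t ≥ 1 be an integer and let c_t := (3/π²) · ∏_{p prime} (1 + (1 + 1/p)⁻¹ · ∑_{k ≥ 1} τ_t(p^{2k}) · p^{−2k}). For every ε > 0 there exists C > 0 such that, for any family (χ_Δ) where for each fundamental discriminant Δ, χ_Δ is a primitive quadratic Dirichlet character modulo |Δ| with χ_Δ(−1) = Δ/|Δ|, and for all real Y ≥ 1: | ∑_{Δ fundamental, 0 < Δ ≤ Y} L(1, χ_Δ)^t − c_t·Y | ≤ C·Y^{2/3+ε} and | ∑_{Δ fundamental, −Y ≤ Δ < 0} L(1, χ_Δ)^t − c_t·Y | ≤ C·Y^{2/3+ε}. -/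

import Mathlib

/-- `Δ` is a fundamental discriminant. -/
def IsFundamentalDiscriminant (Δ : ℤ) : Prop :=
  Δ ≠ 1 ∧ ((Δ % 4 = 1 ∧ Squarefree Δ) ∨
    ∃ m : ℤ, Δ = 4 * m ∧ Squarefree m ∧ (m % 4 = 2 ∨ m % 4 = 3))

theorem IsFundamentalDiscriminant.natAbs_ne_zero {Δ : ℤ} (h : IsFundamentalDiscriminant Δ) :
    Δ.natAbs ≠ 0 := by
  rcases h with ⟨h1, ⟨hmod, _⟩ | ⟨m, hm, _, hmod⟩⟩ <;>
    · intro h0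
      rw [Int.natAbs_eq_zero] at h0
      omega

/-- `τ_r(n)`: the `r`-fold divisor function, i.e. the number of ordered `r`-tuples of positive
integers with product `n`. -/
noncomputable def tau (r n : ℕ) : ℕ :=
  Nat.card {f : Fin r → ℕ // (∀ i, 0 < f i) ∧ ∏ i, f i = n}

/-- The constant `c_t = (3/π²)·∏_p (1 + (1+1/p)⁻¹·∑_{k ≥ 1} τ_t(p^{2k})·p^{−2k})`. -/
noncomputable def momentConst (t : ℕ) : ℝ :=
  3 / Real.pi ^ 2 *
    ∏' p : Nat.Primes,
      (1 + (1 + 1 / (p : ℝ))⁻¹ *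
        ∑' k : ℕ, (tau t ((p : ℕ) ^ (2 * (k + 1))) : ℝ) / (p : ℝ) ^ (2 * (k + 1)))

section

open ZMod in
/-- The Kronecker symbol `(Δ/n)` for `n ≥ 1`. -/
noncomputable def kro (Δ : ℤ) (n : ℕ) : ℤ :=
  (ZMod.χ₈ (Δ : ZMod 8)) ^ (padicValNat 2 n) * jacobiSym Δ (n / 2 ^ padicValNat 2 n)

section GaussPrim

variable {N : ℕ} [NeZero N] {R : Type*} [CommRing R] [IsDomain R]

theorem gauss_prim_mul (e : AddChar (ZMod N) R) (he : e.IsPrimitive)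
    {χ : DirichletCharacter R N} (hχ : χ.IsPrimitive) :
    gaussSum χ e * gaussSum χ⁻¹ (e.mulShift (-1)) = N := by
  classical
  have h1 : ∀ a : ZMod N, gaussSum χ e * χ⁻¹ a = gaussSum χ (e.mulShift a) := fun a => by
    rw [gaussSum_mulShift_of_isPrimitive e hχ a, mul_comm]
  conv_lhs => rw [gaussSum.eq_1 χ⁻¹, Finset.mul_sum]
  have h2 : ∀ a : ZMod N, gaussSum χ e * (χ⁻¹ a * (e.mulShift (-1)) a)
      = ∑ b : ZMod N, χ b * (e.mulShift (b - 1)) a := by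
    intro a
    rw [← mul_assoc, h1, gaussSum, Finset.sum_mul]
    refine Finset.sum_congr rfl fun b _ => ?_
    rw [mul_assoc]
    congr 1
    simp only [AddChar.mulShift_apply]
    rw [← AddChar.map_add_eq_mul]
    congr 1
    ring
  rw [Finset.sum_congr rfl fun a _ => h2 a, Finset.sum_comm]
  simp_rw [← Finset.mul_sum, AddChar.mulShift_apply]
  have h3 : ∀ b : ZMod N, ∑ a : ZMod N, e ((b - 1) * a) = if b = 1 then (N : R) else 0 := by
    intro b
    have := AddChar.sum_mulShift (R' := R) (b - 1) he
    simp_rw [mul_comm _ (b - 1)] at this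
    rw [this]
    simp [sub_eq_zero, ZMod.card]
  simp_rw [h3]
  simp

theorem gauss_prim_sq (e : AddChar (ZMod N) R) (he : e.IsPrimitive)
    {χ : DirichletCharacter R N} (hχ : χ.IsPrimitive) (hq : χ⁻¹ = χ) :
    gaussSum χ e ^ 2 = χ (-1) * N := by
  have h := gauss_prim_mul e he hχ
  rw [gaussSum_mulShift_of_isPrimitive e (by rwa [hq])] at h
  rw [inv_inv, hq] at h
  have h2 : χ (-1) * χ (-1) = 1 := by rw [← map_mul]; simp
  calc gaussSum χ e ^ 2 = (χ (-1) * χ (-1)) * gaussSum χ e ^ 2 := by rw [h2, one_mul]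
    _ = χ (-1) * (gaussSum χ e * (χ (-1) * gaussSum χ e)) := by ring
    _ = _ := by rw [h]

end GaussPrim

theorem quad_values {q : ℕ} {χ : DirichletCharacter ℂ q} (h : χ ^ 2 = 1) (a : ZMod q) :
    χ a = 0 ∨ χ a = 1 ∨ χ a = -1 := by
  by_cases ha : IsUnit a
  · right
    have : χ a ^ 2 = 1 := by
      rw [← MulChar.pow_apply' χ two_ne_zero, h, MulChar.one_apply ha]
    exact sq_eq_one_iff.mp this
  · left; exact MulChar.map_nonunit _ ha

open Classical in
/-- integer valued version of a quadratic character. -/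
noncomputable def quadZ {q : ℕ} (χ : DirichletCharacter ℂ q) (a : ZMod q) : ℤ :=
  if χ a = 0 then 0 else if χ a = 1 then 1 else -1

theorem quadZ_cast {q : ℕ} {χ : DirichletCharacter ℂ q} (h : χ ^ 2 = 1) (a : ZMod q) :
    (quadZ χ a : ℂ) = χ a := by
  unfold quadZ
  rcases quad_values h a with h0 | h0 | h0 <;> norm_num [h0]

/-- quadratic character with values in any commutative ring -/
noncomputable def quadR {q : ℕ} (χ : DirichletCharacter ℂ q) (h : χ ^ 2 = 1) (R : Type*)
    [CommRing R] : DirichletCharacter R q where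
  toFun a := ((quadZ χ a : ℤ) : R)
  map_one' := by
    have : quadZ χ 1 = 1 := by
      have := quadZ_cast h (1 : ZMod q)
      rw [map_one] at this; exact_mod_cast this
    simp [this]
  map_mul' a b := by
    have : quadZ χ (a * b) = quadZ χ a * quadZ χ b := by
      have h1 := quadZ_cast h (a * b)
      rw [map_mul, ← quadZ_cast h a, ← quadZ_cast h b] at h1; exact_mod_cast h1
    simp [this]
  map_nonunit' a ha := by
    have : quadZ χ a = 0 := by
      have h1 := quadZ_cast h a
      rw [MulChar.map_nonunit _ ha] at h1; exact_mod_cast h1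
    simp [this]

theorem quadR_apply {q : ℕ} (χ : DirichletCharacter ℂ q) (h : χ ^ 2 = 1) (R : Type*)
    [CommRing R] (a : ZMod q) : quadR χ h R a = ((quadZ χ a : ℤ) : R) := rfl

theorem quadZ_values {q : ℕ} (χ : DirichletCharacter ℂ q) (a : ZMod q) :
    quadZ χ a = 0 ∨ quadZ χ a = 1 ∨ quadZ χ a = -1 := by
  unfold quadZ; split_ifs <;> simp

theorem quadR_prim {q : ℕ} [NeZero q] (χ : DirichletCharacter ℂ q) (h : χ ^ 2 = 1) (R : Type*)
    [CommRing R] [Nontrivial R] (h2 : (2 : R) ≠ 0) (hp : χ.IsPrimitive) :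
    (quadR χ h R).IsPrimitive := by
  have key : ∀ u : (ZMod q)ˣ, (quadR χ h R).toUnitHom u = 1 ↔ χ.toUnitHom u = 1 := by
    intro u
    rw [← Units.val_inj, ← Units.val_inj]
    simp only [MulChar.coe_toUnitHom, Units.val_one]
    rw [quadR_apply, ← quadZ_cast h]
    rcases quadZ_values χ (u : ZMod q) with h0 | h0 | h0 <;> rw [h0] <;> norm_num
    intro h3
    apply h2
    linear_combination -h3
  have : (quadR χ h R).conductor = χ.conductor := by
    unfold DirichletCharacter.conductor
    congr 1
    ext d
    rw [DirichletCharacter.mem_conductorSet_iff, DirichletCharacter.mem_conductorSet_iff]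
    by_cases hd : d ∣ q
    · rw [DirichletCharacter.factorsThrough_iff_ker_unitsMap hd,
        DirichletCharacter.factorsThrough_iff_ker_unitsMap hd]
      constructor
      · intro H u hu; exact (key u).1 (H hu)
      · intro H u hu; exact (key u).2 (H hu)
    · exact ⟨fun H => absurd H.dvd hd, fun H => absurd H.dvd hd⟩
  rw [DirichletCharacter.isPrimitive_def, this]; exact hp

theorem quadR_quadratic {q : ℕ} (χ : DirichletCharacter ℂ q) (h : χ ^ 2 = 1) (R : Type*)
    [CommRing R] : (quadR χ h R).IsQuadratic := by
  intro a
  rw [quadR_apply]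
  rcases quadZ_values χ a with h0 | h0 | h0 <;> simp [h0]

theorem tri_eq_of_cast {R : Type*} [CommRing R] (p : ℕ) [CharP R p] (hp : 2 < p) {a b : ℤ}
    (ha : a = 0 ∨ a = 1 ∨ a = -1) (hb : b = 0 ∨ b = 1 ∨ b = -1) (h : (a : R) = (b : R)) :
    a = b := by
  have h1 : ((a - b : ℤ) : R) = 0 := by push_cast; rw [h, sub_self]
  rw [CharP.intCast_eq_zero_iff R p] at h1
  obtain ⟨c, hc⟩ := h1
  by_contra hne
  have hc0 : c ≠ 0 := by rintro rfl; apply hne; linarith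
  have := Int.le_of_dvd (show 0 < |a - b| from abs_pos.mpr (sub_ne_zero.mpr hne))
    ((dvd_abs _ _).mpr ⟨c, hc⟩)
  rcases ha with rfl | rfl | rfl <;> rcases hb with rfl | rfl | rfl <;> norm_num at this hne <;> omega

/-- Value of a primitive quadratic character at odd primes. -/
theorem quadZ_odd_prime {q : ℕ} [NeZero q] {Δ : ℤ} (hq : q = Δ.natAbs)
    (χ : DirichletCharacter ℂ q)
    (h2 : χ ^ 2 = 1) (hp : χ.IsPrimitive) (hs : χ (-1) = if 0 < Δ then 1 else -1)
    (p : ℕ) [hpf : Fact p.Prime] (hp2 : p ≠ 2) : quadZ χ (p : ZMod q) = legendreSym p Δ := by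
  have hp3 : 2 < p := lt_of_le_of_ne hpf.1.two_le (Ne.symm hp2)
  by_cases hpq : p ∣ q
  · have h1 : ¬ IsUnit (p : ZMod q) := by
      rw [ZMod.isUnit_iff_coprime]
      intro hc
      exact hpf.1.one_lt.ne' (Nat.Coprime.eq_one_of_dvd hc hpq)
    have h3 : quadZ χ (p : ZMod q) = 0 := by
      have := quadZ_cast h2 (p : ZMod q)
      rw [MulChar.map_nonunit _ h1] at this; exact_mod_cast this
    rw [h3]
    symm
    rw [legendreSym.eq_zero_iff, ZMod.intCast_zmod_eq_zero_iff_dvd]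
    exact Int.natCast_dvd.mpr (hq ▸ hpq)
  · have hpu : IsUnit (p : ZMod q) := by
      rw [ZMod.isUnit_iff_coprime]
      exact (Nat.Prime.coprime_iff_not_dvd hpf.1).mpr hpq
    let n : ℕ+ := ⟨q, Nat.pos_of_ne_zero (NeZero.ne q)⟩
    have hn0 : ((n : ℕ) : ZMod p) ≠ 0 := by
      rw [Ne, ZMod.natCast_eq_zero_iff]; exact hpq
    let ψ := AddChar.primitiveZModChar n (ZMod p) hn0
    let FF := CyclotomicField ψ.n (ZMod p)
    have : CharP FF p := charP_of_injective_algebraMap (algebraMap (ZMod p) FF).injective p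
    have h20 : (2 : FF) ≠ 0 := by
      intro h
      have h' : ((2 : ℕ) : FF) = 0 := by exact_mod_cast h
      rw [CharP.cast_eq_zero_iff FF p] at h'
      exact absurd (Nat.le_of_dvd two_pos h') (by omega)
    have hprim := quadR_prim χ h2 FF h20 hp
    have hquad := quadR_quadratic χ h2 FF
    have hsq : gaussSum (quadR χ h2 FF) ψ.char ^ 2 = (quadR χ h2 FF) (-1) * Fintype.card (ZMod q) := by
      rw [ZMod.card]
      exact gauss_prim_sq ψ.char ψ.prim hprim hquad.inv
    have key := Char.card_pow_char_pow hquad ψ.char p 1 hpu hp2 hsq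
    rw [pow_one, pow_one, ZMod.card, quadR_apply, quadR_apply] at key
    have hsZ : quadZ χ (-1) * q = Δ := by
      have h5 : quadZ χ (-1) = if 0 < Δ then 1 else -1 := by
        have := quadZ_cast h2 (-1 : ZMod q)
        rw [hs] at this
        split_ifs at this ⊢ <;> exact_mod_cast this
      rw [h5]
      split_ifs <;> omega
    have hsF : ((quadZ χ (-1) : ℤ) : FF) * (q : FF) = ((Δ : ℤ) : FF) := by
      rw [← hsZ, Int.cast_mul, Int.cast_natCast]
    rw [hsF] at key
    have hl : ((legendreSym p Δ : ℤ) : FF) = ((Δ : ℤ) : FF) ^ (p / 2) := by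
      have := congrArg (algebraMap (ZMod p) FF) (legendreSym.eq_pow p Δ)
      simpa using this
    refine tri_eq_of_cast (R := FF) p hp3 (quadZ_values _ _) ?_ (by rw [hl, key])
    by_cases h0 : (Δ : ZMod p) = 0
    · left; exact (legendreSym.eq_zero_iff p Δ).mpr h0
    · right; exact legendreSym.eq_one_or_neg_one p h0

end

section

theorem quadZ_mul {q : ℕ} {χ : DirichletCharacter ℂ q} (h : χ ^ 2 = 1) (a b : ZMod q) :
    quadZ χ (a * b) = quadZ χ a * quadZ χ b := by
  have h1 := quadZ_cast h (a * b)
  rw [map_mul, ← quadZ_cast h a, ← quadZ_cast h b] at h1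
  exact_mod_cast h1

theorem quadZ_one {q : ℕ} {χ : DirichletCharacter ℂ q} (h : χ ^ 2 = 1) :
    quadZ χ 1 = 1 := by
  have := quadZ_cast h (1 : ZMod q)
  rw [map_one] at this; exact_mod_cast this

theorem quadZ_pow {q : ℕ} {χ : DirichletCharacter ℂ q} (h : χ ^ 2 = 1) (a : ZMod q) (k : ℕ) :
    quadZ χ (a ^ k) = quadZ χ a ^ k := by
  induction k with
  | zero => simp [quadZ_one h]
  | succ k ih => rw [pow_succ, quadZ_mul h, ih, pow_succ]

theorem quadZ_odd {q : ℕ} [NeZero q] {Δ : ℤ} (hq : q = Δ.natAbs)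
    (χ : DirichletCharacter ℂ q)
    (h2 : χ ^ 2 = 1) (hp : χ.IsPrimitive) (hs : χ (-1) = if 0 < Δ then 1 else -1) :
    ∀ m : ℕ, Odd m → quadZ χ (m : ZMod q) = jacobiSym Δ m := by
  intro m
  induction m using Nat.strong_induction_on with
  | _ m ih =>
    intro hm
    by_cases h1 : m = 1
    · subst h1; simp [quadZ_one h2]
    · have hpp := Nat.minFac_prime h1
      have : Fact (m.minFac).Prime := ⟨hpp⟩
      obtain ⟨c, hc⟩ := Nat.minFac_dvd m
      have hm' : Odd (m.minFac * c) := hc ▸ hm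
      rw [Nat.odd_mul] at hm'
      have hc0 : c ≠ 0 := by rintro rfl; simp at hm'
      have hcm : c < m := by
        rw [hc]; nlinarith [hpp.two_le, Nat.pos_of_ne_zero hc0]
      have : NeZero c := ⟨hc0⟩
      have : NeZero m.minFac := ⟨hpp.ne_zero⟩
      have e1 := ih c hcm hm'.2
      have e2 := quadZ_odd_prime hq χ h2 hp hs m.minFac (by
        rintro h; rw [h] at hm'; exact absurd hm'.1 (by decide))
      have e3 : quadZ χ ((m.minFac * c : ℕ) : ZMod q) = jacobiSym Δ (m.minFac * c) := by
        rw [Nat.cast_mul, quadZ_mul h2, e1, e2, jacobiSym.mul_right,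
          jacobiSym.legendreSym.to_jacobiSym]
      rw [← hc] at e3
      exact e3

theorem chi8_neg (a : ℤ) : ZMod.χ₈ ((-a : ℤ) : ZMod 8) = ZMod.χ₈ (a : ZMod 8) := by
  rw [ZMod.χ₈_int_eq_if_mod_eight, ZMod.χ₈_int_eq_if_mod_eight]
  split_ifs <;> omega

theorem quadZ_two {q : ℕ} [NeZero q] {Δ : ℤ} (hq : q = Δ.natAbs)
    (hf : IsFundamentalDiscriminant Δ) (χ : DirichletCharacter ℂ q)
    (h2 : χ ^ 2 = 1) (hp : χ.IsPrimitive) (hs : χ (-1) = if 0 < Δ then 1 else -1) :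
    quadZ χ (2 : ZMod q) = ZMod.χ₈ (Δ : ZMod 8) := by
  rcases hf.2 with ⟨hmod, _⟩ | ⟨m, hm, _, hmod⟩
  · have hodd : Odd (2 + q) := by
      rw [Nat.odd_iff]; omega
    have hqo : Odd q := by rw [Nat.odd_iff]; omega
    have e1 : (2 : ZMod q) = ((2 + q : ℕ) : ZMod q) := by simp
    rw [e1, quadZ_odd hq χ h2 hp hs _ hodd]
    have e2 : jacobiSym ((2 + q : ℕ) : ℤ) q = ZMod.χ₈ (q : ZMod 8) := by
      rw [← jacobiSym.at_two hqo, jacobiSym.mod_left]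
      conv_rhs => rw [jacobiSym.mod_left]
      congr 1
      push_cast
      simp
    rcases lt_or_ge 0 Δ with hpos | hneg
    · have hΔ : Δ = (q : ℤ) := by omega
      rw [hΔ, jacobiSym.quadratic_reciprocity_one_mod_four (by omega) hodd, e2]
      simp
    · have hΔ : Δ = -(q : ℤ) := by omega
      rw [hΔ, jacobiSym.neg _ hodd, chi8_neg, ZMod.χ₄_nat_one_mod_four (by omega), one_mul,
        jacobiSym.quadratic_reciprocity_one_mod_four' hqo (by omega), e2]
      simp
  · have h3 : ¬ IsUnit ((2 : ℕ) : ZMod q) := by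
      rw [ZMod.isUnit_iff_coprime]
      intro hc
      have := Nat.Coprime.eq_one_of_dvd hc (by omega)
      omega
    have h4 := quadZ_cast h2 ((2 : ℕ) : ZMod q)
    rw [MulChar.map_nonunit _ h3] at h4
    have h5 : quadZ χ (2 : ZMod q) = 0 := by exact_mod_cast h4
    rw [h5, ZMod.χ₈_int_eq_if_mod_eight, if_pos (by omega)]

theorem quadZ_eq_kro {q : ℕ} [NeZero q] {Δ : ℤ} (hq : q = Δ.natAbs)
    (hf : IsFundamentalDiscriminant Δ) (χ : DirichletCharacter ℂ q)
    (h2 : χ ^ 2 = 1) (hp : χ.IsPrimitive) (hs : χ (-1) = if 0 < Δ then 1 else -1)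
    (n : ℕ) (hn : n ≠ 0) : quadZ χ (n : ZMod q) = kro Δ n := by
  have hd : 2 ^ padicValNat 2 n ∣ n := pow_padicValNat_dvd
  have hn2 : n = 2 ^ padicValNat 2 n * (n / 2 ^ padicValNat 2 n) := (Nat.mul_div_cancel' hd).symm
  have hodd : Odd (n / 2 ^ padicValNat 2 n) := by
    rw [← Nat.not_even_iff_odd, even_iff_two_dvd]
    intro h
    obtain ⟨c, hc⟩ := h
    have : 2 ^ (padicValNat 2 n + 1) ∣ n := ⟨c, by rw [pow_succ, mul_assoc, ← hc]; exact hn2⟩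
    exact pow_succ_padicValNat_not_dvd hn this
  unfold kro
  conv_lhs => rw [hn2]
  rw [Nat.cast_mul, quadZ_mul h2, Nat.cast_pow, quadZ_pow h2, Nat.cast_ofNat,
    quadZ_two hq hf χ h2 hp hs, quadZ_odd hq χ h2 hp hs _ hodd]

end

section

/-- The divisor bound. -/
theorem divisor_bound (η : ℝ) (hη : 0 < η) :
    ∃ C : ℝ, 1 ≤ C ∧ ∀ n : ℕ, n ≠ 0 → (n.divisors.card : ℝ) ≤ C * (n : ℝ) ^ η := by
  have hl2 : 0 < Real.log 2 := Real.log_pos one_lt_two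
  set K : ℝ := max 1 (1 / (η * Real.log 2)) with hK
  have hK1 : 1 ≤ K := le_max_left _ _
  set P : ℕ := ⌈(2 : ℝ) ^ (1 / η)⌉₊ with hP
  refine ⟨K ^ P, one_le_pow₀ hK1, fun n hn => ?_⟩
  have key : ∀ p ∈ n.primeFactors, ((n.factorization p + 1 : ℕ) : ℝ) ≤
      (if p < P then K else 1) * ((p : ℝ) ^ (n.factorization p)) ^ η := by
    intro p hp
    have hpp := Nat.prime_of_mem_primeFactors hp
    have hp2 : (2 : ℝ) ≤ p := by exact_mod_cast hpp.two_le
    set a := n.factorization p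
    have hpow : ((p : ℝ) ^ a) ^ η = ((p : ℝ) ^ η) ^ a := by
      rw [← Real.rpow_natCast, ← Real.rpow_natCast, ← Real.rpow_mul (by positivity),
        ← Real.rpow_mul (by positivity), mul_comm]
    rw [hpow]
    push_cast
    split_ifs with h
    · have h1 : 1 + a * (η * Real.log 2) ≤ ((p : ℝ) ^ η) ^ a := by
        calc 1 + a * (η * Real.log 2) ≤ Real.exp (a * (η * Real.log 2)) := by
              linarith [Real.add_one_le_exp (a * (η * Real.log 2))]
          _ = ((2 : ℝ) ^ η) ^ a := by
              rw [Real.rpow_def_of_pos two_pos, ← Real.exp_nat_mul]; ring_nf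
          _ ≤ _ := by gcongr
      have h2 : 1 ≤ K * (η * Real.log 2) := by
        calc 1 = 1 / (η * Real.log 2) * (η * Real.log 2) := by field_simp
          _ ≤ _ := by gcongr; exact le_max_right _ _
      calc (a : ℝ) + 1 ≤ a * (K * (η * Real.log 2)) + K := by nlinarith [Nat.cast_nonneg (α := ℝ) a]
        _ = K * (1 + a * (η * Real.log 2)) := by ring
        _ ≤ _ := by gcongr
    · rw [one_mul]
      have h2 : (2 : ℝ) ≤ (p : ℝ) ^ η := by
        have : (2 : ℝ) ^ (1 / η) ≤ p := (Nat.le_ceil _).trans (by exact_mod_cast not_lt.mp h)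
        calc (2 : ℝ) = ((2 : ℝ) ^ (1 / η)) ^ η := by
              rw [← Real.rpow_mul two_pos.le]; field_simp; simp
          _ ≤ _ := by gcongr
      calc (a : ℝ) + 1 ≤ 2 ^ a := by exact_mod_cast Nat.lt_two_pow_self
        _ ≤ _ := by gcongr
  rw [Nat.card_divisors hn]
  push_cast
  calc (∏ x ∈ n.primeFactors, ((n.factorization x : ℝ) + 1))
      ≤ ∏ x ∈ n.primeFactors, ((if x < P then K else 1) * ((x : ℝ) ^ (n.factorization x)) ^ η) := by
        refine Finset.prod_le_prod (fun _ _ => by positivity) fun p hp => ?_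
        exact_mod_cast key p hp
    _ = (∏ x ∈ n.primeFactors, (if x < P then K else 1)) * (n : ℝ) ^ η := by
        rw [Finset.prod_mul_distrib, Real.finsetProd_rpow _ _ (fun _ _ => by positivity)]
        congr 2
        conv_rhs => rw [← Nat.prod_factorization_pow_eq_self hn]
        rw [Finsupp.prod, Nat.support_factorization]; push_cast; rfl
    _ ≤ K ^ P * (n : ℝ) ^ η := by
        gcongr
        rw [Finset.prod_ite]
        simp only [Finset.prod_const, one_pow, mul_one]
        refine pow_le_pow_right₀ hK1 ?_
        calc _ ≤ (Finset.range P).card := Finset.card_le_card (by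
              intro x hx; simp at hx ⊢; exact hx.2)
          _ = P := Finset.card_range P

end

section

open Real in
theorem geom_char_bound {q : ℕ} [NeZero q] (a : ZMod q) (ha : a ≠ 0) (c : ZMod q) (M : ℕ) :
    ‖∑ j ∈ Finset.range M, ZMod.stdAddChar (N := q) (a * (c + (j : ZMod q)))‖ ≤
      (q : ℝ) / 2 * (1 / a.val + 1 / (q - a.val)) := by
  have hq : 0 < (q : ℝ) := by exact_mod_cast NeZero.pos q
  set z : ℂ := ZMod.stdAddChar a with hz
  have e1 : ∀ j : ℕ, ZMod.stdAddChar (N := q) (a * (c + (j : ZMod q))) = ZMod.stdAddChar (a * c) * z ^ j := by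
    intro j
    rw [mul_add, AddChar.map_add_eq_mul, hz, ← AddChar.map_nsmul_eq_pow]
    congr 2
    rw [nsmul_eq_mul, mul_comm]
  simp_rw [e1]
  rw [← Finset.mul_sum, norm_mul, AddChar.norm_apply, one_mul]
  have hval : 0 < a.val := Nat.pos_of_ne_zero (by rwa [Ne, ZMod.val_eq_zero])
  have hvlt : a.val < q := ZMod.val_lt a
  obtain ⟨v, hv⟩ : ∃ v : ℝ, v = ((a.val : ℕ) : ℝ) := ⟨_, rfl⟩
  rw [← hv]
  have hv0 : 0 < v := by rw [hv]; exact_mod_cast hval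
  have hvq : v < q := by rw [hv]; exact_mod_cast hvlt
  have hzexp : z = Complex.exp (Complex.I * ((2 * π * (v / q) : ℝ) : ℂ)) := by
    rw [hz, ← ZMod.natCast_zmod_val a, ← Int.cast_natCast, ZMod.stdAddChar_coe]
    congr 1
    rw [hv]; push_cast; simp; ring
  have hnz : ‖z - 1‖ = 2 * Real.sin (π * (v / q)) := by
    rw [hzexp, Complex.norm_exp_I_mul_ofReal_sub_one]
    rw [show 2 * π * (v / q) / 2 = π * (v / q) by ring, Real.norm_of_nonneg]
    have : 0 ≤ Real.sin (π * (v / q)) := Real.sin_nonneg_of_nonneg_of_le_pi (by positivity)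
      (by
        have : v / q ≤ 1 := by rw [div_le_one hq]; exact hvq.le
        nlinarith [Real.pi_pos])
    positivity
  have hsin : 2 * min (v / q) (1 - v / q) ≤ Real.sin (π * (v / q)) := by
    rcases le_total (v / q) (1 / 2) with h | h
    · rw [min_eq_left (by linarith)]
      have := Real.mul_le_sin (x := π * (v / q)) (by positivity) (by nlinarith [Real.pi_pos])
      calc 2 * (v / q) = 2 / π * (π * (v / q)) := by field_simp
        _ ≤ _ := this
    · rw [min_eq_right (by linarith)]
      have h1 : v / q ≤ 1 := by rw [div_le_one hq]; exact hvq.le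
      have := Real.mul_le_sin (x := π * (1 - v / q))
        (mul_nonneg Real.pi_pos.le (by linarith)) (by nlinarith [Real.pi_pos])
      rw [← Real.sin_pi_sub (π * (v / q))]
      calc 2 * (1 - v / q) = 2 / π * (π * (1 - v / q)) := by field_simp
        _ ≤ _ := this
        _ = _ := by ring_nf
  have hm : 0 < min (v / q) (1 - v / q) := by
    apply lt_min (by positivity)
    rw [sub_pos, div_lt_one hq]; exact hvq
  have hz1 : z ≠ 1 := by
    intro h; rw [h] at hnz; simp at hnz; linarith
  rw [geom_sum_eq hz1, norm_div, hnz]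
  have hnum : ‖z ^ M - 1‖ ≤ 2 := by
    calc ‖z ^ M - 1‖ ≤ ‖z ^ M‖ + ‖(1 : ℂ)‖ := norm_sub_le _ _
      _ = 2 := by rw [norm_pow, hz, AddChar.norm_apply]; norm_num
  calc ‖z ^ M - 1‖ / (2 * Real.sin (π * (v / q)))
      ≤ 2 / (2 * (2 * min (v / q) (1 - v / q))) := by gcongr
    _ = 1 / 2 * (1 / min (v / q) (1 - v / q)) := by field_simp
    _ ≤ 1 / 2 * (1 / (v / q) + 1 / (1 - v / q)) := by
        have h1 : 0 < v / q := by positivity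
        have h2 : 0 < 1 - v / q := by rw [sub_pos, div_lt_one hq]; exact hvq
        gcongr
        rcases min_choice (v / q) (1 - v / q) with h | h <;> rw [h]
        · have : 0 < 1 / (1 - v / q) := by positivity
          linarith
        · have : 0 < 1 / (v / q) := by positivity
          linarith
    _ = _ := by
        have : (q : ℝ) - v ≠ 0 := by linarith
        have : 1 - v / q ≠ 0 := by
          have : 0 < 1 - v / q := by rw [sub_pos, div_lt_one hq]; exact hvq
          exact this.ne'
        field_simp

theorem sum_inv_val {q : ℕ} [NeZero q] :
    ∑ a ∈ (Finset.univ.filter fun a : ZMod q => a ≠ 0), ((1 : ℝ) / a.val + 1 / (q - a.val)) ≤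
      2 * (1 + Real.log q) := by
  have hq : 0 < q := NeZero.pos q
  have e : ∑ a ∈ (Finset.univ.filter fun a : ZMod q => a ≠ 0), ((1 : ℝ) / a.val + 1 / (q - a.val))
      = ∑ a ∈ Finset.Ico 1 q, ((1 : ℝ) / a + 1 / (q - a)) := by
    refine Finset.sum_bij (fun a _ => a.val) ?_ ?_ ?_ ?_
    · intro a ha
      simp only [Finset.mem_filter, Finset.mem_univ, true_and] at ha
      rw [Finset.mem_Ico]
      exact ⟨Nat.pos_of_ne_zero (by rwa [Ne, ZMod.val_eq_zero]), ZMod.val_lt a⟩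
    · intro a _ b _ h; exact ZMod.val_injective q h
    · intro b hb
      rw [Finset.mem_Ico] at hb
      refine ⟨(b : ZMod q), ?_, ZMod.val_cast_of_lt hb.2⟩
      simp only [Finset.mem_filter, Finset.mem_univ, true_and]
      rw [Ne, ← ZMod.val_eq_zero, ZMod.val_cast_of_lt hb.2]; omega
    · intro a _; rfl
  have hs : ∑ a ∈ Finset.Ico 1 q, (1 : ℝ) / (q - a) = ∑ a ∈ Finset.Ico 1 q, (1 : ℝ) / a := by
    refine Finset.sum_bij (fun a _ => q - a) ?_ ?_ ?_ ?_
    · intro a ha; rw [Finset.mem_Ico] at ha ⊢; omega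
    · intro a ha b hb h; rw [Finset.mem_Ico] at ha hb; omega
    · intro b hb; rw [Finset.mem_Ico] at hb
      exact ⟨q - b, by rw [Finset.mem_Ico]; omega, by omega⟩
    · intro a ha; rw [Finset.mem_Ico] at ha
      rw [Nat.cast_sub ha.2.le]
  rw [e, Finset.sum_add_distrib, hs, ← two_mul]
  have h1 : ∑ a ∈ Finset.Ico 1 q, (1 : ℝ) / a ≤ 1 + Real.log q := by
    have := harmonic_le_one_add_log q
    refine le_trans ?_ this
    rw [harmonic_eq_sum_Icc]
    push_cast
    simp_rw [one_div]
    refine Finset.sum_le_sum_of_subset_of_nonneg ?_ (fun _ _ _ => by positivity)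
    intro a ha; rw [Finset.mem_Ico] at ha; rw [Finset.mem_Icc]; omega
  linarith

/-- Pólya–Vinogradov for primitive characters. -/
theorem polya_vinogradov {q : ℕ} [NeZero q] (hq1 : q ≠ 1) {χ : DirichletCharacter ℂ q}
    (hχ : χ.IsPrimitive) (hinv : χ⁻¹ = χ) (c : ZMod q) (M : ℕ) :
    ‖∑ j ∈ Finset.range M, χ (c + j)‖ ≤ Real.sqrt q * (1 + Real.log q) := by
  classical
  have hq0 : 0 < (q : ℝ) := by exact_mod_cast NeZero.pos q
  have : Fact (1 < q) := ⟨by have := NeZero.pos q; omega⟩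
  have hprim : (ZMod.stdAddChar (N := q)).IsPrimitive := ZMod.isPrimitive_stdAddChar q
  have hinvp : (χ⁻¹).IsPrimitive := by rwa [hinv]
  set G := gaussSum χ⁻¹ (ZMod.stdAddChar (N := q)) with hG
  have hnorm : ‖G‖ = Real.sqrt q := by
    have h1 := gauss_prim_mul (ZMod.stdAddChar (N := q)) hprim hinvp
    rw [inv_inv, ← hG] at h1
    have h2 : gaussSum χ (ZMod.stdAddChar.mulShift (-1)) = star G := by
      rw [hG, gaussSum, gaussSum, star_sum]
      refine Finset.sum_congr rfl fun a _ => ?_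
      rw [star_mul', AddChar.mulShift_apply, neg_one_mul, AddChar.map_neg_eq_conj,
        ← MulChar.star_apply', star_star]
      rfl
    rw [h2] at h1
    have h3 : ‖G‖ ^ 2 = q := by
      have := congrArg norm h1
      rw [norm_mul, norm_star, Complex.norm_natCast] at this
      rw [sq]; exact this
    rw [← h3, Real.sqrt_sq (norm_nonneg _)]
  have hGpos : 0 < ‖G‖ := by rw [hnorm]; exact Real.sqrt_pos.mpr hq0
  have hfour : ∀ x : ZMod q, χ x * G = ∑ a : ZMod q, χ⁻¹ a * ZMod.stdAddChar (a * x) := by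
    intro x
    have := gaussSum_mulShift_of_isPrimitive (ZMod.stdAddChar (N := q)) hinvp x
    rw [inv_inv] at this
    rw [hG, ← this, gaussSum]
    refine Finset.sum_congr rfl fun a _ => ?_
    rw [AddChar.mulShift_apply, mul_comm x]
  have hsum : (∑ j ∈ Finset.range M, χ (c + j)) * G
      = ∑ a ∈ (Finset.univ.filter fun a : ZMod q => a ≠ 0), χ⁻¹ a *
        ∑ j ∈ Finset.range M, ZMod.stdAddChar (N := q) (a * (c + (j : ZMod q))) := by
    rw [Finset.sum_mul, Finset.sum_congr rfl fun (j : ℕ) _ => hfour (c + (j : ZMod q)), Finset.sum_comm]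
    simp_rw [← Finset.mul_sum]
    rw [Finset.sum_filter_of_ne]
    intro a _ h ha
    apply h
    rw [ha, MulChar.map_nonunit _ (by simp), zero_mul]
  have hb : ‖∑ j ∈ Finset.range M, χ (c + j)‖ * ‖G‖ ≤ q * (1 + Real.log q) := by
    rw [← norm_mul, hsum]
    calc _ ≤ ∑ a ∈ (Finset.univ.filter fun a : ZMod q => a ≠ 0), ‖χ⁻¹ a *
        ∑ j ∈ Finset.range M, ZMod.stdAddChar (N := q) (a * (c + (j : ZMod q)))‖ := norm_sum_le _ _
      _ ≤ ∑ a ∈ (Finset.univ.filter fun a : ZMod q => a ≠ 0),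
          (q : ℝ) / 2 * (1 / a.val + 1 / (q - a.val)) := by
        refine Finset.sum_le_sum fun a ha => ?_
        simp only [Finset.mem_filter, Finset.mem_univ, true_and] at ha
        rw [norm_mul]
        calc _ ≤ 1 * ‖∑ j ∈ Finset.range M, ZMod.stdAddChar (N := q) (a * (c + (j : ZMod q)))‖ := by
              gcongr; exact DirichletCharacter.norm_le_one _ _
          _ ≤ _ := by rw [one_mul]; exact geom_char_bound a ha c M
      _ ≤ (q : ℝ) / 2 * (2 * (1 + Real.log q)) := by
        rw [← Finset.mul_sum]
        gcongr
        exact sum_inv_val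
      _ = _ := by ring
  have : ‖∑ j ∈ Finset.range M, χ (c + j)‖ ≤ q * (1 + Real.log q) / ‖G‖ := by
    rwa [le_div_iff₀ hGpos]
  refine this.trans (le_of_eq ?_)
  rw [hnorm, div_eq_iff (Real.sqrt_pos.mpr hq0).ne']
  rw [mul_right_comm, Real.mul_self_sqrt hq0.le]

end

section

/-- The Jacobi symbol as a Dirichlet character. -/
noncomputable def jacChar (n : ℕ) [NeZero n] : DirichletCharacter ℂ n where
  toFun a := ((jacobiSym a.val n : ℤ) : ℂ)
  map_one' := by
    have : jacobiSym (((1 : ZMod n).val : ℕ) : ℤ) n = 1 := by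
      rw [ZMod.val_one_eq_one_mod]
      push_cast
      rw [← jacobiSym.mod_left, jacobiSym.one_left]
    rw [this]; simp
  map_mul' a b := by
    have : jacobiSym (((a * b).val : ℕ) : ℤ) n = jacobiSym a.val n * jacobiSym b.val n := by
      rw [ZMod.val_mul]
      push_cast
      rw [← jacobiSym.mod_left, jacobiSym.mul_left]
    rw [this]; push_cast; rfl
  map_nonunit' a ha := by
    have : jacobiSym ((a.val : ℕ) : ℤ) n = 0 := by
      rw [jacobiSym.eq_zero_iff_not_coprime]
      intro h
      apply ha
      rw [← ZMod.natCast_zmod_val a, ZMod.isUnit_iff_coprime]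
      exact_mod_cast h
    rw [this]; simp

theorem jacChar_natCast (n : ℕ) [NeZero n] (k : ℕ) :
    jacChar n (k : ZMod n) = ((jacobiSym k n : ℤ) : ℂ) := by
  change ((jacobiSym ((k : ZMod n).val : ℕ) n : ℤ) : ℂ) = _
  rw [ZMod.val_natCast]
  push_cast
  rw [← jacobiSym.mod_left]

theorem jacChar_inv (n : ℕ) [NeZero n] : (jacChar n)⁻¹ = jacChar n := by
  apply MulChar.IsQuadratic.inv
  intro a
  rw [← ZMod.natCast_zmod_val a, jacChar_natCast]
  rcases jacobiSym.trichotomy (a.val : ℤ) n with h | h | h <;> rw [h] <;> simp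

theorem jacChar_primitive (n : ℕ) [NeZero n] (hodd : Odd n) (hsq : Squarefree n) :
    (jacChar n).IsPrimitive := by
  rw [DirichletCharacter.isPrimitive_def]
  by_contra hne
  have hd := DirichletCharacter.conductor_dvd_level (jacChar n)
  set d := (jacChar n).conductor with hdd
  obtain ⟨e, he⟩ := hd
  have he1 : e ≠ 1 := by rintro rfl; apply hne; rw [mul_one] at he; exact he.symm
  obtain ⟨p, hp, f, hf⟩ : ∃ p, p.Prime ∧ p ∣ e := ⟨e.minFac, Nat.minFac_prime he1, Nat.minFac_dvd e⟩
  set m := d * f with hm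
  have hnm : n = p * m := by rw [he, hf, hm]; ring
  have hcop : Nat.Coprime p m := Nat.coprime_of_squarefree_mul (hnm ▸ hsq)
  have : Fact p.Prime := ⟨hp⟩
  have hp2 : p ≠ 2 := by
    rintro rfl
    rw [hnm] at hodd
    exact absurd (Nat.odd_mul.mp hodd).1 (by decide)
  obtain ⟨a, ha⟩ := FiniteField.exists_nonsquare (F := ZMod p) (by rwa [ZMod.ringChar_zmod_n])
  obtain ⟨u, hu1, hu2⟩ := Nat.chineseRemainder hcop a.val 1
  have hup : (u : ZMod p) = a := by
    rw [← ZMod.natCast_zmod_val a]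
    exact (ZMod.natCast_eq_natCast_iff _ _ _).mpr hu1
  have hm0 : NeZero m := ⟨by rintro h; rw [h] at hnm; simp at hnm; exact NeZero.ne n hnm⟩
  have hp0 : NeZero p := ⟨hp.ne_zero⟩
  have h1 : jacobiSym u n = -1 := by
    rw [hnm, jacobiSym.mul_right, ← jacobiSym.legendreSym.to_jacobiSym]
    have e1 : legendreSym p u = -1 := by
      rw [legendreSym.eq_neg_one_iff]
      push_cast
      rwa [hup]
    have e2 : jacobiSym u m = 1 := by
      rw [jacobiSym.mod_left]
      have : ((u : ℤ) % (m : ℤ)) = 1 % (m : ℤ) := by exact_mod_cast hu2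
      rw [this, ← jacobiSym.mod_left, jacobiSym.one_left]
    rw [e1, e2]; norm_num
  have hfac := DirichletCharacter.factorsThrough_conductor (jacChar n)
  rw [← hdd] at hfac
  obtain ⟨hdn, χ0, hχ0⟩ := hfac
  have hun : IsUnit (u : ZMod n) := by
    rw [ZMod.isUnit_iff_coprime]
    have : jacobiSym u n ≠ 0 := by rw [h1]; norm_num
    rw [Ne, jacobiSym.eq_zero_iff_not_coprime, not_not] at this
    exact_mod_cast this
  have h2 := jacChar_natCast n u
  rw [h1, hχ0, ← hun.unit_spec, DirichletCharacter.changeLevel_eq_cast_of_dvd χ0 hdn, hun.unit_spec,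
    ZMod.cast_natCast hdn] at h2
  have h3 : (u : ZMod d) = 1 := by
    have := (ZMod.natCast_eq_natCast_iff u 1 m).mpr hu2
    have h4 := congrArg (ZMod.castHom (show d ∣ m from ⟨f, rfl⟩) (ZMod d)) this
    simpa only [map_natCast, Nat.cast_one, map_one] using h4
  rw [h3, map_one] at h2
  norm_num at h2

theorem jac_prim_sum (n : ℕ) (hodd : Odd n) (hsq : Squarefree n) (h1 : n ≠ 1) (r M : ℕ) :
    |∑ j ∈ Finset.range M, ((jacobiSym ((8 * j + r : ℕ) : ℤ) n : ℤ) : ℝ)| ≤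
      Real.sqrt n * (1 + Real.log n) := by
  have : NeZero n := ⟨hodd.pos.ne'⟩
  have hu : IsUnit ((8 : ℕ) : ZMod n) := by
    rw [ZMod.isUnit_iff_coprime]
    exact Nat.Coprime.pow_left 3 (Nat.coprime_two_left.mpr hodd)
  obtain ⟨b, hb⟩ := hu.exists_right_inv
  have key : ∀ j : ℕ, (((jacobiSym ((8 * j + r : ℕ) : ℤ) n : ℤ) : ℝ) : ℂ) =
      jacChar n ((8 : ℕ) : ZMod n) * jacChar n (b * r + (j : ZMod n)) := by
    intro j
    rw [← map_mul, mul_add, ← mul_assoc, hb, one_mul]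
    have := jacChar_natCast n (8 * j + r)
    rw [Complex.ofReal_intCast, ← this]
    congr 1
    push_cast; ring
  have hn : |∑ j ∈ Finset.range M, ((jacobiSym ((8 * j + r : ℕ) : ℤ) n : ℤ) : ℝ)| =
      ‖((∑ j ∈ Finset.range M, ((jacobiSym ((8 * j + r : ℕ) : ℤ) n : ℤ) : ℝ) : ℝ) : ℂ)‖ := by
    rw [Complex.norm_real, Real.norm_eq_abs]
  rw [hn, Complex.ofReal_sum, Finset.sum_congr rfl fun j _ => key j, ← Finset.mul_sum, norm_mul]
  calc _ ≤ 1 * ‖∑ j ∈ Finset.range M, jacChar n (b * r + (j : ZMod n))‖ := by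
        gcongr; exact DirichletCharacter.norm_le_one _ _
    _ ≤ _ := by
        rw [one_mul]
        exact polya_vinogradov h1 (jacChar_primitive n hodd hsq) (jacChar_inv n) _ _

/-- integers up to `N` in a residue class mod 8 -/
def cls (N r : ℕ) : Finset ℕ := (Finset.Icc 1 N).filter (fun k => k % 8 = r)

theorem mem_cls {N r k : ℕ} : k ∈ cls N r ↔ (1 ≤ k ∧ k ≤ N) ∧ k % 8 = r := by
  simp [cls]

theorem cls_eq (N r : ℕ) (hr : r < 8) (hr0 : r ≠ 0) :
    cls N r = (Finset.range ((N + 8 - r) / 8)).image (fun j => 8 * j + r) := by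
  ext k
  rw [mem_cls, Finset.mem_image]
  simp only [Finset.mem_range]
  constructor
  · rintro ⟨⟨h1, h2⟩, h3⟩
    exact ⟨k / 8, by omega, by omega⟩
  · rintro ⟨j, hj, rfl⟩
    omega

theorem sum_cls (N r : ℕ) (hr : r < 8) (hr0 : r ≠ 0) (f : ℕ → ℝ) :
    ∑ k ∈ cls N r, f k = ∑ j ∈ Finset.range ((N + 8 - r) / 8), f (8 * j + r) := by
  rw [cls_eq N r hr hr0, Finset.sum_image]
  intro a _ b _ h
  simp only at h; omega

theorem card_cls (N r : ℕ) (hr : r < 8) (hr0 : r ≠ 0) :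
    |((cls N r).card : ℝ) - (N : ℝ) / 8| ≤ 1 := by
  have : (cls N r).card = (N + 8 - r) / 8 := by
    rw [cls_eq N r hr hr0, Finset.card_image_of_injective, Finset.card_range]
    intro a b h; simp only at h; omega
  rw [this, abs_le]
  set x := (N + 8 - r) / 8 with hx
  have h1 : (N : ℝ) ≤ 8 * x + 8 := by exact_mod_cast (by omega : N ≤ 8 * x + 8)
  have h2 : (8 : ℝ) * x ≤ N + 8 := by exact_mod_cast (by omega : 8 * x ≤ N + 8)
  constructor <;> linarith

/-- Jacobi symbol sum over a residue class. -/
noncomputable def JS (N r n : ℕ) : ℝ := ∑ k ∈ cls N r, ((jacobiSym (k : ℤ) n : ℤ) : ℝ)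

theorem JS_prim (N r n : ℕ) (hr : r < 8) (hr0 : r ≠ 0) (hodd : Odd n) (hsq : Squarefree n)
    (h1 : n ≠ 1) : |JS N r n| ≤ Real.sqrt n * (1 + Real.log n) := by
  unfold JS
  rw [sum_cls N r hr hr0]
  exact jac_prim_sum n hodd hsq h1 r _

end

section

open ArithmeticFunction in
theorem sum_moebius_gcd (k l : ℕ) (hl : l ≠ 0) :
    ∑ e ∈ l.divisors with e ∣ k, (moebius e : ℝ) = if Nat.Coprime k l then 1 else 0 := by
  have h1 : l.divisors.filter (fun e => e ∣ k) = (Nat.gcd k l).divisors := by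
    ext e
    simp only [Finset.mem_filter, Nat.mem_divisors, Nat.dvd_gcd_iff]
    have : Nat.gcd k l ≠ 0 := Nat.gcd_ne_zero_right hl
    tauto
  rw [h1]
  have h2 := ArithmeticFunction.coe_mul_zeta_apply (f := moebius) (x := Nat.gcd k l)
  rw [moebius_mul_coe_zeta, ArithmeticFunction.one_apply] at h2
  have h3 : ((∑ i ∈ (k.gcd l).divisors, moebius i : ℤ) : ℝ) = ((if k.gcd l = 1 then 1 else 0 : ℤ) : ℝ) := by
    rw [← h2]
  push_cast at h3
  rw [h3]

theorem jac_sq (k l n0 : ℕ) (hl : l ≠ 0) (hn : n0 ≠ 0) :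
    jacobiSym (k : ℤ) (l ^ 2 * n0) = if Nat.Coprime k l then jacobiSym k n0 else 0 := by
  have : NeZero l := ⟨hl⟩
  have : NeZero n0 := ⟨hn⟩
  rw [jacobiSym.mul_right, jacobiSym.pow_right]
  split_ifs with h
  · rw [jacobiSym.sq_one (by exact_mod_cast h), one_mul]
  · have : jacobiSym (k : ℤ) l = 0 := by
      rw [jacobiSym.eq_zero_iff_not_coprime]; exact_mod_cast h
    rw [this]; ring

theorem odd_sq_mod8 (e : ℕ) (he : Odd e) : (e * e) % 8 = 1 := by
  have : e % 8 = 1 ∨ e % 8 = 3 ∨ e % 8 = 5 ∨ e % 8 = 7 := by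
    rw [Nat.odd_iff] at he; omega
  rcases this with h | h | h | h <;> rw [Nat.mul_mod, h]

theorem sum_cls_dvd (N r e : ℕ) (hr : r < 8) (he : Odd e) (f : ℕ → ℝ) :
    ∑ k ∈ cls N r with e ∣ k, f k = ∑ k ∈ cls (N / e) (r * e % 8), f (e * k) := by
  have he0 : 0 < e := he.pos
  have h8 := odd_sq_mod8 e he
  have : (cls N r).filter (fun k => e ∣ k) = (cls (N / e) (r * e % 8)).image (fun k => e * k) := by
    ext k
    simp only [Finset.mem_filter, mem_cls, Finset.mem_image]
    constructor
    · rintro ⟨⟨⟨h1, h2⟩, h3⟩, ⟨c, rfl⟩⟩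
      refine ⟨c, ⟨⟨Nat.pos_of_mul_pos_left h1, ?_⟩, ?_⟩, rfl⟩
      · rw [Nat.le_div_iff_mul_le he0]; linarith [mul_comm e c]
      · rw [← h3, Nat.mod_mul_mod, mul_right_comm, Nat.mul_mod, h8]; simp
    · rintro ⟨c, ⟨⟨h1, h2⟩, h3⟩, rfl⟩
      rw [Nat.le_div_iff_mul_le he0] at h2
      refine ⟨⟨⟨Nat.mul_pos he0 h1, by linarith [mul_comm e c]⟩, ?_⟩, dvd_mul_right _ _⟩
      rw [Nat.mul_mod, h3, ← Nat.mul_mod, mul_left_comm, Nat.mul_mod, h8]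
      simp; omega
  rw [this, Finset.sum_image]
  intro a _ b _ h
  exact Nat.eq_of_mul_eq_mul_left he0 h

theorem JS_decomp (N r l n0 : ℕ) (hr : r < 8) (hl : Odd l) (hn : n0 ≠ 0) :
    JS N r (l ^ 2 * n0) = ∑ e ∈ l.divisors, (ArithmeticFunction.moebius e : ℝ) *
      ((jacobiSym e n0 : ℤ) : ℝ) * JS (N / e) (r * e % 8) n0 := by
  have hl0 : l ≠ 0 := hl.pos.ne'
  unfold JS
  have h1 : ∀ k ∈ cls N r, ((jacobiSym (k : ℤ) (l ^ 2 * n0) : ℤ) : ℝ) =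
      ∑ e ∈ l.divisors, if e ∣ k then (ArithmeticFunction.moebius e : ℝ) * ((jacobiSym k n0 : ℤ) : ℝ)
        else 0 := by
    intro k _
    rw [jac_sq k l n0 hl0 hn, ← Finset.sum_filter, ← Finset.sum_mul, sum_moebius_gcd k l hl0]
    split_ifs <;> simp
  rw [Finset.sum_congr rfl h1, Finset.sum_comm]
  refine Finset.sum_congr rfl fun e he => ?_
  have heo : Odd e := hl.of_dvd_nat (Nat.dvd_of_mem_divisors he)
  rw [← Finset.sum_filter, sum_cls_dvd N r e hr heo, Finset.mul_sum]
  refine Finset.sum_congr rfl fun k _ => ?_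
  push_cast
  rw [jacobiSym.mul_left]
  push_cast; ring

theorem mod8_odd {r e : ℕ} (hr : Odd r) (he : Odd e) : r * e % 8 ≠ 0 := by
  have := Nat.odd_iff.mp (hr.mul he)
  omega

theorem abs_moebius_le (e : ℕ) : |(ArithmeticFunction.moebius e : ℝ)| ≤ 1 := by
  exact_mod_cast ArithmeticFunction.abs_moebius_le_one (n := e)

theorem abs_jac_le (k : ℤ) (n : ℕ) : |((jacobiSym k n : ℤ) : ℝ)| ≤ 1 := by
  rcases jacobiSym.trichotomy k n with h | h | h <;> rw [h] <;> norm_num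

theorem JS_nonsq (N r l n0 : ℕ) (hr : r < 8) (hro : Odd r) (hl : Odd l) (hn : Odd n0)
    (hsq : Squarefree n0) (h1 : n0 ≠ 1) :
    |JS N r (l ^ 2 * n0)| ≤ l.divisors.card * (Real.sqrt n0 * (1 + Real.log n0)) := by
  rw [JS_decomp N r l n0 hr hl hn.pos.ne']
  refine (Finset.abs_sum_le_sum_abs _ _).trans ?_
  rw [← nsmul_eq_mul]
  refine Finset.sum_le_card_nsmul _ _ _ fun e he => ?_
  have heo : Odd e := hl.of_dvd_nat (Nat.dvd_of_mem_divisors he)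
  rw [abs_mul, abs_mul]
  have h2 := JS_prim (N / e) (r * e % 8) n0 (Nat.mod_lt _ (by norm_num)) (mod8_odd hro heo) hn hsq h1
  calc _ ≤ 1 * 1 * |JS (N / e) (r * e % 8) n0| := by
        gcongr
        · exact abs_moebius_le e
        · exact abs_jac_le _ _
    _ ≤ _ := by simpa using h2

theorem JS_one (N r : ℕ) (hr : r < 8) (hr0 : r ≠ 0) : |JS N r 1 - (N : ℝ) / 8| ≤ 1 := by
  unfold JS
  simp only [jacobiSym.one_right, Int.cast_one, Finset.sum_const, nsmul_eq_mul, mul_one]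
  exact card_cls N r hr hr0

theorem JS_sq (N r l : ℕ) (hr : r < 8) (hro : Odd r) (hl : Odd l) (hsq : Squarefree l) :
    |JS N r (l ^ 2) - (∏ p ∈ l.primeFactors, (1 - (p : ℝ)⁻¹)) * (N / 8)| ≤ 2 * l.divisors.card := by
  have hm : ∏ p ∈ l.primeFactors, (1 - (p : ℝ)⁻¹) =
      ∑ e ∈ l.divisors, (ArithmeticFunction.moebius e : ℝ) * (e : ℝ)⁻¹ := by
    let f : ArithmeticFunction ℝ := ⟨fun n => (n : ℝ)⁻¹, by simp⟩
    have hf : f.IsMultiplicative := by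
      refine ⟨by simp [f], fun {m n} _ => ?_⟩
      simp [f, mul_comm]
    have := ArithmeticFunction.IsMultiplicative.prodPrimeFactors_one_sub_of_squarefree f hf hsq
    simpa [f] using this
  have h0 := JS_decomp N r l 1 hr hl one_ne_zero
  rw [mul_one] at h0
  rw [h0, hm, Finset.sum_mul, ← Finset.sum_sub_distrib]
  refine (Finset.abs_sum_le_sum_abs _ _).trans ?_
  rw [mul_comm, ← nsmul_eq_mul]
  refine Finset.sum_le_card_nsmul _ _ _ fun e he => ?_
  have heo : Odd e := hl.of_dvd_nat (Nat.dvd_of_mem_divisors he)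
  rw [jacobiSym.one_right, Int.cast_one, mul_one, mul_assoc, ← mul_sub, abs_mul]
  have h2 := JS_one (N / e) (r * e % 8) (Nat.mod_lt _ (by norm_num)) (mod8_odd hro heo)
  have he0 : (0 : ℝ) < e := by exact_mod_cast heo.pos
  have h3 : |((N / e : ℕ) : ℝ) / 8 - (e : ℝ)⁻¹ * (N / 8)| ≤ 1 := by
    have a1 : ((N / e : ℕ) : ℝ) ≤ N / e := Nat.cast_div_le
    have a2 : (N : ℝ) / e < ((N / e : ℕ) : ℝ) + 1 := by
      rw [div_lt_iff₀ he0]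
      exact_mod_cast (Nat.lt_mul_of_div_lt (Nat.lt_succ_self _) heo.pos)
    have a3 : (e : ℝ)⁻¹ * (N / 8) = (N / e) / 8 := by field_simp
    rw [a3, abs_le]; constructor <;> linarith
  calc _ ≤ 1 * |JS (N / e) (r * e % 8) 1 - (e : ℝ)⁻¹ * (N / 8)| := by
        gcongr; exact abs_moebius_le e
    _ ≤ |JS (N / e) (r * e % 8) 1 - ((N / e : ℕ) : ℝ) / 8| +
        |((N / e : ℕ) : ℝ) / 8 - (e : ℝ)⁻¹ * (N / 8)| := by
        rw [one_mul]; exact abs_sub_le _ _ _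
    _ ≤ 2 := by linarith

end

section

open Classical in
/-- density of units for squares -/
noncomputable def rho (n : ℕ) : ℝ :=
  if IsSquare n then ∏ p ∈ n.primeFactors, (1 - (p : ℝ)⁻¹) else 0

theorem coprime_radical_iff (k b : ℕ) (hk : k ≠ 0) (hb : b ≠ 0) :
    Nat.Coprime k (UniqueFactorizationMonoid.radical b) ↔ Nat.Coprime k b := by
  rw [← Nat.disjoint_primeFactors hk hb, ← Nat.disjoint_primeFactors hk
    UniqueFactorizationMonoid.radical_ne_zero, Nat.primeFactors_radical]

theorem JS_radical (N r b : ℕ) (hb : b ≠ 0) :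
    JS N r (b ^ 2) = JS N r ((UniqueFactorizationMonoid.radical b) ^ 2) := by
  unfold JS
  refine Finset.sum_congr rfl fun k hk => ?_
  rw [mem_cls] at hk
  have h1 := jac_sq k b 1 hb one_ne_zero
  have h2 := jac_sq k (UniqueFactorizationMonoid.radical b) 1
    UniqueFactorizationMonoid.radical_ne_zero one_ne_zero
  rw [mul_one] at h1 h2
  rw [h1, h2]
  simp only [coprime_radical_iff k b (by omega) hb]

theorem one_add_log_le (η : ℝ) (hη : 0 < η) (n : ℕ) (hn : n ≠ 0) :
    1 + Real.log n ≤ (1 + 1 / η) * (n : ℝ) ^ η := by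
  have h1 : Real.log n ≤ (n : ℝ) ^ η / η := Real.log_le_rpow_div (Nat.cast_nonneg n) hη
  have h2 : (1 : ℝ) ≤ (n : ℝ) ^ η :=
    Real.one_le_rpow (by exact_mod_cast Nat.one_le_iff_ne_zero.mpr hn) hη.le
  calc 1 + Real.log n ≤ (n : ℝ) ^ η + (n : ℝ) ^ η / η := by linarith
    _ = _ := by ring

/-- Bound for Jacobi sums in progressions. -/
theorem JS_bound (η : ℝ) (hη : 0 < η) : ∃ C : ℝ, 1 ≤ C ∧ ∀ N r n : ℕ, r < 8 → Odd r → Odd n →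
    |JS N r n - rho n * (N / 8)| ≤ C * (n : ℝ) ^ (1 / 2 + η) := by
  obtain ⟨C, hC1, hC⟩ := divisor_bound η hη
  refine ⟨2 * C * (1 + 1 / η), ?_, fun N r n hr hro hn => ?_⟩
  · have : 0 < 1 / η := by positivity
    nlinarith
  have hη' : 0 < 1 / η := by positivity
  have hn0 : n ≠ 0 := hn.pos.ne'
  obtain ⟨a, b, hab, hsq⟩ := Nat.sq_mul_squarefree n
  have hb0 : b ≠ 0 := by rintro rfl; simp at hab; omega
  have ha0 : a ≠ 0 := hsq.ne_zero
  have hn1 : (1 : ℝ) ≤ n := by exact_mod_cast hn.pos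
  have ho : Odd (b ^ 2) ∧ Odd a := by rw [← hab] at hn; exact Nat.odd_mul.mp hn
  have hbo : Odd b := by
    have := ho.1
    rwa [Nat.odd_pow_iff two_ne_zero] at this
  have hcast : (n : ℝ) = (b : ℝ) ^ 2 * a := by rw [← hab]; push_cast; ring
  have hb1 : (1 : ℝ) ≤ b := by exact_mod_cast hbo.pos
  have ha1 : (1 : ℝ) ≤ a := by exact_mod_cast ho.2.pos
  by_cases ha : a = 1
  · subst ha
    rw [mul_one] at hab
    have hsqn : IsSquare n := ⟨b, by rw [← hab, sq]⟩
    set l := UniqueFactorizationMonoid.radical b with hl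
    have hlo : Odd l := hbo.of_dvd_nat UniqueFactorizationMonoid.radical_dvd_self
    have h1 := JS_sq N r l hr hro hlo UniqueFactorizationMonoid.squarefree_radical
    have h2 : rho n = ∏ p ∈ l.primeFactors, (1 - (p : ℝ)⁻¹) := by
      unfold rho
      rw [if_pos hsqn, hl, Nat.primeFactors_radical, ← hab, Nat.primeFactors_pow _ two_ne_zero]
    rw [h2, ← hab, JS_radical N r b hb0, ← hl]
    refine h1.trans ?_
    have h3 := hC l hlo.pos.ne'
    have hln : (l : ℝ) ≤ ((b ^ 2 : ℕ) : ℝ) := by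
      have : l ≤ b := Nat.le_of_dvd hbo.pos UniqueFactorizationMonoid.radical_dvd_self
      exact_mod_cast this.trans (Nat.le_self_pow two_ne_zero b)
    rw [hab] at hln ⊢
    calc 2 * (l.divisors.card : ℝ) ≤ 2 * (C * (l : ℝ) ^ η) := by gcongr
      _ ≤ 2 * (C * (n : ℝ) ^ η) := by gcongr
      _ ≤ 2 * (C * (n : ℝ) ^ (1 / 2 + η)) := by
          gcongr 2 * (C * ?_)
          exact Real.rpow_le_rpow_of_exponent_le hn1 (by linarith)
      _ = 2 * C * 1 * (n : ℝ) ^ (1 / 2 + η) := by ring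
      _ ≤ _ := by gcongr; linarith
  · have hsqn : ¬ IsSquare n := by
      rintro ⟨c, hc⟩
      apply ha
      have : IsSquare a := by
        have hbc : b ∣ c := by
          rw [← Nat.pow_dvd_pow_iff two_ne_zero, sq c, ← hc, ← hab]; exact dvd_mul_right _ _
        obtain ⟨e, rfl⟩ := hbc
        refine ⟨e, ?_⟩
        have : b ^ 2 * a = b ^ 2 * (e * e) := by rw [hab, hc]; ring
        exact Nat.eq_of_mul_eq_mul_left (pow_pos hbo.pos 2) this
      obtain ⟨e, he⟩ := this
      have := hsq e ⟨1, by rw [mul_one]; exact he⟩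
      rw [Nat.isUnit_iff] at this
      rw [he, this]
    have h2 : rho n = 0 := by unfold rho; rw [if_neg hsqn]
    rw [h2, zero_mul, sub_zero]
    conv_lhs => rw [← hab]
    refine (JS_nonsq N r b a hr hro hbo ho.2 hsq ha).trans ?_
    have h3 := hC b hb0
    have h4 := one_add_log_le η hη a ha0
    have h5 : 0 ≤ 1 + Real.log a := by have := Real.log_nonneg ha1; linarith
    calc (b.divisors.card : ℝ) * (Real.sqrt a * (1 + Real.log a))
        ≤ C * (b : ℝ) ^ η * (Real.sqrt a * ((1 + 1 / η) * (a : ℝ) ^ η)) := by gcongr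
      _ = C * (1 + 1 / η) * (Real.sqrt a * ((b : ℝ) * a) ^ η) := by
          rw [Real.mul_rpow (by positivity) (by positivity)]; ring
      _ ≤ C * (1 + 1 / η) * (Real.sqrt n * (n : ℝ) ^ η) := by
          gcongr
          · exact Nat.le_of_dvd hn.pos ⟨b ^ 2, by rw [← hab, mul_comm]⟩
          · rw [hcast]; nlinarith
      _ = C * (1 + 1 / η) * (n : ℝ) ^ (1 / 2 + η) := by
          rw [Real.sqrt_eq_rpow, ← Real.rpow_add (by linarith)]
      _ ≤ 2 * (C * (1 + 1 / η) * (n : ℝ) ^ (1 / 2 + η)) := by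
          have : 0 ≤ C * (1 + 1 / η) * (n : ℝ) ^ (1 / 2 + η) := by positivity
          linarith
      _ = _ := by ring

theorem rho_nonneg (n : ℕ) : 0 ≤ rho n := by
  unfold rho
  split_ifs
  · refine Finset.prod_nonneg fun p hp => ?_
    have := (Nat.prime_of_mem_primeFactors hp).one_lt
    rw [sub_nonneg]
    exact inv_le_one_of_one_le₀ (by exact_mod_cast this.le)
  · exact le_refl 0

theorem rho_le_one (n : ℕ) : rho n ≤ 1 := by
  unfold rho
  split_ifs
  · refine Finset.prod_le_one (fun p hp => ?_) fun p hp => ?_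
    · have := (Nat.prime_of_mem_primeFactors hp).one_lt
      rw [sub_nonneg]
      exact inv_le_one_of_one_le₀ (by exact_mod_cast this.le)
    · have : 0 ≤ (p : ℝ)⁻¹ := by positivity
      linarith
  · exact zero_le_one

end

section

theorem sq_dvd_iff (d a b : ℕ) (ha : Squarefree a) (hb : b ≠ 0) : d ^ 2 ∣ b ^ 2 * a ↔ d ∣ b := by
  constructor
  · intro h
    have hg : 0 < Nat.gcd d b := Nat.gcd_pos_of_pos_right _ (Nat.pos_of_ne_zero hb)
    obtain ⟨g, d', b', hg', hcop, hd, hb'⟩ := Nat.exists_coprime' hg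
    rw [hd, hb', mul_pow, mul_pow, mul_right_comm] at h
    have h2 : d' ^ 2 ∣ b' ^ 2 * a :=
      Nat.dvd_of_mul_dvd_mul_right (pow_pos hg' 2) h
    have h3 : d' ^ 2 ∣ a := (Nat.Coprime.pow 2 2 hcop).dvd_of_dvd_mul_left h2
    have h4 := ha d' (by rwa [← sq])
    rw [Nat.isUnit_iff] at h4
    rw [hd, hb', h4, one_mul]; exact dvd_mul_left _ _
  · intro h
    exact (pow_dvd_pow_of_dvd h 2).trans (dvd_mul_right _ _)

theorem squarefree_sum (k N : ℕ) (hk : k ≠ 0) (hkN : k ≤ N) :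
    ∑ d ∈ Finset.Icc 1 N with d ^ 2 ∣ k, (ArithmeticFunction.moebius d : ℝ) =
      if Squarefree k then 1 else 0 := by
  obtain ⟨a, b, hab, hsq⟩ := Nat.sq_mul_squarefree k
  have hb0 : b ≠ 0 := by rintro rfl; simp at hab; exact hk hab.symm
  have h1 : (Finset.Icc 1 N).filter (fun d => d ^ 2 ∣ k) = b.divisors.filter (fun d => d ∣ b) := by
    ext d
    simp only [Finset.mem_filter, Finset.mem_Icc, Nat.mem_divisors]
    rw [← hab, sq_dvd_iff d a b hsq hb0]
    constructor
    · rintro ⟨_, h⟩; exact ⟨⟨h, hb0⟩, h⟩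
    · rintro ⟨⟨h, _⟩, _⟩
      refine ⟨⟨Nat.pos_of_dvd_of_pos h (Nat.pos_of_ne_zero hb0), ?_⟩, h⟩
      have h2 : d ≤ b := Nat.le_of_dvd (Nat.pos_of_ne_zero hb0) h
      have h3 : b ∣ k := ⟨b * a, by rw [← hab]; ring⟩
      exact h2.trans ((Nat.le_of_dvd (Nat.pos_of_ne_zero hk) h3).trans hkN)
  rw [h1, sum_moebius_gcd b b hb0]
  have : Nat.Coprime b b ↔ Squarefree k := by
    rw [Nat.coprime_self]
    constructor
    · rintro rfl; rw [← hab]; simpa using hsq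
    · intro h
      have := h b ⟨a, by rw [← hab]; ring⟩
      rwa [Nat.isUnit_iff] at this
  simp only [this]

/-- squarefree Jacobi sums -/
noncomputable def SF (N r n : ℕ) : ℝ :=
  ∑ k ∈ cls N r with Squarefree k, ((jacobiSym (k : ℤ) n : ℤ) : ℝ)

theorem SF_decomp (N r n : ℕ) (hr : r < 8) (hro : Odd r) (hn : Odd n) :
    SF N r n = ∑ d ∈ Finset.Icc 1 N, if Nat.Coprime d (2 * n) then
      (ArithmeticFunction.moebius d : ℝ) * JS (N / d ^ 2) r n else 0 := by
  unfold SF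
  rw [Finset.sum_filter]
  have h1 : ∀ k ∈ cls N r, (if Squarefree k then ((jacobiSym (k : ℤ) n : ℤ) : ℝ) else 0) =
      ∑ d ∈ Finset.Icc 1 N, if d ^ 2 ∣ k then (ArithmeticFunction.moebius d : ℝ) *
        ((jacobiSym (k : ℤ) n : ℤ) : ℝ) else 0 := by
    intro k hk
    rw [mem_cls] at hk
    rw [← Finset.sum_filter, ← Finset.sum_mul, squarefree_sum k N (by omega) hk.1.2]
    split_ifs <;> simp
  rw [Finset.sum_congr rfl h1, Finset.sum_comm]
  refine Finset.sum_congr rfl fun d hd => ?_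
  rw [Finset.mem_Icc] at hd
  rw [← Finset.sum_filter]
  by_cases hdo : Odd d
  · have ho2 : Odd (d ^ 2) := hdo.pow
    rw [sum_cls_dvd N r (d ^ 2) hr ho2]
    have hr2 : r * d ^ 2 % 8 = r := by
      rw [Nat.mul_mod, sq, odd_sq_mod8 d hdo]; omega
    rw [hr2]
    have h3 : ∀ k : ℕ, jacobiSym ((d ^ 2 * k : ℕ) : ℤ) n =
        if Nat.Coprime d n then jacobiSym (k : ℤ) n else 0 := by
      intro k
      push_cast
      rw [jacobiSym.mul_left]
      split_ifs with h
      · rw [jacobiSym.sq_one' (by exact_mod_cast h), one_mul]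
      · rw [jacobiSym.pow_left]
        have : jacobiSym (d : ℤ) n = 0 := by
          have : NeZero n := ⟨hn.pos.ne'⟩
          rw [jacobiSym.eq_zero_iff_not_coprime]; exact_mod_cast h
        rw [this]; ring
    simp_rw [h3]
    have h4 : Nat.Coprime d (2 * n) ↔ Nat.Coprime d n := by
      rw [Nat.coprime_mul_iff_right]
      have := Nat.coprime_two_right.mpr hdo
      tauto
    simp only [h4]
    split_ifs with h
    · unfold JS; rw [Finset.mul_sum]
    · simp
  · have h5 : ¬ Nat.Coprime d (2 * n) := by
      intro h
      exact hdo (Nat.coprime_two_right.mp (Nat.Coprime.coprime_mul_right_right h))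
    rw [if_neg h5]
    apply Finset.sum_eq_zero
    intro k hk
    rw [Finset.mem_filter, mem_cls] at hk
    exfalso
    apply hdo
    have hko : Odd k := by
      rw [Nat.odd_iff] at hro ⊢; omega
    exact (hko.of_dvd_nat hk.2).of_dvd_nat (dvd_pow_self d two_ne_zero)

/-- `∑_{(d,m)=1} μ(d)/d²` -/
noncomputable def Smu (m : ℕ) : ℝ :=
  ∑' d : ℕ, if Nat.Coprime d m then (ArithmeticFunction.moebius d : ℝ) / (d : ℝ) ^ 2 else 0

theorem summable_Smu (m : ℕ) : Summable fun d : ℕ =>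
    if Nat.Coprime d m then (ArithmeticFunction.moebius d : ℝ) / (d : ℝ) ^ 2 else 0 := by
  refine Summable.of_norm_bounded (g := fun d : ℕ => 1 / (d : ℝ) ^ 2)
    (Real.summable_one_div_nat_pow.mpr one_lt_two) fun d => ?_
  split_ifs
  · rw [norm_div, norm_pow, Real.norm_natCast, Real.norm_eq_abs]
    gcongr
    exact abs_moebius_le d
  · simp

open ArithmeticFunction in
theorem Smu_eq (m : ℕ) [NeZero m] :
    Smu m = 6 / Real.pi ^ 2 * ∏ p ∈ m.primeFactors, (1 - ((p : ℝ) ^ 2)⁻¹)⁻¹ := by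
  have h2 : (1 : ℝ) < (2 : ℂ).re := by norm_num
  have h := DirichletCharacter.LSeries.mul_mu_eq_one (1 : DirichletCharacter ℂ m) h2
  rw [← DirichletCharacter.LFunction_eq_LSeries _ h2] at h
  have h3 := DirichletCharacter.LFunctionTrivChar_eq_mul_riemannZeta (N := m) (s := 2) (by norm_num)
  rw [DirichletCharacter.LFunctionTrivChar] at h3
  rw [h3, riemannZeta_two] at h
  have h4 : LSeries ((fun n : ℕ => (1 : DirichletCharacter ℂ m) n) * (fun n : ℕ => (moebius n : ℂ))) 2
      = ((Smu m : ℝ) : ℂ) := by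
    unfold LSeries Smu
    rw [Complex.ofReal_tsum]
    refine tsum_congr fun n => ?_
    rw [LSeries.term_def]
    by_cases hn : n = 0
    · simp [hn]
    · rw [if_neg hn]
      simp only [Pi.mul_apply]
      by_cases hc : Nat.Coprime n m
      · rw [if_pos hc, MulChar.one_apply ((ZMod.isUnit_iff_coprime n m).mpr hc), one_mul]
        push_cast
        congr 1
        norm_cast
      · rw [if_neg hc, MulChar.map_nonunit _ (by rwa [ZMod.isUnit_iff_coprime])]
        simp
  have h5 : (∏ p ∈ m.primeFactors, (1 - (p : ℂ) ^ (-2 : ℂ))) * ((Real.pi : ℂ) ^ 2 / 6) * (Smu m : ℝ) = 1 := by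
    rw [← h4]; exact h
  have h6 : (∏ p ∈ m.primeFactors, (1 - (p : ℂ) ^ (-2 : ℂ))) =
      ((∏ p ∈ m.primeFactors, (1 - ((p : ℝ) ^ 2)⁻¹) : ℝ) : ℂ) := by
    push_cast
    refine Finset.prod_congr rfl fun p _ => ?_
    rw [Complex.cpow_neg]
    congr 2
    norm_cast
  rw [h6] at h5
  have h7 : (∏ p ∈ m.primeFactors, (1 - ((p : ℝ) ^ 2)⁻¹)) * (Real.pi ^ 2 / 6) * Smu m = 1 := by
    exact_mod_cast h5
  have hpi := Real.pi_ne_zero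
  have hP : (∏ p ∈ m.primeFactors, (1 - ((p : ℝ) ^ 2)⁻¹)) ≠ 0 := by
    intro h0; rw [h0] at h7; simp at h7
  rw [Finset.prod_inv_distrib]
  generalize (∏ p ∈ m.primeFactors, (1 - ((p : ℝ) ^ 2)⁻¹)) = P at h7 hP ⊢
  field_simp
  field_simp at h7
  linarith

end

section

/-- `∏_{p ∣ n} (1+1/p)⁻¹` -/
noncomputable def gg (n : ℕ) : ℝ := ∏ p ∈ n.primeFactors, (1 + 1 / (p : ℝ))⁻¹

open Classical in
/-- the density attached to squares -/
noncomputable def GG (n : ℕ) : ℝ := if IsSquare n then gg n else 0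

theorem gg_nonneg (n : ℕ) : 0 ≤ gg n := Finset.prod_nonneg fun p _ => by positivity

theorem gg_le_one (n : ℕ) : gg n ≤ 1 := by
  refine Finset.prod_le_one (fun p _ => by positivity) fun p _ => ?_
  apply inv_le_one_of_one_le₀
  have : 0 ≤ 1 / (p : ℝ) := by positivity
  linarith

theorem GG_nonneg (n : ℕ) : 0 ≤ GG n := by
  unfold GG; split_ifs
  · exact gg_nonneg n
  · exact le_refl 0

theorem GG_le_one (n : ℕ) : GG n ≤ 1 := by
  unfold GG; split_ifs
  · exact gg_le_one n
  · exact zero_le_one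

theorem rho_Smu (n : ℕ) (hn : Odd n) : rho n / 8 * Smu (2 * n) = GG n / Real.pi ^ 2 := by
  unfold rho GG
  have : NeZero (2 * n) := ⟨by have := hn.pos; omega⟩
  split_ifs
  · rw [Smu_eq, Nat.primeFactors_mul two_ne_zero hn.pos.ne', Nat.prime_two.primeFactors,
      Finset.prod_union (by
        rw [Finset.disjoint_singleton_left]
        intro h
        have := Nat.dvd_of_mem_primeFactors h
        exact absurd (hn.of_dvd_nat this) (by decide)), Finset.prod_singleton]
    have h1 : gg n = (∏ p ∈ n.primeFactors, (1 - (p : ℝ)⁻¹)) *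
        ∏ p ∈ n.primeFactors, (1 - ((p : ℝ) ^ 2)⁻¹)⁻¹ := by
      rw [gg, ← Finset.prod_mul_distrib]
      refine Finset.prod_congr rfl fun p hp => ?_
      have hp2 : (2 : ℝ) ≤ p := by exact_mod_cast (Nat.prime_of_mem_primeFactors hp).two_le
      have e1 : 1 - ((p : ℝ) ^ 2)⁻¹ = (1 - (p : ℝ)⁻¹) * (1 + 1 / p) := by field_simp; ring
      have e2 : 1 - (p : ℝ)⁻¹ ≠ 0 := by
        have : (p : ℝ)⁻¹ < 1 := inv_lt_one_of_one_lt₀ (by linarith)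
        linarith
      rw [e1, mul_inv, ← mul_assoc, mul_inv_cancel₀ e2, one_mul]
    rw [h1]
    have hpi := Real.pi_ne_zero
    generalize ∏ p ∈ n.primeFactors, (1 - (p : ℝ)⁻¹) = A
    generalize ∏ p ∈ n.primeFactors, (1 - ((p : ℝ) ^ 2)⁻¹)⁻¹ = B
    push_cast
    norm_num
    field_simp
    ring
  · simp

theorem JS_triv (N r n : ℕ) : |JS N r n| ≤ N := by
  unfold JS
  refine (Finset.abs_sum_le_sum_abs _ _).trans ?_
  calc _ ≤ ∑ k ∈ cls N r, (1 : ℝ) := Finset.sum_le_sum fun k _ => abs_jac_le _ _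
    _ = ((cls N r).card : ℝ) := by simp
    _ ≤ ((Finset.Icc 1 N).card : ℝ) := by
        exact_mod_cast Finset.card_le_card (Finset.filter_subset _ _)
    _ = N := by simp

theorem SF_bound (η : ℝ) (hη : 0 < η) (hη4 : η < 1 / 2) : ∃ C : ℝ, 1 ≤ C ∧ ∀ N r n : ℕ, r < 8 →
    Odd r → Odd n →
    |SF N r n - GG n / Real.pi ^ 2 * N| ≤ C * (N : ℝ) ^ (1 / 2 + η) * (n : ℝ) ^ (1 / 4 + η) := by
  obtain ⟨C, hC1, hC⟩ := JS_bound η hη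
  have hsum : Summable fun d : ℕ => 1 / (d : ℝ) ^ (1 + 2 * η) :=
    Real.summable_one_div_nat_rpow.mpr (by linarith)
  set Z := ∑' d : ℕ, 1 / (d : ℝ) ^ (1 + 2 * η) with hZ
  have hZ1 : 1 ≤ Z := by
    have := hsum.le_tsum 1 (fun _ _ => by positivity)
    rw [hZ]; simpa using this
  refine ⟨4 * C * Z, by nlinarith, fun N r n hr hro hn => ?_⟩
  have hn1 : (1 : ℝ) ≤ n := by exact_mod_cast hn.pos
  set R : ℝ := C * (n : ℝ) ^ (1 / 2 + η) with hR
  have hR1 : 1 ≤ R := by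
    have : (1 : ℝ) ≤ (n : ℝ) ^ (1 / 2 + η) := Real.one_le_rpow hn1 (by linarith)
    nlinarith
  rw [← rho_Smu n hn]
  set f : ℕ → ℝ := fun d => if Nat.Coprime d (2 * n) then
      (ArithmeticFunction.moebius d : ℝ) * JS (N / d ^ 2) r n else 0 with hf
  set g : ℕ → ℝ := fun d => if Nat.Coprime d (2 * n) then
      (ArithmeticFunction.moebius d : ℝ) / (d : ℝ) ^ 2 else 0 with hg
  have hfs : HasSum f (SF N r n) := by
    rw [SF_decomp N r n hr hro hn]
    apply hasSum_sum_of_ne_finset_zero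
    intro d hd
    rw [Finset.mem_Icc, not_and_or] at hd
    rw [hf]
    simp only
    rcases hd with hd | hd
    · have : d = 0 := by omega
      subst this; simp
    · have : N / d ^ 2 = 0 := by
        apply Nat.div_eq_of_lt
        nlinarith
      rw [this]
      have h0 : JS 0 r n = 0 := by simp [JS, cls]
      simp [h0]
  have hgs : HasSum (fun d => rho n / 8 * N * g d) (rho n / 8 * N * Smu (2 * n)) :=
    (summable_Smu (2 * n)).hasSum.mul_left _
  have hdiff := hfs.sub hgs
  have hb : ∀ d : ℕ, ‖f d - rho n / 8 * N * g d‖ ≤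
      4 * (N : ℝ) ^ (1 / 2 + η) * R ^ (1 / 2 : ℝ) * (1 / (d : ℝ) ^ (1 + 2 * η)) := by
    intro d
    rcases Nat.eq_zero_or_pos d with rfl | hd
    · rw [hf, hg]; simp; positivity
    have hd0 : (0 : ℝ) < d := by exact_mod_cast hd
    have key : ‖f d - rho n / 8 * N * g d‖ ≤ |JS (N / d ^ 2) r n - rho n * ((N / (d : ℝ) ^ 2) / 8)| := by
      rw [hf, hg]
      simp only
      split_ifs
      · rw [show (ArithmeticFunction.moebius d : ℝ) * JS (N / d ^ 2) r n - rho n / 8 * N *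
            ((ArithmeticFunction.moebius d : ℝ) / (d : ℝ) ^ 2) = (ArithmeticFunction.moebius d : ℝ) *
            (JS (N / d ^ 2) r n - rho n * ((N / (d : ℝ) ^ 2) / 8)) by ring, norm_mul]
        calc _ ≤ 1 * ‖(JS (N / d ^ 2) r n - rho n * ((N / (d : ℝ) ^ 2) / 8))‖ := by
              gcongr; exact abs_moebius_le d
          _ = _ := by rw [one_mul, Real.norm_eq_abs]
      · simp
    refine key.trans ?_
    set t := |JS (N / d ^ 2) r n - rho n * ((N / (d : ℝ) ^ 2) / 8)| with ht
    have hfl : ((N / d ^ 2 : ℕ) : ℝ) ≤ N / (d : ℝ) ^ 2 := by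
      have := Nat.cast_div_le (α := ℝ) (m := N) (n := d ^ 2); push_cast at this; exact this
    have hfl2 : (N : ℝ) / (d : ℝ) ^ 2 < ((N / d ^ 2 : ℕ) : ℝ) + 1 := by
      rw [div_lt_iff₀ (by positivity)]
      exact_mod_cast (Nat.lt_mul_of_div_lt (Nat.lt_succ_self _) (pow_pos hd 2))
    have hr0 := rho_nonneg n
    have hr1 := rho_le_one n
    have hX : 0 ≤ (N : ℝ) / (d : ℝ) ^ 2 := by positivity
    have t1 : t ≤ 2 * (N / (d : ℝ) ^ 2) := by
      have h1 := JS_triv (N / d ^ 2) r n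
      have h2 : |rho n * ((N / (d : ℝ) ^ 2) / 8)| ≤ N / (d : ℝ) ^ 2 := by
        rw [abs_of_nonneg (by positivity)]; nlinarith
      calc t ≤ _ := abs_sub _ _
        _ ≤ _ := by linarith
    have t2 : t ≤ 2 * R := by
      have h1 := hC (N / d ^ 2) r n hr hro hn
      have h2 : |rho n * (((N / d ^ 2 : ℕ) : ℝ) / 8) - rho n * ((N / (d : ℝ) ^ 2) / 8)| ≤ 1 := by
        rw [← mul_sub, abs_mul, abs_of_nonneg hr0]
        have : |(((N / d ^ 2 : ℕ) : ℝ) / 8) - ((N / (d : ℝ) ^ 2) / 8)| ≤ 1 := by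
          rw [abs_le]; constructor <;> linarith
        calc _ ≤ 1 * (1 : ℝ) := by gcongr
          _ = 1 := one_mul 1
      calc t ≤ _ := abs_sub_le _ (rho n * (((N / d ^ 2 : ℕ) : ℝ) / 8)) _
        _ ≤ R + 1 := add_le_add h1 h2
        _ ≤ 2 * R := by linarith
    have t0 : 0 ≤ t := abs_nonneg _
    rcases t0.eq_or_lt with h0 | hpos
    · rw [← h0]; positivity
    calc t = t ^ (1 / 2 + η) * t ^ (1 / 2 - η) := by
          rw [← Real.rpow_add hpos]; norm_num
      _ ≤ (2 * (N / (d : ℝ) ^ 2)) ^ (1 / 2 + η) * (2 * R) ^ (1 / 2 - η) := by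
          gcongr
      _ = 2 * (N : ℝ) ^ (1 / 2 + η) * R ^ (1 / 2 - η) * (1 / (d : ℝ) ^ (1 + 2 * η)) := by
          rw [Real.mul_rpow two_pos.le hX, Real.mul_rpow two_pos.le (by linarith),
            Real.div_rpow (Nat.cast_nonneg N) (by positivity), ← Real.rpow_natCast (d : ℝ) 2,
            ← Real.rpow_mul hd0.le]
          have e2 : (2 : ℝ) ^ (1 / 2 + η) * 2 ^ (1 / 2 - η) = 2 := by
            rw [← Real.rpow_add two_pos]; norm_num
          have e3 : ((2 : ℕ) : ℝ) * (1 / 2 + η) = 1 + 2 * η := by push_cast; ring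
          rw [e3]
          linear_combination ((N : ℝ) ^ (1 / 2 + η) * R ^ (1 / 2 - η) * (1 / (d : ℝ) ^ (1 + 2 * η))) * e2
      _ ≤ 2 * (N : ℝ) ^ (1 / 2 + η) * R ^ (1 / 2 : ℝ) * (1 / (d : ℝ) ^ (1 + 2 * η)) := by
          gcongr 2 * (N : ℝ) ^ (1 / 2 + η) * ?_ * (1 / (d : ℝ) ^ (1 + 2 * η))
          exact Real.rpow_le_rpow_of_exponent_le hR1 (by linarith)
      _ ≤ _ := by
          have : 0 ≤ (N : ℝ) ^ (1 / 2 + η) * R ^ (1 / 2 : ℝ) * (1 / (d : ℝ) ^ (1 + 2 * η)) := by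
            positivity
          nlinarith
  have hfin := tsum_of_norm_bounded (hsum.hasSum.mul_left (4 * (N : ℝ) ^ (1 / 2 + η) * R ^ (1 / 2 : ℝ))) hb
  rw [hdiff.tsum_eq, Real.norm_eq_abs, ← hZ] at hfin
  rw [show rho n / 8 * Smu (2 * n) * N = rho n / 8 * N * Smu (2 * n) by ring]
  refine hfin.trans ?_
  have hRr : R ^ (1 / 2 : ℝ) ≤ C * (n : ℝ) ^ (1 / 4 + η) := by
    rw [hR, Real.mul_rpow (by linarith) (by positivity), ← Real.rpow_mul (by linarith)]
    have h1 : C ^ (1 / 2 : ℝ) ≤ C := by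
      calc C ^ (1 / 2 : ℝ) ≤ C ^ (1 : ℝ) := Real.rpow_le_rpow_of_exponent_le hC1 (by norm_num)
        _ = C := Real.rpow_one C
    have h2 : (n : ℝ) ^ ((1 / 2 + η) * (1 / 2)) ≤ (n : ℝ) ^ (1 / 4 + η) :=
      Real.rpow_le_rpow_of_exponent_le hn1 (by linarith)
    gcongr
  calc _ ≤ 4 * (N : ℝ) ^ (1 / 2 + η) * (C * (n : ℝ) ^ (1 / 4 + η)) * Z := by gcongr
    _ = _ := by ring

end

section

theorem squarefree_sk {s : ℤ} (hs : s = 1 ∨ s = -1) (k : ℕ) : Squarefree (s * (k : ℤ)) ↔ Squarefree k := by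
  rw [← Int.squarefree_natAbs, Int.natAbs_mul, Int.natAbs_natCast]
  rcases hs with rfl | rfl <;> simp

theorem fund_odd {s : ℤ} (hs : s = 1 ∨ s = -1) (k : ℕ) (hk : k % 2 = 1) :
    IsFundamentalDiscriminant (s * k) ↔ s * k ≠ 1 ∧ ((s * k) % 4 = 1 ∧ Squarefree k) := by
  unfold IsFundamentalDiscriminant
  rw [squarefree_sk hs]
  constructor
  · rintro ⟨h1, h2 | ⟨m, hm, _⟩⟩
    · exact ⟨h1, h2⟩
    · exfalso
      rcases hs with rfl | rfl <;> omega
  · rintro ⟨h1, h2⟩; exact ⟨h1, Or.inl h2⟩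

theorem fund_four {s : ℤ} (hs : s = 1 ∨ s = -1) (k : ℕ) (hk : k % 2 = 1) :
    IsFundamentalDiscriminant (s * (4 * k : ℕ)) ↔ ((s * k) % 4 = 3 ∧ Squarefree k) := by
  unfold IsFundamentalDiscriminant
  push_cast
  constructor
  · rintro ⟨h1, ⟨h2, _⟩ | ⟨m, hm, hsq, hmod⟩⟩
    · exfalso; rcases hs with rfl | rfl <;> omega
    · have : m = s * k := by linarith
      subst this
      rw [squarefree_sk hs] at hsq
      refine ⟨?_, hsq⟩
      rcases hs with rfl | rfl <;> omega
  · rintro ⟨h1, h2⟩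
    refine ⟨by rcases hs with rfl | rfl <;> omega, Or.inr ⟨s * k, by ring, ?_, Or.inr h1⟩⟩
    rwa [squarefree_sk hs]

theorem squarefree_two_mul (k : ℕ) (hk : k % 2 = 1) : Squarefree (2 * k) ↔ Squarefree k := by
  rw [Nat.squarefree_mul (Nat.coprime_two_left.mpr (Nat.odd_iff.mpr hk))]
  simp [Nat.prime_two.prime.irreducible.squarefree]

theorem fund_eight {s : ℤ} (hs : s = 1 ∨ s = -1) (k : ℕ) :
    IsFundamentalDiscriminant (s * (8 * k : ℕ)) ↔ (k % 2 = 1 ∧ Squarefree k) := by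
  unfold IsFundamentalDiscriminant
  push_cast
  constructor
  · rintro ⟨h1, ⟨h2, _⟩ | ⟨m, hm, hsq, hmod⟩⟩
    · exfalso; rcases hs with rfl | rfl <;> omega
    · have : m = s * (2 * k : ℕ) := by push_cast; linarith
      subst this
      have hk : k % 2 = 1 := by rcases hs with rfl | rfl <;> omega
      rw [squarefree_sk hs, squarefree_two_mul k hk] at hsq
      exact ⟨hk, hsq⟩
  · rintro ⟨h1, h2⟩
    refine ⟨by rcases hs with rfl | rfl <;> omega, Or.inr ⟨s * (2 * k : ℕ), by push_cast; ring, ?_, ?_⟩⟩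
    · rwa [squarefree_sk hs, squarefree_two_mul k h1]
    · left; rcases hs with rfl | rfl <;> omega

theorem not_fund_two {s : ℤ} (hs : s = 1 ∨ s = -1) (k : ℕ) (hk : k % 4 = 2) :
    ¬ IsFundamentalDiscriminant (s * k) := by
  rintro ⟨h1, ⟨h2, _⟩ | ⟨m, hm, hsq, hmod⟩⟩ <;> rcases hs with rfl | rfl <;> omega

/-- residue classes for `Δ ≡ 1 mod 4` -/
def clA (s : ℤ) : Finset ℕ := if s = 1 then {1, 5} else {3, 7}
/-- residue classes for `Δ = 4 * D` -/
def clB (s : ℤ) : Finset ℕ := if s = 1 then {3, 7} else {1, 5}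
/-- odd residue classes -/
def clC : Finset ℕ := {1, 3, 5, 7}

theorem mem_clA {s : ℤ} (hs : s = 1 ∨ s = -1) (k : ℕ) :
    k % 8 ∈ clA s ↔ (s * k) % 4 = 1 := by
  rcases hs with rfl | rfl
  · simp only [clA, if_true, Finset.mem_insert, Finset.mem_singleton]; omega
  · simp only [clA, show ((-1 : ℤ) = 1) = False by simp, if_false, Finset.mem_insert,
      Finset.mem_singleton]; omega

theorem mem_clB {s : ℤ} (hs : s = 1 ∨ s = -1) (k : ℕ) :
    k % 8 ∈ clB s ↔ (s * k) % 4 = 3 := by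
  rcases hs with rfl | rfl
  · simp only [clB, if_true, Finset.mem_insert, Finset.mem_singleton]; omega
  · simp only [clB, show ((-1 : ℤ) = 1) = False by simp, if_false, Finset.mem_insert,
      Finset.mem_singleton]; omega

theorem mem_clC (k : ℕ) : k % 8 ∈ clC ↔ k % 2 = 1 := by
  simp only [clC, Finset.mem_insert, Finset.mem_singleton]; omega

theorem sum_classes (N : ℕ) (T : Finset ℕ) (P : ℕ → Prop) [DecidablePred P] (f : ℕ → ℝ) :
    ∑ r ∈ T, ∑ k ∈ cls N r with P k, f k =
      ∑ k ∈ (Finset.Icc 1 N).filter (fun k => k % 8 ∈ T ∧ P k), f k := by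
  rw [← Finset.sum_fiberwise_of_maps_to (t := T) (g := fun k => k % 8)
    (s := (Finset.Icc 1 N).filter (fun k => k % 8 ∈ T ∧ P k))]
  · refine Finset.sum_congr rfl fun r hr => Finset.sum_congr ?_ fun _ _ => rfl
    ext k
    simp only [Finset.mem_filter, mem_cls, Finset.mem_Icc]
    constructor
    · rintro ⟨⟨h1, h2⟩, h3⟩; exact ⟨⟨h1, h2 ▸ hr, h3⟩, h2⟩
    · rintro ⟨⟨h1, _, h3⟩, h2⟩; exact ⟨⟨h1, h2⟩, h3⟩
  · intro k hk
    simp only [Finset.mem_filter] at hk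
    exact hk.2.1

open Classical in
/-- fundamental discriminants of sign `s` up to `N` (absolute values) -/
noncomputable def FD (s : ℤ) (N : ℕ) : Finset ℕ :=
  (Finset.Icc 1 N).filter (fun k => IsFundamentalDiscriminant (s * k))

theorem mem_FD {s : ℤ} {N k : ℕ} : k ∈ FD s N ↔ (1 ≤ k ∧ k ≤ N) ∧ IsFundamentalDiscriminant (s * k) := by
  simp [FD]

theorem sum_FD (s : ℤ) (hs : s = 1 ∨ s = -1) (N : ℕ) (hN : 1 ≤ N) (F : ℤ → ℝ) :
    ∑ k ∈ FD s N, F (s * k) + (if s = 1 then F 1 else 0) =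
      ∑ r ∈ clA s, ∑ k ∈ cls N r with Squarefree k, F (s * k) +
      ∑ r ∈ clB s, ∑ k ∈ cls (N / 4) r with Squarefree k, F (s * (4 * k : ℕ)) +
      ∑ r ∈ clC, ∑ k ∈ cls (N / 8) r with Squarefree k, F (s * (8 * k : ℕ)) := by
  classical
  rw [sum_classes N (clA s) Squarefree (fun k => F (s * k)),
    sum_classes (N / 4) (clB s) Squarefree (fun k => F (s * (4 * k : ℕ))),
    sum_classes (N / 8) clC Squarefree (fun k => F (s * (8 * k : ℕ)))]
  rw [← Finset.sum_filter_add_sum_filter_not (FD s N) (fun k => k % 2 = 1),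
    ← Finset.sum_filter_add_sum_filter_not ((FD s N).filter (fun k => ¬ k % 2 = 1)) (fun k => k % 8 = 4)]
  have hA : ∑ k ∈ (FD s N).filter (fun k => k % 2 = 1), F (s * k) + (if s = 1 then F 1 else 0) =
      ∑ k ∈ (Finset.Icc 1 N).filter (fun k => k % 8 ∈ clA s ∧ Squarefree k), F (s * k) := by
    rw [← Finset.sum_filter_add_sum_filter_not
      ((Finset.Icc 1 N).filter (fun k => k % 8 ∈ clA s ∧ Squarefree k)) (fun k : ℕ => s * (k : ℤ) ≠ 1)]
    congr 1
    · refine Finset.sum_congr ?_ fun _ _ => rfl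
      ext k
      simp only [Finset.mem_filter, mem_FD, Finset.mem_Icc, mem_clA hs]
      constructor
      · rintro ⟨⟨h1, h2⟩, h3⟩
        rw [fund_odd hs k h3] at h2
        exact ⟨⟨h1, h2.2⟩, h2.1⟩
      · rintro ⟨⟨h1, h2⟩, h3⟩
        have hk : k % 2 = 1 := by rcases hs with rfl | rfl <;> omega
        exact ⟨⟨h1, (fund_odd hs k hk).mpr ⟨h3, h2⟩⟩, hk⟩
    · split_ifs with h
      · subst h
        rw [Finset.sum_eq_single 1]
        · simp
        · intro b hb hb1
          simp only [Finset.mem_filter, not_not] at hb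
          exfalso; apply hb1; omega
        · intro h1
          exfalso; apply h1
          simp only [Finset.mem_filter, Finset.mem_Icc, mem_clA hs]
          refine ⟨⟨⟨le_refl 1, hN⟩, by norm_num, squarefree_one⟩, by simp⟩
      · symm
        apply Finset.sum_eq_zero
        intro k hk
        simp only [Finset.mem_filter, not_not] at hk
        exfalso
        have := hk.2
        rcases hs with rfl | rfl <;> omega
  have hB : ∑ k ∈ ((FD s N).filter (fun k => ¬ k % 2 = 1)).filter (fun k => k % 8 = 4), F (s * k) =
      ∑ k ∈ (Finset.Icc 1 (N / 4)).filter (fun k => k % 8 ∈ clB s ∧ Squarefree k),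
        F (s * (4 * k : ℕ)) := by
    symm
    refine Finset.sum_bij (fun k _ => 4 * k) ?_ ?_ ?_ ?_
    · intro k hk
      simp only [Finset.mem_filter, Finset.mem_Icc, mem_clB hs] at hk
      have hk2 : k % 2 = 1 := by rcases hs with rfl | rfl <;> omega
      simp only [Finset.mem_filter, mem_FD]
      rw [fund_four hs k hk2]
      exact ⟨⟨⟨by omega, hk.2⟩, by omega⟩, by omega⟩
    · intro a _ b _ h; have h0 := h; omega
    · intro k hk
      simp only [Finset.mem_filter, mem_FD] at hk
      obtain ⟨k', rfl⟩ : ∃ k', k = 4 * k' := ⟨k / 4, by omega⟩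
      have hk2 : k' % 2 = 1 := by omega
      refine ⟨k', ?_, rfl⟩
      have := (fund_four hs k' hk2).mp hk.1.1.2
      simp only [Finset.mem_filter, Finset.mem_Icc, mem_clB hs]
      exact ⟨by omega, this⟩
    · intro k _; rfl
  have hC : ∑ k ∈ ((FD s N).filter (fun k => ¬ k % 2 = 1)).filter (fun k => ¬ k % 8 = 4), F (s * k) =
      ∑ k ∈ (Finset.Icc 1 (N / 8)).filter (fun k => k % 8 ∈ clC ∧ Squarefree k),
        F (s * (8 * k : ℕ)) := by
    symm
    refine Finset.sum_bij (fun k _ => 8 * k) ?_ ?_ ?_ ?_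
    · intro k hk
      simp only [Finset.mem_filter, Finset.mem_Icc, mem_clC] at hk
      simp only [Finset.mem_filter, mem_FD]
      rw [fund_eight hs k]
      exact ⟨⟨⟨by omega, hk.2⟩, by omega⟩, by omega⟩
    · intro a _ b _ h; have h0 := h; omega
    · intro k hk
      simp only [Finset.mem_filter, mem_FD] at hk
      have h42 : ¬ k % 4 = 2 := fun h => not_fund_two hs k h hk.1.1.2
      obtain ⟨k', rfl⟩ : ∃ k', k = 8 * k' := ⟨k / 8, by omega⟩
      refine ⟨k', ?_, rfl⟩
      have := (fund_eight hs k').mp hk.1.1.2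
      simp only [Finset.mem_filter, Finset.mem_Icc, mem_clC]
      exact ⟨by omega, this⟩
    · intro k _; rfl
  rw [hB, hC, ← hA]
  ring

end

section

/-- odd part -/
def op (n : ℕ) : ℕ := n / 2 ^ padicValNat 2 n

theorem op_mul_pow (n : ℕ) : 2 ^ padicValNat 2 n * op n = n :=
  Nat.mul_div_cancel' pow_padicValNat_dvd

theorem op_odd {n : ℕ} (hn : n ≠ 0) : Odd (op n) := by
  have h := Nat.not_dvd_ordCompl Nat.prime_two hn
  rw [Nat.factorization_def n Nat.prime_two] at h
  rw [← Nat.not_even_iff_odd, even_iff_two_dvd]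
  exact h

theorem op_mul {m n : ℕ} (hm : m ≠ 0) (hn : n ≠ 0) : op (m * n) = op m * op n := by
  have h1 := op_mul_pow (m * n)
  have h2 := op_mul_pow m
  have h3 := op_mul_pow n
  rw [padicValNat.mul hm hn, pow_add] at h1
  have : 0 < 2 ^ padicValNat 2 m * 2 ^ padicValNat 2 n := by positivity
  apply Nat.eq_of_mul_eq_mul_left this
  rw [h1]
  nth_rewrite 1 [← h2, ← h3]
  ring

theorem kro_def (Δ : ℤ) (n : ℕ) : kro Δ n = ZMod.χ₈ (Δ : ZMod 8) ^ padicValNat 2 n * jacobiSym Δ (op n) := rfl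

theorem kro_mul (Δ : ℤ) {m n : ℕ} (hm : m ≠ 0) (hn : n ≠ 0) : kro Δ (m * n) = kro Δ m * kro Δ n := by
  have h1 := op_odd hm
  have h2 := op_odd hn
  have : NeZero (op m) := ⟨by rintro h; simp [h] at h1⟩
  have : NeZero (op n) := ⟨by rintro h; simp [h] at h2⟩
  rw [kro_def, kro_def, kro_def, op_mul hm hn, padicValNat.mul hm hn, jacobiSym.mul_right, pow_add]
  ring

theorem kro_one (Δ : ℤ) : kro Δ 1 = 1 := by
  simp [kro]

theorem abs_kro_le (Δ : ℤ) (n : ℕ) : |(kro Δ n : ℝ)| ≤ 1 := by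
  rw [kro_def]
  push_cast
  rw [abs_mul, abs_pow]
  have h1 : |(ZMod.χ₈ (Δ : ZMod 8) : ℝ)| ≤ 1 := by
    rw [ZMod.χ₈_int_eq_if_mod_eight]
    split_ifs <;> simp
  exact mul_le_one₀ (pow_le_one₀ (abs_nonneg _) h1) (abs_nonneg _) (abs_jac_le Δ (op n))

theorem jac_GG (a : ℤ) (n : ℕ) (hn : Odd n) (ha : ∀ p : ℕ, p.Prime → Odd p → ¬ (p : ℤ) ∣ a) :
    (jacobiSym a n : ℝ) * GG n = GG n := by
  unfold GG
  split_ifs with h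
  · obtain ⟨m, rfl⟩ := h
    have hm : Odd m := (Nat.odd_mul.mp hn).1
    have : NeZero m := ⟨by rintro rfl; simp at hm⟩
    rw [jacobiSym.mul_right, ← sq, jacobiSym.sq_one]
    · simp
    · by_contra hg
      obtain ⟨p, hp, hpd⟩ := Nat.exists_prime_and_dvd hg
      have h1 : (p : ℤ) ∣ a := (Int.natCast_dvd_natCast.mpr hpd).trans (Int.gcd_dvd_left ..)
      have h2 : (p : ℤ) ∣ m := (Int.natCast_dvd_natCast.mpr hpd).trans (Int.gcd_dvd_right ..)
      have h3 : p ∣ m := by exact_mod_cast h2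
      exact ha p hp (hm.of_dvd_nat h3) h1
  · simp

theorem GG_op (n : ℕ) (hn : n ≠ 0) :
    GG (op n) * (1 + (-1) ^ padicValNat 2 n + 0 ^ padicValNat 2 n) = 3 * GG n := by
  have hodd := op_odd hn
  have hop0 : op n ≠ 0 := by rintro h; simp [h] at hodd
  have hd := op_mul_pow n
  rcases Nat.eq_zero_or_pos (padicValNat 2 n) with h0 | h0
  · rw [h0] at hd ⊢
    simp at hd; rw [hd]; norm_num; ring
  · rcases Nat.even_or_odd (padicValNat 2 n) with he | ho
    · have hsq : IsSquare n ↔ IsSquare (op n) := by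
        obtain ⟨c, hc⟩ := he
        constructor
        · intro h
          rw [← hd] at h
          have h2 : 2 ^ padicValNat 2 n * op n = (2 ^ c)^2 * op n := by rw [hc]; ring
          rw [h2] at h
          obtain ⟨e, he⟩ := h
          have : 2 ^ c ∣ e := by
            rw [← Nat.pow_dvd_pow_iff (n := 2) (by norm_num), sq e, ← he]
            exact Dvd.intro _ rfl
          obtain ⟨f, rfl⟩ := this
          refine ⟨f, ?_⟩
          apply Nat.eq_of_mul_eq_mul_left (show 0 < (2 ^ c)^2 by positivity)
          rw [he]; ring
        · intro h
          rw [← hd]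
          refine IsSquare.mul ?_ h
          rw [hc]; exact ⟨2 ^ c, by ring⟩
      rw [he.neg_one_pow, zero_pow h0.ne']
      unfold GG
      simp only [hsq]
      split_ifs
      · have : gg n = 2 / 3 * gg (op n) := by
          unfold gg
          have h1 : n.primeFactors = insert 2 (op n).primeFactors := by
            conv_lhs => rw [← hd]
            rw [Nat.primeFactors_mul (by positivity) hop0, Nat.primeFactors_pow _ h0.ne',
              Nat.Prime.primeFactors Nat.prime_two]; rfl
          rw [h1, Finset.prod_insert]
          · norm_num
          · intro h
            have := Nat.dvd_of_mem_primeFactors h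
            rw [Nat.odd_iff] at hodd; omega
        rw [this]; ring
      · simp
    · rw [ho.neg_one_pow, zero_pow h0.ne']
      have : ¬ IsSquare n := by
        rintro ⟨e, he⟩
        have he0 : e ≠ 0 := by rintro rfl; simp at he; exact hn he
        rw [he, padicValNat.mul he0 he0] at ho
        rw [Nat.odd_iff] at ho; omega
      simp [GG, this]

theorem sum_kro_cls (s : ℤ) (hs : s = 1 ∨ s = -1) (N n : ℕ) (hN : 1 ≤ N) (hn : n ≠ 0) :
    ∑ k ∈ FD s N, (kro (s * k) n : ℝ) + (if s = 1 then 1 else 0) =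
      ∑ r ∈ clA s, (ZMod.χ₈ (r : ZMod 8) : ℝ) ^ padicValNat 2 n * (jacobiSym s (op n) * SF N r (op n)) +
      ∑ r ∈ clB s, (0 : ℝ) ^ padicValNat 2 n * (jacobiSym (s * 4) (op n) * SF (N / 4) r (op n)) +
      ∑ r ∈ clC, (0 : ℝ) ^ padicValNat 2 n * (jacobiSym (s * 8) (op n) * SF (N / 8) r (op n)) := by
  have h := sum_FD s hs N hN (fun Δ => (kro Δ n : ℝ))
  have h1 : (kro 1 n : ℝ) = 1 := by
    rw [kro_def]; simp
  rw [h1] at h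
  rw [h]
  congr 1
  · congr 1
    · refine Finset.sum_congr rfl fun r hr => ?_
      unfold SF
      rw [Finset.mul_sum, Finset.mul_sum]
      refine Finset.sum_congr rfl fun k hk => ?_
      have hk' : k % 8 = r := (mem_cls.mp (Finset.mem_filter.mp hk).1).2
      have e1 : ZMod.χ₈ ((s * (k : ℤ) : ℤ) : ZMod 8) = ZMod.χ₈ (r : ZMod 8) := by
        have : (r : ZMod 8) = ((k : ℤ) : ZMod 8) := by
          rw [← hk']; simp
        rw [this]
        rcases hs with rfl | rfl
        · rw [one_mul]
        · rw [neg_one_mul, chi8_neg]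
      rw [kro_def, e1, jacobiSym.mul_left]
      push_cast; ring
    · refine Finset.sum_congr rfl fun r hr => ?_
      unfold SF
      rw [Finset.mul_sum, Finset.mul_sum]
      refine Finset.sum_congr rfl fun k hk => ?_
      have e1 : ZMod.χ₈ ((s * ((4 * k : ℕ) : ℤ) : ℤ) : ZMod 8) = 0 := by
        rw [ZMod.χ₈_int_eq_if_mod_eight, if_pos]
        push_cast; rcases hs with rfl | rfl <;> omega
      rw [kro_def, e1, show s * ((4 * k : ℕ) : ℤ) = (s * 4) * k by push_cast; ring, jacobiSym.mul_left]
      push_cast; ring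
  · refine Finset.sum_congr rfl fun r hr => ?_
    unfold SF
    rw [Finset.mul_sum, Finset.mul_sum]
    refine Finset.sum_congr rfl fun k hk => ?_
    have e1 : ZMod.χ₈ ((s * ((8 * k : ℕ) : ℤ) : ℤ) : ZMod 8) = 0 := by
      rw [ZMod.χ₈_int_eq_if_mod_eight, if_pos]
      push_cast; rcases hs with rfl | rfl <;> omega
    rw [kro_def, e1, show s * ((8 * k : ℕ) : ℤ) = (s * 8) * k by push_cast; ring, jacobiSym.mul_left]
    push_cast; ring

theorem jacSF (a : ℤ) (n : ℕ) (hn : Odd n) (ha : ∀ p : ℕ, p.Prime → Odd p → ¬ (p : ℤ) ∣ a)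
    (x M E c : ℝ) (hc : |c| ≤ 1) (hx : |x - GG n / Real.pi ^ 2 * M| ≤ E) :
    |c * (jacobiSym a n * x) - c * (GG n / Real.pi ^ 2 * M)| ≤ E := by
  have h1 : c * (jacobiSym a n * x) - c * (GG n / Real.pi ^ 2 * M) =
      c * (jacobiSym a n * (x - GG n / Real.pi ^ 2 * M)) := by
    have := jac_GG a n hn ha
    linear_combination c / Real.pi ^ 2 * M * this
  rw [h1, abs_mul, abs_mul]
  have := abs_jac_le a n
  calc _ ≤ 1 * (1 * E) := by gcongr
    _ = E := by ring

theorem two_pow_odd_prime (s : ℤ) (hs : s = 1 ∨ s = -1) (j : ℕ) (p : ℕ) (hp : p.Prime) (ho : Odd p) :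
    ¬ (p : ℤ) ∣ s * 2 ^ j := by
  intro h
  have h2 : (p : ℤ) ∣ 2 ^ j := by
    rcases hs with rfl | rfl
    · simpa using h
    · simpa using h
  have h3 : p ∣ 2 ^ j := by exact_mod_cast h2
  have := (Nat.prime_dvd_prime_iff_eq hp Nat.prime_two).mp (hp.dvd_of_dvd_pow h3)
  subst this; exact absurd ho (by decide)

set_option maxHeartbeats 1000000 in
theorem T2_bound (η : ℝ) (hη : 0 < η) (hη4 : η < 1 / 2) : ∃ C : ℝ, 1 ≤ C ∧ ∀ (s : ℤ) (N n : ℕ),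
    (s = 1 ∨ s = -1) → 1 ≤ N → n ≠ 0 →
    |∑ k ∈ FD s N, (kro (s * k) n : ℝ) - 3 / Real.pi ^ 2 * GG n * N| ≤
      C * (N : ℝ) ^ (1 / 2 + η) * (n : ℝ) ^ (1 / 4 + η) := by
  obtain ⟨C, hC, hb⟩ := SF_bound η hη hη4
  refine ⟨8 * C + 7, by linarith, fun s N n hs hN hn => ?_⟩
  have hodd := op_odd hn
  have hop0 : op n ≠ 0 := by rintro h; simp [h] at hodd
  set v := padicValNat 2 n with hv
  set E := (N : ℝ) ^ (1 / 2 + η) * (n : ℝ) ^ (1 / 4 + η) with hE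
  have hopn : op n ≤ n := Nat.div_le_self _ _
  have hE1 : 1 ≤ E := by
    have h1 : (1 : ℝ) ≤ (N : ℝ) ^ (1 / 2 + η) :=
      Real.one_le_rpow (by exact_mod_cast hN) (by linarith)
    have h2 : (1 : ℝ) ≤ (n : ℝ) ^ (1 / 4 + η) :=
      Real.one_le_rpow (by exact_mod_cast Nat.one_le_iff_ne_zero.mpr hn) (by linarith)
    nlinarith
  have key : ∀ M r : ℕ, M ≤ N → r ∈ clC → |SF M r (op n) - GG (op n) / Real.pi ^ 2 * M| ≤ C * E := by
    intro M r hM hr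
    have hr2 : r < 8 ∧ Odd r := by
      simp only [clC, Finset.mem_insert, Finset.mem_singleton] at hr
      rcases hr with rfl | rfl | rfl | rfl <;> decide
    refine (hb M r (op n) hr2.1 hr2.2 hodd).trans ?_
    rw [hE, mul_assoc]
    gcongr
  have hA : clA s ⊆ clC := by
    rcases hs with rfl | rfl <;> decide
  have hB : clB s ⊆ clC := by
    rcases hs with rfl | rfl <;> decide
  have hχ : ∀ r : ℕ, |(ZMod.χ₈ (r : ZMod 8) : ℝ) ^ v| ≤ 1 := by
    intro r
    rw [abs_pow]
    apply pow_le_one₀ (abs_nonneg _)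
    have := ZMod.χ₈_nat_eq_if_mod_eight r
    rw [this]; split_ifs <;> simp
  have h0v : |(0 : ℝ) ^ v| ≤ 1 := by
    rw [abs_pow]; exact pow_le_one₀ (abs_nonneg _) (by simp)
  have gen : ∀ (T : Finset ℕ) (c : ℕ → ℝ) (a : ℤ) (M : ℕ), T ⊆ clC → (∀ r, |c r| ≤ 1) → M ≤ N →
      (∀ p : ℕ, p.Prime → Odd p → ¬ (p : ℤ) ∣ a) →
      |∑ r ∈ T, c r * (jacobiSym a (op n) * SF M r (op n)) -
        ∑ r ∈ T, c r * (GG (op n) / Real.pi ^ 2 * M)| ≤ T.card * (C * E) := by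
    intro T c a M hT hc hM ha
    rw [← Finset.sum_sub_distrib]
    refine (Finset.abs_sum_le_sum_abs _ _).trans ?_
    rw [← nsmul_eq_mul]
    refine Finset.sum_le_card_nsmul _ _ _ fun r hr => ?_
    exact jacSF a (op n) hodd ha _ _ _ _ (hc r) (key M r hM (hT hr))
  have gA := gen (clA s) (fun r => (ZMod.χ₈ (r : ZMod 8) : ℝ) ^ v) s N hA hχ le_rfl
    (by simpa using two_pow_odd_prime s hs 0)
  have gB := gen (clB s) (fun r => (0 : ℝ) ^ v) (s * 4) (N / 4) hB (fun _ => h0v) (Nat.div_le_self _ _)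
    (by simpa using two_pow_odd_prime s hs 2)
  have gC := gen clC (fun r => (0 : ℝ) ^ v) (s * 8) (N / 8) le_rfl (fun _ => h0v) (Nat.div_le_self _ _)
    (by simpa using two_pow_odd_prime s hs 3)
  have hsum := sum_kro_cls s hs N n hN hn
  rw [← hv] at hsum
  have cA : (clA s).card = 2 := by rcases hs with rfl | rfl <;> decide
  have cB : (clB s).card = 2 := by rcases hs with rfl | rfl <;> decide
  have cC : clC.card = 4 := by decide
  have sA : ∑ r ∈ clA s, (ZMod.χ₈ (r : ZMod 8) : ℝ) ^ v * (GG (op n) / Real.pi ^ 2 * N) =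
      (1 + (-1) ^ v) * (GG (op n) / Real.pi ^ 2 * N) := by
    have x1 : ZMod.χ₈ (1 : ZMod 8) = 1 := by decide
    have x3 : ZMod.χ₈ (3 : ZMod 8) = -1 := by decide
    have x5 : ZMod.χ₈ (5 : ZMod 8) = -1 := by decide
    have x7 : ZMod.χ₈ (7 : ZMod 8) = 1 := by decide
    rcases hs with rfl | rfl
    · rw [show clA 1 = {1, 5} by decide, Finset.sum_pair (by norm_num)]
      push_cast
      rw [x1, x5]; push_cast; ring
    · rw [show clA (-1) = {3, 7} by decide, Finset.sum_pair (by norm_num)]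
      push_cast
      rw [x3, x7]; push_cast; ring
  rw [sA, cA] at gA
  rw [Finset.sum_const, cB] at gB
  rw [Finset.sum_const, cC] at gC
  simp only [nsmul_eq_mul] at gB gC
  have hG := GG_op n hn
  rw [← hv] at hG
  set G := GG (op n) / Real.pi ^ 2 with hGd
  have hG0 : 0 ≤ G := div_nonneg (GG_nonneg _) (by positivity)
  have hG1 : G ≤ 1 := by
    rw [hGd, div_le_one (by positivity)]
    have := Real.pi_gt_three
    have := GG_le_one (op n)
    nlinarith
  have hG' : 3 / Real.pi ^ 2 * GG n = G * (1 + (-1) ^ v + 0 ^ v) := by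
    rw [hGd]; linear_combination -(1 / Real.pi ^ 2) * hG
  rw [hG']
  have f4 : |((N / 4 : ℕ) : ℝ) - (N : ℝ) / 4| ≤ 1 := by
    have h1 : N / 4 * 4 ≤ N := Nat.div_mul_le_self _ _
    have h2 : N < (N / 4) * 4 + 4 := by omega
    have h1' : ((N / 4 : ℕ) : ℝ) * 4 ≤ N := by exact_mod_cast h1
    have h2' : (N : ℝ) < ((N / 4 : ℕ) : ℝ) * 4 + 4 := by exact_mod_cast h2
    rw [abs_le]; constructor <;> linarith
  have f8 : |((N / 8 : ℕ) : ℝ) - (N : ℝ) / 8| ≤ 1 := by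
    have h1 : N / 8 * 8 ≤ N := Nat.div_mul_le_self _ _
    have h2 : N < (N / 8) * 8 + 8 := by omega
    have h1' : ((N / 8 : ℕ) : ℝ) * 8 ≤ N := by exact_mod_cast h1
    have h2' : (N : ℝ) < ((N / 8 : ℕ) : ℝ) * 8 + 8 := by exact_mod_cast h2
    rw [abs_le]; constructor <;> linarith
  have hr : |2 * (0 : ℝ) ^ v * G * (((N / 4 : ℕ) : ℝ) - (N : ℝ) / 4) +
      4 * (0 : ℝ) ^ v * G * (((N / 8 : ℕ) : ℝ) - (N : ℝ) / 8)| ≤ 6 := by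
    have hGa : |G| ≤ 1 := by rw [abs_of_nonneg hG0]; exact hG1
    refine (abs_add_le _ _).trans ?_
    rw [abs_mul, abs_mul, abs_mul, abs_mul, abs_mul, abs_mul]
    calc _ ≤ |(2 : ℝ)| * 1 * 1 * 1 + |(4 : ℝ)| * 1 * 1 * 1 := by gcongr
      _ = 6 := by norm_num
  have hi : |(if s = 1 then (1 : ℝ) else 0)| ≤ 1 := by split_ifs <;> simp
  set X := ∑ r ∈ clA s, (ZMod.χ₈ (r : ZMod 8) : ℝ) ^ v * (jacobiSym s (op n) * SF N r (op n))
  set Y := ∑ r ∈ clB s, (0 : ℝ) ^ v * (jacobiSym (s * 4) (op n) * SF (N / 4) r (op n))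
  set Z := ∑ r ∈ clC, (0 : ℝ) ^ v * (jacobiSym (s * 8) (op n) * SF (N / 8) r (op n))
  have hfin : ∑ k ∈ FD s N, (kro (s * k) n : ℝ) - G * (1 + (-1) ^ v + 0 ^ v) * N =
      (X - (1 + (-1) ^ v) * (G * N)) + (Y - (2 : ℕ) * (0 ^ v * (G * ((N / 4 : ℕ) : ℝ)))) +
      (Z - (4 : ℕ) * (0 ^ v * (G * ((N / 8 : ℕ) : ℝ)))) + 
      (2 * (0 : ℝ) ^ v * G * (((N / 4 : ℕ) : ℝ) - (N : ℝ) / 4) +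
      4 * (0 : ℝ) ^ v * G * (((N / 8 : ℕ) : ℝ) - (N : ℝ) / 8)) - (if s = 1 then (1 : ℝ) else 0) := by
    push_cast
    linear_combination hsum
  rw [hfin, mul_assoc (8 * C + 7), ← hE]
  push_cast at gA gB gC ⊢
  have := abs_le.mp gA; have := abs_le.mp gB; have := abs_le.mp gC
  have := abs_le.mp hr; have := abs_le.mp hi
  rw [abs_le]; constructor <;> linarith

end

section

theorem op_square {a b : ℕ} (ha : a ≠ 0) (hb : b ≠ 0) (h : IsSquare (op a * op b)) :
    ∃ m : ℕ, m ≠ 0 ∧ (a * b = m ^ 2 ∨ a * b = 2 * m ^ 2) := by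
  obtain ⟨e, he⟩ := h
  have hab : a * b ≠ 0 := mul_ne_zero ha hb
  have h1 := op_mul_pow (a * b)
  rw [op_mul ha hb, he] at h1
  rcases Nat.even_or_odd (padicValNat 2 (a * b)) with ⟨c, hc⟩ | ⟨c, hc⟩
  · have h2 : a * b = (2 ^ c * e) ^ 2 := by rw [← h1, hc]; ring
    refine ⟨2 ^ c * e, fun h => hab ?_, Or.inl h2⟩
    rw [h2, h]; simp
  · have h2 : a * b = 2 * (2 ^ c * e) ^ 2 := by rw [← h1, hc]; ring
    refine ⟨2 ^ c * e, fun h => hab ?_, Or.inr h2⟩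
    rw [h2, h]; simp

theorem summable_eta (η : ℝ) (hη : 0 < η) : Summable fun m : ℕ => (m : ℝ) ^ (-1 - η) := by
  rw [Real.summable_nat_rpow]; linarith

open Classical in
theorem diag_sum (η : ℝ) (hη : 0 < η) : ∃ C : ℝ, 1 ≤ C ∧ ∀ P : Finset (ℕ × ℕ),
    (∀ x ∈ P, x.1 ≠ 0 ∧ x.2 ≠ 0 ∧ IsSquare (op x.1 * op x.2)) →
    ∑ x ∈ P, ((x.1 * x.2 : ℕ) : ℝ) ^ (-(1 / 2 : ℝ) - 2 * η) ≤ C := by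
  obtain ⟨D, hD, hd⟩ := divisor_bound η hη
  have hs := summable_eta (2 * η) (by positivity)
  set S := ∑' m : ℕ, (m : ℝ) ^ (-1 - 2 * η)
  have hS0 : 0 ≤ S := tsum_nonneg fun m => by positivity
  refine ⟨D * (1 + 2 ^ η) * S + 1, ?_, fun P hP => ?_⟩
  · have : 0 ≤ D * (1 + 2 ^ η) * S := by positivity
    linarith
  choose! g hg0 hg using fun (x : ℕ × ℕ) (hx : x ∈ P) => op_square (hP x hx).1 (hP x hx).2.1 (hP x hx).2.2
  rw [← Finset.sum_fiberwise_of_maps_to (t := P.image g) (g := g)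
    (fun x hx => Finset.mem_image_of_mem g hx)]
  have key : ∀ m ∈ P.image g, ∑ x ∈ P with g x = m, ((x.1 * x.2 : ℕ) : ℝ) ^ (-(1 / 2 : ℝ) - 2 * η) ≤
      D * (1 + 2 ^ η) * (m : ℝ) ^ (-1 - 2 * η) := by
    intro m hm
    have hm0 : m ≠ 0 := by
      obtain ⟨x, hx, rfl⟩ := Finset.mem_image.mp hm
      exact hg0 x hx
    have hmp : (0 : ℝ) < m := by positivity
    have hsub : P.filter (fun x => g x = m) ⊆ (m ^ 2).divisorsAntidiagonal ∪ (2 * m ^ 2).divisorsAntidiagonal := by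
      intro x hx
      rw [Finset.mem_filter] at hx
      have := hg x hx.1
      rw [hx.2] at this
      simp only [Finset.mem_union, Nat.mem_divisorsAntidiagonal]
      rcases this with h | h
      · left; exact ⟨h, by positivity⟩
      · right; exact ⟨h, by positivity⟩
    have hcard : ((P.filter (fun x => g x = m)).card : ℝ) ≤ D * (1 + 2 ^ η) * (m : ℝ) ^ (2 * η) := by
      have h1 := (Finset.card_le_card hsub).trans (Finset.card_union_le _ _)
      rw [← Nat.map_div_right_divisors, ← Nat.map_div_right_divisors, Finset.card_map, Finset.card_map] at h1
      have h2 := hd (m ^ 2) (by positivity)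
      have h3 := hd (2 * m ^ 2) (by positivity)
      have e : ((m : ℝ) ^ 2) ^ η = (m : ℝ) ^ (2 * η) := by
        rw [← Real.rpow_natCast, ← Real.rpow_mul hmp.le]; norm_num
      push_cast at h2 h3
      rw [Real.mul_rpow (by norm_num) (by positivity), e] at h3
      rw [e] at h2
      have h1' : ((P.filter (fun x => g x = m)).card : ℝ) ≤ (m ^ 2).divisors.card + (2 * m ^ 2).divisors.card := by
        exact_mod_cast h1
      nlinarith
    calc _ ≤ ∑ x ∈ P with g x = m, (m : ℝ) ^ (-1 - 4 * η) := by
          refine Finset.sum_le_sum fun x hx => ?_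
          rw [Finset.mem_filter] at hx
          have h := hg x hx.1
          rw [hx.2] at h
          have h1 : m ^ 2 ≤ x.1 * x.2 := by rcases h with h | h <;> rw [h]; linarith [sq_nonneg m]
          have h2 : (m : ℝ) ^ 2 ≤ ((x.1 * x.2 : ℕ) : ℝ) := by exact_mod_cast h1
          calc _ ≤ ((m : ℝ) ^ 2) ^ (-(1 / 2 : ℝ) - 2 * η) :=
                Real.rpow_le_rpow_of_nonpos (by positivity) h2 (by linarith)
            _ = _ := by
              rw [← Real.rpow_natCast, ← Real.rpow_mul hmp.le]; congr 1; push_cast; ring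
      _ = ((P.filter (fun x => g x = m)).card : ℝ) * (m : ℝ) ^ (-1 - 4 * η) := by
          rw [Finset.sum_const, nsmul_eq_mul]
      _ ≤ D * (1 + 2 ^ η) * (m : ℝ) ^ (2 * η) * (m : ℝ) ^ (-1 - 4 * η) := by gcongr
      _ = _ := by
          rw [mul_assoc, ← Real.rpow_add hmp]; congr 2; ring
  calc _ ≤ ∑ m ∈ P.image g, D * (1 + 2 ^ η) * (m : ℝ) ^ (-1 - 2 * η) := Finset.sum_le_sum key
    _ = D * (1 + 2 ^ η) * ∑ m ∈ P.image g, (m : ℝ) ^ (-1 - 2 * η) := by rw [Finset.mul_sum]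
    _ ≤ D * (1 + 2 ^ η) * S := by
        gcongr
        exact hs.sum_le_tsum _ fun m _ => by positivity
    _ ≤ _ := by linarith

open Classical in
/-- mean square over one residue class -/
theorem cls_ms (η : ℝ) (hη : 0 < η) : ∃ C : ℝ, 1 ≤ C ∧ ∀ (M N r : ℕ) (S : Finset ℕ) (b c : ℕ → ℝ),
    M ≤ N → r ∈ clC → (∀ n ∈ S, n ≠ 0) → (∀ n, |b n| ≤ |c n|) →
    ∑ k ∈ cls M r, (∑ n ∈ S, b n * jacobiSym (k : ℤ) (op n)) ^ 2 ≤
      N * ∑ x ∈ (S ×ˢ S).filter (fun x => IsSquare (op x.1 * op x.2)), |c x.1| * |c x.2| +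
      C * (∑ n ∈ S, |c n| * (n : ℝ) ^ (1 / 2 + η)) ^ 2 := by
  obtain ⟨C, hC, hb⟩ := JS_bound η hη
  refine ⟨C, hC, fun M N r S b c hMN hr hS hbc => ?_⟩
  have hr2 : r < 8 ∧ Odd r := by
    simp only [clC, Finset.mem_insert, Finset.mem_singleton] at hr
    rcases hr with rfl | rfl | rfl | rfl <;> decide
  have e1 : ∑ k ∈ cls M r, (∑ n ∈ S, b n * jacobiSym (k : ℤ) (op n)) ^ 2 =
      ∑ x ∈ S ×ˢ S, b x.1 * b x.2 * JS M r (op x.1 * op x.2) := by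
    simp only [JS, Finset.mul_sum]
    rw [Finset.sum_comm]
    refine Finset.sum_congr rfl fun k _ => ?_
    rw [sq, Finset.sum_mul_sum, ← Finset.sum_product']
    refine Finset.sum_congr rfl fun x hx => ?_
    rw [Finset.mem_product] at hx
    have h1 := op_odd (hS _ hx.1)
    have h2 := op_odd (hS _ hx.2)
    have : NeZero (op x.1) := ⟨by rintro h; simp [h] at h1⟩
    have : NeZero (op x.2) := ⟨by rintro h; simp [h] at h2⟩
    rw [jacobiSym.mul_right]; push_cast; ring
  rw [e1, Finset.sum_filter, Finset.mul_sum, sq (∑ n ∈ S, _), Finset.sum_mul_sum, ← Finset.sum_product',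
    Finset.mul_sum, ← Finset.sum_add_distrib]
  refine Finset.sum_le_sum fun x hx => ?_
  rw [Finset.mem_product] at hx
  have h1 := op_odd (hS _ hx.1)
  have h2 := op_odd (hS _ hx.2)
  have hJ := hb M r (op x.1 * op x.2) hr2.1 hr2.2 (h1.mul h2)
  have hle : ((op x.1 * op x.2 : ℕ) : ℝ) ^ (1 / 2 + η) ≤ (x.1 : ℝ) ^ (1 / 2 + η) * (x.2 : ℝ) ^ (1 / 2 + η) := by
    rw [← Real.mul_rpow (by positivity) (by positivity)]
    have : op x.1 * op x.2 ≤ x.1 * x.2 := Nat.mul_le_mul (Nat.div_le_self _ _) (Nat.div_le_self _ _)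
    apply Real.rpow_le_rpow (by positivity) _ (by linarith)
    exact_mod_cast this
  have hrho : |rho (op x.1 * op x.2) * (M / 8)| ≤ if IsSquare (op x.1 * op x.2) then (N : ℝ) else 0 := by
    split_ifs with h
    · rw [abs_of_nonneg (mul_nonneg (rho_nonneg _) (by positivity))]
      have := rho_le_one (op x.1 * op x.2)
      have hM : (M : ℝ) ≤ N := by exact_mod_cast hMN
      have hM0 : (0 : ℝ) ≤ M := by positivity
      calc _ ≤ 1 * ((M : ℝ) / 8) := by gcongr
        _ ≤ N := by linarith
    · simp [rho, h]
  have hJ2 : |JS M r (op x.1 * op x.2)| ≤ (if IsSquare (op x.1 * op x.2) then (N : ℝ) else 0) +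
      C * ((x.1 : ℝ) ^ (1 / 2 + η) * (x.2 : ℝ) ^ (1 / 2 + η)) := by
    have h3 : JS M r (op x.1 * op x.2) = rho (op x.1 * op x.2) * (M / 8) +
      (JS M r (op x.1 * op x.2) - rho (op x.1 * op x.2) * (M / 8)) := by ring
    rw [h3]
    refine (abs_add_le _ _).trans (add_le_add hrho (hJ.trans ?_))
    gcongr
  calc _ ≤ |b x.1 * b x.2 * JS M r (op x.1 * op x.2)| := le_abs_self _
    _ = |b x.1| * |b x.2| * |JS M r (op x.1 * op x.2)| := by rw [abs_mul, abs_mul]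
    _ ≤ |c x.1| * |c x.2| * ((if IsSquare (op x.1 * op x.2) then (N : ℝ) else 0) +
      C * ((x.1 : ℝ) ^ (1 / 2 + η) * (x.2 : ℝ) ^ (1 / 2 + η))) := by
        exact mul_le_mul (mul_le_mul (hbc _) (hbc _) (abs_nonneg _) (abs_nonneg _)) hJ2 (abs_nonneg _)
          (mul_nonneg (abs_nonneg _) (abs_nonneg _))
    _ = _ := by split_ifs <;> ring

/-- value of a Dirichlet polynomial -/
noncomputable def DP (S : Finset ℕ) (c : ℕ → ℝ) (Δ : ℤ) : ℝ := ∑ n ∈ S, c n * kro Δ n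

theorem FD_le (s : ℤ) (hs : s = 1 ∨ s = -1) (N : ℕ) (hN : 1 ≤ N) (F : ℤ → ℝ) (hF : ∀ Δ, 0 ≤ F Δ) :
    ∑ k ∈ FD s N, F (s * k) ≤
      ∑ r ∈ clA s, ∑ k ∈ cls N r, F (s * k) +
      ∑ r ∈ clB s, ∑ k ∈ cls (N / 4) r, F (s * 4 * k) +
      ∑ r ∈ clC, ∑ k ∈ cls (N / 8) r, F (s * 8 * k) := by
  have h := sum_FD s hs N hN F
  have h1 : 0 ≤ (if s = 1 then F 1 else 0) := by split_ifs; exact hF 1; exact le_rfl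
  have h2 : ∑ k ∈ FD s N, F (s * k) ≤ ∑ k ∈ FD s N, F (s * k) + (if s = 1 then F 1 else 0) := by linarith
  refine h2.trans (h.le.trans ?_)
  have e4 : ∀ k : ℕ, s * ((4 * k : ℕ) : ℤ) = s * 4 * k := fun k => by push_cast; ring
  have e8 : ∀ k : ℕ, s * ((8 * k : ℕ) : ℤ) = s * 8 * k := fun k => by push_cast; ring
  simp only [e4, e8]
  refine add_le_add (add_le_add ?_ ?_) ?_ <;> refine Finset.sum_le_sum fun r _ => ?_
  · exact Finset.sum_le_sum_of_subset_of_nonneg (Finset.filter_subset _ _) fun _ _ _ => hF _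
  · exact Finset.sum_le_sum_of_subset_of_nonneg (Finset.filter_subset _ _) fun _ _ _ => hF _
  · exact Finset.sum_le_sum_of_subset_of_nonneg (Finset.filter_subset _ _) fun _ _ _ => hF _

theorem chi8_mul_mod (a : ℤ) (k r : ℕ) (h : k % 8 = r) :
    ZMod.χ₈ ((a * (k : ℤ) : ℤ) : ZMod 8) = ZMod.χ₈ ((a * (r : ℤ) : ℤ) : ZMod 8) := by
  congr 1
  have : (r : ZMod 8) = (k : ZMod 8) := by rw [← h]; simp
  push_cast
  rw [this]

open Classical in
theorem ms_general (η : ℝ) (hη : 0 < η) : ∃ C : ℝ, 1 ≤ C ∧ ∀ (s : ℤ) (N : ℕ) (S : Finset ℕ) (c : ℕ → ℝ),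
    (s = 1 ∨ s = -1) → 1 ≤ N → (∀ n ∈ S, n ≠ 0) →
    ∑ k ∈ FD s N, (DP S c (s * k)) ^ 2 ≤
      8 * (N * ∑ x ∈ (S ×ˢ S).filter (fun x => IsSquare (op x.1 * op x.2)), |c x.1| * |c x.2| +
      C * (∑ n ∈ S, |c n| * (n : ℝ) ^ (1 / 2 + η)) ^ 2) := by
  obtain ⟨C, hC, hb⟩ := cls_ms η hη
  refine ⟨C, hC, fun s N S c hs hN hS => ?_⟩
  set E := (N * ∑ x ∈ (S ×ˢ S).filter (fun x => IsSquare (op x.1 * op x.2)), |c x.1| * |c x.2| +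
      C * (∑ n ∈ S, |c n| * (n : ℝ) ^ (1 / 2 + η)) ^ 2)
  have key : ∀ (a : ℤ) (M r : ℕ), M ≤ N → r ∈ clC → ∑ k ∈ cls M r, (DP S c (a * k)) ^ 2 ≤ E := by
    intro a M r hM hr
    refine le_trans (le_of_eq ?_) (hb M N r S (fun n => c n * ((ZMod.χ₈ ((a * (r : ℤ) : ℤ) : ZMod 8) : ℝ) ^ padicValNat 2 n *
      jacobiSym a (op n))) c hM hr hS ?_)
    · refine Finset.sum_congr rfl fun k hk => ?_
      congr 1
      unfold DP
      refine Finset.sum_congr rfl fun n hn => ?_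
      rw [kro_def, chi8_mul_mod a k r (mem_cls.mp hk).2, jacobiSym.mul_left]
      push_cast; ring
    · intro n
      rw [abs_mul, abs_mul, abs_pow]
      have h1 : |(ZMod.χ₈ ((a * (r : ℤ) : ℤ) : ZMod 8) : ℝ)| ≤ 1 := by
        rw [ZMod.χ₈_int_eq_if_mod_eight]
        split_ifs <;> simp
      have h2 := mul_le_one₀ (pow_le_one₀ (n := padicValNat 2 n) (abs_nonneg _) h1) (abs_nonneg _) (abs_jac_le a (op n))
      exact mul_le_of_le_one_right (abs_nonneg _) h2
  have hA : clA s ⊆ clC := by rcases hs with rfl | rfl <;> decide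
  have hB : clB s ⊆ clC := by rcases hs with rfl | rfl <;> decide
  have cA : (clA s).card = 2 := by rcases hs with rfl | rfl <;> decide
  have cB : (clB s).card = 2 := by rcases hs with rfl | rfl <;> decide
  have cC : clC.card = 4 := by decide
  have h := FD_le s hs N hN (fun Δ => DP S c Δ ^ 2) (fun _ => sq_nonneg _)
  refine h.trans ?_
  have a1 := Finset.sum_le_card_nsmul (clA s) (fun r => ∑ k ∈ cls N r, (DP S c (s * k)) ^ 2) E
    fun r hr => key s N r le_rfl (hA hr)
  have a2 := Finset.sum_le_card_nsmul (clB s) (fun r => ∑ k ∈ cls (N / 4) r, (DP S c (s * 4 * k)) ^ 2) E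
    fun r hr => key (s * 4) (N / 4) r (Nat.div_le_self _ _) (hB hr)
  have a3 := Finset.sum_le_card_nsmul clC (fun r => ∑ k ∈ cls (N / 8) r, (DP S c (s * 8 * k)) ^ 2) E
    fun r hr => key (s * 8) (N / 8) r (Nat.div_le_self _ _) hr
  rw [cA] at a1; rw [cB] at a2; rw [cC] at a3
  simp only [nsmul_eq_mul] at a1 a2 a3
  push_cast at a1 a2 a3
  linarith

/-- mean square with coefficients `|c n| ≤ b / max n H` -/
theorem ms_item (η : ℝ) (hη : 0 < η) (hη4 : η < 1 / 4) : ∃ C : ℝ, 1 ≤ C ∧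
    ∀ (s : ℤ) (N : ℕ) (S : Finset ℕ) (c : ℕ → ℝ) (b H : ℝ),
    (s = 1 ∨ s = -1) → 1 ≤ N → (∀ n ∈ S, n ≠ 0) → 0 < H → 0 ≤ b →
    (∀ n ∈ S, |c n| ≤ b / max (n : ℝ) H) →
    ∑ k ∈ FD s N, (DP S c (s * k)) ^ 2 ≤
      C * (N * b ^ 2 * H ^ (4 * η - 1) + (∑ n ∈ S, |c n| * (n : ℝ) ^ (1 / 2 + η)) ^ 2) := by
  classical
  obtain ⟨C, hC, hb⟩ := ms_general η hη
  obtain ⟨D, hD, hd⟩ := diag_sum η hη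
  refine ⟨8 * (C + D), by linarith, fun s N S c b H hs hN hS hH hb0 hc => ?_⟩
  refine (hb s N S c hs hN hS).trans ?_
  have hdiag : ∑ x ∈ (S ×ˢ S).filter (fun x => IsSquare (op x.1 * op x.2)), |c x.1| * |c x.2| ≤
      b ^ 2 * H ^ (4 * η - 1) * D := by
    refine le_trans ?_ (mul_le_mul_of_nonneg_left (hd ((S ×ˢ S).filter (fun x => IsSquare (op x.1 * op x.2))) ?_)
      (by positivity))
    · rw [Finset.mul_sum]
      refine Finset.sum_le_sum fun x hx => ?_
      rw [Finset.mem_filter, Finset.mem_product] at hx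
      have hone : ∀ n ∈ S, |c n| ≤ b * (H ^ (2 * η - 1 / 2) * (n : ℝ) ^ (-(1 / 2 : ℝ) - 2 * η)) := by
        intro n hn
        refine (hc n hn).trans ?_
        rw [div_eq_mul_inv]
        have hn0 : (0 : ℝ) < n := by exact_mod_cast Nat.pos_of_ne_zero (hS n hn)
        have hm : 0 < max (n : ℝ) H := lt_max_of_lt_left hn0
        gcongr
        calc (max (n : ℝ) H)⁻¹ = (max (n : ℝ) H) ^ (2 * η - 1 / 2) * (max (n : ℝ) H) ^ (-(1 / 2 : ℝ) - 2 * η) := by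
              rw [← Real.rpow_add hm, ← Real.rpow_neg_one]; congr 1; ring
          _ ≤ _ := by
              apply mul_le_mul _ _ (by positivity) (by positivity)
              · exact Real.rpow_le_rpow_of_nonpos hH (le_max_right _ _) (by linarith)
              · exact Real.rpow_le_rpow_of_nonpos hn0 (le_max_left _ _) (by linarith)
      calc _ ≤ (b * (H ^ (2 * η - 1 / 2) * (x.1 : ℝ) ^ (-(1 / 2 : ℝ) - 2 * η))) *
          (b * (H ^ (2 * η - 1 / 2) * (x.2 : ℝ) ^ (-(1 / 2 : ℝ) - 2 * η))) := by
            gcongr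
            · exact hone _ hx.1.1
            · exact hone _ hx.1.2
        _ = b ^ 2 * (H ^ (2 * η - 1 / 2) * H ^ (2 * η - 1 / 2)) *
          ((x.1 : ℝ) ^ (-(1 / 2 : ℝ) - 2 * η) * (x.2 : ℝ) ^ (-(1 / 2 : ℝ) - 2 * η)) := by ring
        _ = _ := by
            rw [← Real.rpow_add hH, ← Real.mul_rpow (by positivity) (by positivity)]
            push_cast
            congr 3; ring
    · intro x hx
      rw [Finset.mem_filter, Finset.mem_product] at hx
      exact ⟨hS _ hx.1.1, hS _ hx.1.2, hx.2⟩
  have hN0 : (0 : ℝ) ≤ N := by positivity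
  set Q := (∑ n ∈ S, |c n| * (n : ℝ) ^ (1 / 2 + η)) ^ 2
  have hQ : 0 ≤ Q := sq_nonneg _
  have hZ : 0 ≤ N * b ^ 2 * H ^ (4 * η - 1) := by positivity
  have h1 := mul_le_mul_of_nonneg_left hdiag hN0
  calc _ ≤ 8 * (N * (b ^ 2 * H ^ (4 * η - 1) * D) + C * Q) := by linarith
    _ ≤ _ := by nlinarith [mul_nonneg (show (0:ℝ) ≤ C by linarith) hZ, mul_nonneg (show (0:ℝ) ≤ D by linarith) hQ]

end

section

/-- integers by residue classes -/
def resEquiv (q : ℕ) [NeZero q] : ZMod q × ℤ ≃ ℤ where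
  toFun x := (x.1.val : ℤ) + q * x.2
  invFun m := ((m : ZMod q), m / q)
  left_inv x := by
    have hq : (q : ℤ) ≠ 0 := by exact_mod_cast NeZero.ne q
    ext
    · simp
    · simp only
      rw [Int.add_mul_ediv_left _ _ hq, Int.ediv_eq_zero_of_lt (by positivity)
        (by exact_mod_cast ZMod.val_lt x.1), zero_add]
  right_inv m := by
    simp only [ZMod.val_intCast]
    exact Int.emod_add_mul_ediv m q

theorem tsum_res {q : ℕ} [NeZero q] (f : ℤ → ℂ) (hf : Summable f) (K : ZMod q → ℂ)
    (hK : ∀ a : ZMod q, HasSum (fun n : ℤ => f (a.val + q * n)) (K a)) :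
    ∑' m, f m = ∑ a, K a := by
  have h1 : HasSum (f ∘ resEquiv q) (∑' m, f m) := (resEquiv q).hasSum_iff.mpr hf.hasSum
  have h2 := h1.prod_fiberwise (g := K) (fun a => hK a)
  exact h2.unique (hasSum_fintype K)

theorem gauss_res {q : ℕ} [NeZero q] (χ : DirichletCharacter ℂ q) (hχ : χ.IsPrimitive) (hq : χ⁻¹ = χ)
    (n : ℤ) : ∑ a : ZMod q, χ a * Complex.exp (2 * Real.pi * Complex.I * ((a.val / q : ℝ) : ℂ) * n) =
      χ (n : ZMod q) * gaussSum χ (ZMod.stdAddChar (N := q)) := by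
  have h := gaussSum_mulShift_of_isPrimitive (ZMod.stdAddChar (N := q)) hχ (n : ZMod q)
  rw [hq] at h
  rw [← h, gaussSum]
  refine Finset.sum_congr rfl fun a _ => ?_
  congr 1
  rw [AddChar.mulShift_apply]
  have : (n : ZMod q) * a = ((n * a.val : ℤ) : ZMod q) := by push_cast; simp
  rw [this, ZMod.stdAddChar_coe]
  congr 1
  push_cast; ring

theorem summable_gauss {t : ℝ} (ht : 0 < t) : Summable fun m : ℤ => Real.exp (-Real.pi * m ^ 2 * t) := by
  have := (HurwitzZeta.hasSum_int_evenKernel 0 ht).summable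
  simpa using this

theorem summable_gauss1 {t : ℝ} (ht : 0 < t) : Summable fun m : ℤ => (m : ℝ) * Real.exp (-Real.pi * m ^ 2 * t) := by
  have := (HurwitzZeta.hasSum_int_oddKernel 0 ht).summable
  simpa using this

theorem chi_norm_le {q : ℕ} (χ : DirichletCharacter ℂ q) (a : ZMod q) : ‖χ a‖ ≤ 1 :=
  DirichletCharacter.norm_le_one χ a

open HurwitzZeta Complex in
theorem tz_fe_even {q : ℕ} [NeZero q] (χ : DirichletCharacter ℂ q) (hχ : χ.IsPrimitive) (hq : χ⁻¹ = χ)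
    {t : ℝ} (ht : 0 < t) :
    ∑' m : ℤ, χ (m : ZMod q) * (Real.exp (-Real.pi * m ^ 2 * t) : ℂ) =
      ((1 / ((q : ℝ) ^ 2 * t) ^ (1 / 2 : ℝ) : ℝ) : ℂ) * (gaussSum χ (ZMod.stdAddChar (N := q)) *
        ∑' m : ℤ, χ (m : ZMod q) * (Real.exp (-Real.pi * m ^ 2 * (1 / ((q : ℝ) ^ 2 * t))) : ℂ)) := by
  have hq0 : (0 : ℝ) < q := by exact_mod_cast Nat.pos_of_ne_zero (NeZero.ne q)
  have hX : 0 < (q : ℝ) ^ 2 * t := by positivity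
  have hsum : Summable fun m : ℤ => χ (m : ZMod q) * (Real.exp (-Real.pi * m ^ 2 * t) : ℂ) := by
    refine Summable.of_norm_bounded (summable_gauss ht) fun m => ?_
    rw [norm_mul, Complex.norm_real, Real.norm_eq_abs, abs_of_pos (Real.exp_pos _)]
    exact mul_le_of_le_one_left (Real.exp_pos _).le (chi_norm_le χ _)
  rw [tsum_res _ hsum (fun a => χ a * (evenKernel ((a.val / q : ℝ) : UnitAddCircle) ((q : ℝ) ^ 2 * t) : ℂ))]
  · simp_rw [evenKernel_functional_equation]
    push_cast
    have h2 : HasSum (fun n : ℤ => ∑ a : ZMod q, χ a * (cexp (2 * Real.pi * I * ((a.val / q : ℝ) : ℂ) * n) *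
        (Real.exp (-Real.pi * n ^ 2 * (1 / ((q : ℝ) ^ 2 * t))) : ℂ)))
        (∑ a : ZMod q, χ a * (cosKernel ((a.val / q : ℝ) : UnitAddCircle) (1 / ((q : ℝ) ^ 2 * t)) : ℂ)) :=
      hasSum_sum fun a _ => (hasSum_int_cosKernel (a.val / q) (by positivity)).mul_left _
    have h3 : ∀ n : ℤ, ∑ a : ZMod q, χ a * (cexp (2 * Real.pi * I * ((a.val / q : ℝ) : ℂ) * n) *
        (Real.exp (-Real.pi * n ^ 2 * (1 / ((q : ℝ) ^ 2 * t))) : ℂ)) = gaussSum χ (ZMod.stdAddChar (N := q)) *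
        (χ (n : ZMod q) * (Real.exp (-Real.pi * n ^ 2 * (1 / ((q : ℝ) ^ 2 * t))) : ℂ)) := by
      intro n
      simp_rw [← mul_assoc]
      rw [← Finset.sum_mul, gauss_res χ hχ hq]
      ring
    simp_rw [h3] at h2
    have h4 := h2.tsum_eq
    rw [tsum_mul_left] at h4
    push_cast at h4
    rw [h4, Finset.mul_sum]
    refine Finset.sum_congr rfl fun a _ => ?_
    ring
  · intro a
    refine ((((hasSum_int_evenKernel (a.val / q) hX).mapL Complex.ofRealCLM)).mul_left (χ a)).congr_fun fun n => ?_
    simp only [Complex.ofRealCLM_apply]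
    congr 1
    · congr 1; simp
    · congr 2
      push_cast
      field_simp
      ring

open HurwitzZeta Complex in
theorem tz_fe_odd {q : ℕ} [NeZero q] (χ : DirichletCharacter ℂ q) (hχ : χ.IsPrimitive) (hq : χ⁻¹ = χ)
    {t : ℝ} (ht : 0 < t) :
    ∑' m : ℤ, χ (m : ZMod q) * (m * Real.exp (-Real.pi * m ^ 2 * t) : ℝ) =
      q * ((1 / ((q : ℝ) ^ 2 * t) ^ (3 / 2 : ℝ) : ℝ) : ℂ) * (-I * gaussSum χ (ZMod.stdAddChar (N := q)) *
        ∑' m : ℤ, χ (m : ZMod q) * (m * Real.exp (-Real.pi * m ^ 2 * (1 / ((q : ℝ) ^ 2 * t))) : ℝ)) := by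
  have hq0 : (0 : ℝ) < q := by exact_mod_cast Nat.pos_of_ne_zero (NeZero.ne q)
  have hX : 0 < (q : ℝ) ^ 2 * t := by positivity
  have hsum : Summable fun m : ℤ => χ (m : ZMod q) * (m * Real.exp (-Real.pi * m ^ 2 * t) : ℝ) := by
    refine Summable.of_norm_bounded (summable_gauss1 ht).abs fun m => ?_
    rw [norm_mul, Complex.norm_real, Real.norm_eq_abs]
    exact mul_le_of_le_one_left (abs_nonneg _) (chi_norm_le χ _)
  rw [tsum_res _ hsum (fun a => q * (χ a * (oddKernel ((a.val / q : ℝ) : UnitAddCircle) ((q : ℝ) ^ 2 * t) : ℂ)))]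
  · simp_rw [oddKernel_functional_equation]
    push_cast
    have h2 : HasSum (fun n : ℤ => ∑ a : ZMod q, χ a * (-I * n * cexp (2 * Real.pi * I * ((a.val / q : ℝ) : ℂ) * n) *
        (Real.exp (-Real.pi * n ^ 2 * (1 / ((q : ℝ) ^ 2 * t))) : ℂ)))
        (∑ a : ZMod q, χ a * (sinKernel ((a.val / q : ℝ) : UnitAddCircle) (1 / ((q : ℝ) ^ 2 * t)) : ℂ)) :=
      hasSum_sum fun a _ => (hasSum_int_sinKernel (a.val / q) (by positivity)).mul_left _
    have h3 : ∀ n : ℤ, ∑ a : ZMod q, χ a * (-I * n * cexp (2 * Real.pi * I * ((a.val / q : ℝ) : ℂ) * n) *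
        (Real.exp (-Real.pi * n ^ 2 * (1 / ((q : ℝ) ^ 2 * t))) : ℂ)) = -I * gaussSum χ (ZMod.stdAddChar (N := q)) *
        (χ (n : ZMod q) * ((n * Real.exp (-Real.pi * n ^ 2 * (1 / ((q : ℝ) ^ 2 * t))) : ℝ) : ℂ)) := by
      intro n
      have : ∀ a : ZMod q, χ a * (-I * n * cexp (2 * Real.pi * I * ((a.val / q : ℝ) : ℂ) * n) *
        (Real.exp (-Real.pi * n ^ 2 * (1 / ((q : ℝ) ^ 2 * t))) : ℂ)) =
        (χ a * cexp (2 * Real.pi * I * ((a.val / q : ℝ) : ℂ) * n)) * (-I * n *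
        (Real.exp (-Real.pi * n ^ 2 * (1 / ((q : ℝ) ^ 2 * t))) : ℂ)) := fun a => by ring
      simp_rw [this]
      rw [← Finset.sum_mul, gauss_res χ hχ hq]
      push_cast
      ring
    simp_rw [h3] at h2
    have h4 := h2.tsum_eq
    rw [tsum_mul_left] at h4
    push_cast at h4
    rw [h4, Finset.mul_sum]
    refine Finset.sum_congr rfl fun a _ => ?_
    ring
  · intro a
    refine ((((hasSum_int_oddKernel (a.val / q) hX).mapL Complex.ofRealCLM).mul_left (χ a)).mul_left (q : ℂ)).congr_fun fun n => ?_
    simp only [Complex.ofRealCLM_apply]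
    have e1 : -Real.pi * ((n : ℝ) + (a.val : ℝ) / q) ^ 2 * ((q : ℝ) ^ 2 * t) =
      -Real.pi * (((a.val + q * n : ℤ)) : ℝ) ^ 2 * t := by
        push_cast; field_simp; ring
    have e2 : (((a.val : ℤ) + q * n : ℤ) : ZMod q) = a := by simp
    rw [e1, e2]
    push_cast
    have : (q : ℂ) ≠ 0 := by exact_mod_cast NeZero.ne q
    field_simp
    ring

theorem norm_gauss {q : ℕ} [NeZero q] (χ : DirichletCharacter ℂ q) (hχ : χ.IsPrimitive) (hq : χ⁻¹ = χ) :
    ‖gaussSum χ (ZMod.stdAddChar (N := q))‖ = (q : ℝ) ^ (1 / 2 : ℝ) := by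
  have h := gauss_prim_sq (ZMod.stdAddChar (N := q)) (ZMod.isPrimitive_stdAddChar q) hχ hq
  have h2 := congrArg norm h
  have h3 : ‖χ (-1)‖ = 1 := by
    have : χ (-1) * χ (-1) = 1 := by rw [← map_mul]; simp
    have h4 := congrArg norm this
    rw [norm_mul, norm_one] at h4
    nlinarith [norm_nonneg (χ (-1))]
  rw [norm_pow, norm_mul, h3, one_mul, Complex.norm_natCast] at h2
  rw [← Real.sqrt_eq_rpow, ← h2, Real.sqrt_sq (norm_nonneg _)]

end

section

noncomputable def psi (s : ℤ) (v : ℝ) : ℝ :=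
  if s = 1 then Real.exp (-Real.pi * v) else √v * Real.exp (-Real.pi * v)

noncomputable def Phi (s : ℤ) (k : ℕ) (t : ℝ) : ℝ :=
  ∑' n : ℕ, (kro (s * k) (n + 1) : ℝ) * psi s ((n + 1 : ℝ) ^ 2 * t)

/-- functional equation, as a property of the pair -/
def FEP (s : ℤ) (k : ℕ) : Prop := ∀ t : ℝ, 0 < t →
  |Phi s k t| = (k : ℝ) ^ (-(1 / 2) : ℝ) * t ^ (-(1 / 2) : ℝ) * |Phi s k (1 / ((k : ℝ) ^ 2 * t))|

theorem psi_nonneg (s : ℤ) (v : ℝ) : 0 ≤ psi s v := by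
  unfold psi; split_ifs <;> positivity

theorem psi_cont (s : ℤ) : Continuous (psi s) := by
  unfold psi; split_ifs <;> fun_prop

theorem psi_le_exp (s : ℤ) {v : ℝ} (hv : 0 ≤ v) : psi s v ≤ Real.exp (-v) := by
  have h3 := Real.pi_gt_three
  unfold psi; split_ifs
  · apply Real.exp_le_exp.mpr; nlinarith
  · have h1 : √v ≤ Real.exp v := by
      have := Real.add_one_le_exp v
      have h2 : √v ≤ 1 + v := by
        rw [Real.sqrt_le_left (by linarith)]; nlinarith
      linarith
    calc √v * Real.exp (-Real.pi * v) ≤ Real.exp v * Real.exp (-Real.pi * v) := by gcongr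
      _ = Real.exp (v + -Real.pi * v) := (Real.exp_add _ _).symm
      _ ≤ _ := by apply Real.exp_le_exp.mpr; nlinarith

theorem exp_neg_le_pow (j : ℕ) {v : ℝ} (hv : 0 < v) : Real.exp (-v) ≤ j.factorial / v ^ j := by
  have := Real.pow_div_factorial_le_exp v hv.le j
  rw [Real.exp_neg, inv_eq_one_div, div_le_div_iff₀ (Real.exp_pos _) (by positivity), one_mul]
  rw [div_le_iff₀ (by positivity)] at this
  linarith

theorem exp_neg_le_rpow {a : ℝ} (ha0 : 0 ≤ a) (ha : a ≤ 1) {v : ℝ} (hv : 0 < v) :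
    Real.exp (-v) ≤ v ^ (-a) := by
  rcases le_total v 1 with h | h
  · have : 1 ≤ v ^ (-a) := Real.one_le_rpow_of_pos_of_le_one_of_nonpos hv h (by linarith)
    have := Real.exp_le_one_iff.mpr (by linarith : -v ≤ 0)
    linarith
  · have h1 := exp_neg_le_pow 1 hv
    have h2 : v ^ (-1 : ℝ) ≤ v ^ (-a) := Real.rpow_le_rpow_of_exponent_le h (by linarith)
    rw [Real.rpow_neg_one] at h2
    simp at h1
    linarith

theorem psi_le_rpow (s : ℤ) {a : ℝ} (ha0 : 0 ≤ a) (ha : a ≤ 1) {v : ℝ} (hv : 0 < v) :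
    psi s v ≤ v ^ (-a) := (psi_le_exp s hv.le).trans (exp_neg_le_rpow ha0 ha hv)

theorem psi_n_le (s : ℤ) {a : ℝ} (ha0 : 0 ≤ a) (ha : a ≤ 1) (n : ℕ) {t : ℝ} (ht : 0 < t) :
    psi s ((n + 1 : ℝ) ^ 2 * t) ≤ t ^ (-a) * ((n + 1 : ℕ) : ℝ) ^ (-(2 * a)) := by
  refine (psi_le_rpow s ha0 ha (by positivity)).trans (le_of_eq ?_)
  rw [Real.mul_rpow (by positivity) ht.le, mul_comm, ← Real.rpow_natCast, ← Real.rpow_mul (by positivity)]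
  push_cast
  ring_nf

theorem summable_shift {a : ℝ} (ha : 1 / 2 < a) : Summable fun n : ℕ => ((n + 1 : ℕ) : ℝ) ^ (-(2 * a)) :=
  (summable_nat_add_iff 1 (f := fun n : ℕ => (n : ℝ) ^ (-(2 * a)))).mpr
    (Real.summable_nat_rpow.mpr (by linarith))

theorem Phi_term_le (s : ℤ) (k n : ℕ) (t : ℝ) :
    ‖(kro (s * k) (n + 1) : ℝ) * psi s ((n + 1 : ℝ) ^ 2 * t)‖ ≤ psi s ((n + 1 : ℝ) ^ 2 * t) := by
  rw [norm_mul, Real.norm_eq_abs, Real.norm_eq_abs, abs_of_nonneg (psi_nonneg _ _)]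
  exact mul_le_of_le_one_left (psi_nonneg _ _) (abs_kro_le _ _)

theorem Phi_summable (s : ℤ) (k : ℕ) {t : ℝ} (ht : 0 < t) :
    Summable fun n : ℕ => (kro (s * k) (n + 1) : ℝ) * psi s ((n + 1 : ℝ) ^ 2 * t) :=
  Summable.of_norm_bounded ((summable_shift (a := 1) (by norm_num)).mul_left (t ^ (-1 : ℝ)))
    fun n => (Phi_term_le s k n t).trans (psi_n_le s (by norm_num) le_rfl n ht)

theorem Phi_bound {a : ℝ} (ha0 : 1 / 2 < a) (ha : a ≤ 1) : ∃ C : ℝ, 1 ≤ C ∧ ∀ (s : ℤ) (k : ℕ) (t : ℝ), 0 < t →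
    |Phi s k t| ≤ C * t ^ (-a) := by
  refine ⟨max 1 (∑' n : ℕ, ((n + 1 : ℕ) : ℝ) ^ (-(2 * a))), le_max_left _ _, fun s k t ht => ?_⟩
  have h := tsum_of_norm_bounded ((summable_shift ha0).hasSum.mul_left (t ^ (-a)))
    (fun n => (Phi_term_le s k n t).trans (psi_n_le s (by linarith) ha n ht))
  rw [Real.norm_eq_abs] at h
  refine h.trans ?_
  rw [mul_comm]
  gcongr
  exact le_max_right _ _

theorem Phi_cont (s : ℤ) (k : ℕ) : ContinuousOn (Phi s k) (Set.Ioi 0) := by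
  intro t ht
  have ht' : 0 < t := ht
  have h : ContinuousOn (Phi s k) (Set.Ioi (t / 2)) := by
    unfold Phi
    refine continuousOn_tsum (fun n => ?_) ((summable_shift (a := 1) (by norm_num)).mul_left ((t / 2) ^ (-1 : ℝ)))
      fun n y hy => (Phi_term_le s k n y).trans ((psi_n_le s (by norm_num) le_rfl n ?_).trans ?_)
    · have := psi_cont s
      fun_prop
    · exact lt_trans (by positivity) hy
    · have hy' : t / 2 < y := hy
      have : y ^ (-1 : ℝ) ≤ (t / 2) ^ (-1 : ℝ) := by
        rw [Real.rpow_neg_one, Real.rpow_neg_one]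
        exact inv_anti₀ (by positivity) hy'.le
      gcongr
  exact (h.continuousAt (Ioi_mem_nhds (by linarith))).continuousWithinAt

theorem fund_one_lt {Δ : ℤ} (h : IsFundamentalDiscriminant Δ) : 1 < Δ.natAbs := by
  rcases h with ⟨h1, ⟨hmod, _⟩ | ⟨m, hm, _, hmod⟩⟩ <;> omega

end

section

theorem tsum_int_even (f : ℤ → ℂ) (hf : Summable f) (h0 : f 0 = 0) (he : ∀ m, f (-m) = f m) :
    ∑' m, f m = 2 * ∑' n : ℕ, f ((n : ℤ) + 1) := by
  have h1 : Summable fun n : ℕ => f ((n : ℤ) + 1) :=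
    hf.comp_injective (i := fun n : ℕ => (n : ℤ) + 1) (fun a b h => by simpa using h)
  have h2 : Summable fun n : ℕ => f (-((n : ℤ) + 1)) := by simpa only [he] using h1
  rw [tsum_of_add_one_of_neg_add_one h1 h2, h0]
  simp only [he]
  ring

theorem chi_kro {s : ℤ} {k q : ℕ} [NeZero q] (hq : q = (s * k).natAbs) (hf : IsFundamentalDiscriminant (s * k))
    (χ : DirichletCharacter ℂ q) (h2 : χ ^ 2 = 1) (hp : χ.IsPrimitive)
    (hs : χ (-1) = if 0 < s * (k : ℤ) then 1 else -1) (n : ℕ) :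
    χ (((n + 1 : ℕ)) : ZMod q) = ((kro (s * k) (n + 1) : ℝ) : ℂ) := by
  rw [← quadZ_cast h2, quadZ_eq_kro hq hf χ h2 hp hs (n + 1) (by omega)]
  push_cast; rfl

theorem chi_zero {q : ℕ} (hq : 1 < q) (χ : DirichletCharacter ℂ q) : χ 0 = 0 := by
  apply χ.map_nonunit
  have : Fact (1 < q) := ⟨hq⟩
  simp

theorem sgn_pos {s : ℤ} (hs : s = 1 ∨ s = -1) {k : ℕ} (hk : 0 < k) :
    (if 0 < s * (k : ℤ) then (1 : ℂ) else -1) = s := by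
  rcases hs with rfl | rfl
  · rw [if_pos (by simpa using hk)]; simp
  · rw [if_neg (by simp)]; simp

theorem Tz_pos {k q : ℕ} [NeZero q] (hq : q = ((1 : ℤ) * k).natAbs) (hf : IsFundamentalDiscriminant ((1 : ℤ) * k))
    (χ : DirichletCharacter ℂ q) (h2 : χ ^ 2 = 1) (hp : χ.IsPrimitive)
    (hs : χ (-1) = if 0 < (1 : ℤ) * (k : ℤ) then 1 else -1) {t : ℝ} (ht : 0 < t) :
    ∑' m : ℤ, χ (m : ZMod q) * (Real.exp (-Real.pi * m ^ 2 * t) : ℝ) = 2 * (Phi 1 k t : ℂ) := by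
  have hq1 := fund_one_lt hf
  have hk : 0 < k := by rw [Int.natAbs_mul] at hq1; simp at hq1; omega
  rw [sgn_pos (Or.inl rfl) hk] at hs
  rw [tsum_int_even]
  · rw [Phi, Complex.ofReal_tsum]
    congr 2
    ext n
    have := chi_kro hq hf χ h2 hp (by rw [sgn_pos (Or.inl rfl) hk]; exact hs) n
    push_cast at this ⊢
    rw [this]
    have e : -Real.pi * ((n : ℝ) + 1) ^ 2 * t = -Real.pi * (((n : ℝ) + 1) ^ 2 * t) := by ring
    have e' := congrArg (fun x : ℝ => Complex.exp (x : ℂ)) e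
    push_cast at e'
    simp only [psi, if_pos]
    push_cast
    rw [e']
  · refine Summable.of_norm_bounded (summable_gauss ht) fun m => ?_
    rw [norm_mul, Complex.norm_real, Real.norm_eq_abs, abs_of_pos (Real.exp_pos _)]
    exact mul_le_of_le_one_left (Real.exp_pos _).le (chi_norm_le χ _)
  · simp [chi_zero (hq ▸ hq1) χ]
  · intro m
    have : χ ((-m : ℤ) : ZMod q) = χ (m : ZMod q) := by
      rw [Int.cast_neg, ← neg_one_mul, map_mul, hs]; simp
    rw [this]; push_cast; ring_nf

theorem Tz_neg {k q : ℕ} [NeZero q] (hq : q = ((-1 : ℤ) * k).natAbs) (hf : IsFundamentalDiscriminant ((-1 : ℤ) * k))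
    (χ : DirichletCharacter ℂ q) (h2 : χ ^ 2 = 1) (hp : χ.IsPrimitive)
    (hs : χ (-1) = if 0 < (-1 : ℤ) * (k : ℤ) then 1 else -1) {t : ℝ} (ht : 0 < t) :
    ∑' m : ℤ, χ (m : ZMod q) * (m * Real.exp (-Real.pi * m ^ 2 * t) : ℝ) =
      2 * ((t ^ (-(1 / 2) : ℝ) : ℝ) : ℂ) * (Phi (-1) k t : ℂ) := by
  have hq1 := fund_one_lt hf
  have hk : 0 < k := by rw [Int.natAbs_mul] at hq1; simp at hq1; omega
  rw [sgn_pos (Or.inr rfl) hk] at hs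
  rw [tsum_int_even]
  · rw [mul_assoc]
    congr 1
    rw [Phi, Complex.ofReal_tsum, ← tsum_mul_left]
    refine tsum_congr fun n => ?_
    have := chi_kro hq hf χ h2 hp (by rw [sgn_pos (Or.inr rfl) hk]; exact hs) n
    have e1 : psi (-1) ((n + 1 : ℝ) ^ 2 * t) = t ^ (1 / 2 : ℝ) * ((n + 1 : ℝ) * Real.exp (-Real.pi * (n + 1 : ℝ) ^ 2 * t)) := by
      rw [psi, if_neg (by norm_num), Real.sqrt_mul (by positivity), Real.sqrt_sq (by positivity), Real.sqrt_eq_rpow]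
      ring_nf
    have e2 : t ^ (-(1 / 2) : ℝ) * t ^ (1 / 2 : ℝ) = 1 := by
      rw [← Real.rpow_add ht]; simp
    have e3 : ∀ A B : ℝ, t ^ (-(1 / 2) : ℝ) * (A * (t ^ (1 / 2 : ℝ) * B)) = A * B := by
      intro A B
      calc _ = (t ^ (-(1 / 2) : ℝ) * t ^ (1 / 2 : ℝ)) * (A * B) := by ring
        _ = _ := by rw [e2, one_mul]
    rw [e1, ← Complex.ofReal_mul, e3, Complex.ofReal_mul (kro _ _ : ℝ), ← this]
    push_cast
    rfl
  · refine Summable.of_norm_bounded (summable_gauss1 ht).abs fun m => ?_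
    rw [norm_mul, Complex.norm_real, Real.norm_eq_abs]
    exact mul_le_of_le_one_left (abs_nonneg _) (chi_norm_le χ _)
  · simp
  · intro m
    have : χ ((-m : ℤ) : ZMod q) = -χ (m : ZMod q) := by
      rw [Int.cast_neg, ← neg_one_mul, map_mul, hs]; simp
    rw [this]; push_cast; ring_nf

theorem chi_inv {q : ℕ} {χ : DirichletCharacter ℂ q} (h2 : χ ^ 2 = 1) : χ⁻¹ = χ := by
  rw [sq] at h2
  exact inv_eq_of_mul_eq_one_left h2

theorem FEP_of {s : ℤ} (hs1 : s = 1 ∨ s = -1) {k q : ℕ} [NeZero q] (hq : q = (s * k).natAbs)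
    (hf : IsFundamentalDiscriminant (s * k))
    (χ : DirichletCharacter ℂ q) (h2 : χ ^ 2 = 1) (hp : χ.IsPrimitive)
    (hs : χ (-1) = if 0 < s * (k : ℤ) then 1 else -1) : FEP s k := by
  intro t ht
  have hqk : q = k := by rw [hq]; rcases hs1 with rfl | rfl <;> simp
  subst hqk
  have hq0 : (0 : ℝ) < q := by exact_mod_cast Nat.pos_of_ne_zero (NeZero.ne q)
  have hg := norm_gauss χ hp (chi_inv h2)
  have hT : 0 < 1 / ((q : ℝ) ^ 2 * t) := by positivity
  have E : ∀ z : ℝ, ((q : ℝ) ^ 2 * t) ^ z = (q : ℝ) ^ (2 * z) * t ^ z := by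
    intro z
    rw [Real.mul_rpow (by positivity) ht.le, ← Real.rpow_natCast, ← Real.rpow_mul hq0.le]; norm_num
  rcases hs1 with rfl | rfl
  · have h := tz_fe_even χ hp (chi_inv h2) ht
    rw [Tz_pos hq hf χ h2 hp hs ht, Tz_pos hq hf χ h2 hp hs hT] at h
    have h' := congrArg norm h
    simp only [norm_mul, Complex.norm_real, hg, Real.norm_eq_abs] at h'
    simp only [RCLike.norm_ofNat] at h'
    have p1 : 0 < 1 / ((q : ℝ) ^ 2 * t) ^ (1 / 2 : ℝ) := by positivity
    rw [abs_of_pos p1, E] at h'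
    have : (q : ℝ) ^ (-(1 / 2) : ℝ) = (q : ℝ) ^ (1 / 2 : ℝ) / (q : ℝ) ^ (2 * (1 / 2) : ℝ) := by
      rw [← Real.rpow_sub hq0]; norm_num
    rw [this, Real.rpow_neg ht.le]
    have h3 : 0 < t ^ (1 / 2 : ℝ) := by positivity
    field_simp at h' ⊢
    linarith
  · have h := tz_fe_odd χ hp (chi_inv h2) ht
    rw [Tz_neg hq hf χ h2 hp hs ht, Tz_neg hq hf χ h2 hp hs hT] at h
    have h' := congrArg norm h
    simp only [norm_mul, norm_neg, Complex.norm_I, Complex.norm_real, hg, Real.norm_eq_abs, Complex.norm_natCast] at h'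
    simp only [RCLike.norm_ofNat] at h'
    have p1 : 0 < 1 / ((q : ℝ) ^ 2 * t) ^ (3 / 2 : ℝ) := by positivity
    have p2 : 0 < (1 / ((q : ℝ) ^ 2 * t)) ^ (-(1 / 2) : ℝ) := by positivity
    have p3 : 0 < t ^ (-(1 / 2) : ℝ) := by positivity
    have p4 : (1 / ((q : ℝ) ^ 2 * t)) ^ (-(1 / 2) : ℝ) = ((q : ℝ) ^ (2 * (-(1 / 2)) : ℝ) * t ^ (-(1 / 2) : ℝ))⁻¹ := by
      rw [one_div, Real.inv_rpow (by positivity), E]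
    rw [abs_of_pos p1, abs_of_pos p2, abs_of_pos p3, p4, E] at h'
    have e1 : t ^ (3 / 2 : ℝ) = t * t ^ (1 / 2 : ℝ) := by
      rw [← Real.rpow_one_add' ht.le (by norm_num)]; norm_num
    have e2 : t ^ (-(1 / 2) : ℝ) = (t ^ (1 / 2 : ℝ))⁻¹ := Real.rpow_neg ht.le _
    have e4 : (q : ℝ) ^ (2 * (3 / 2) : ℝ) = q ^ 3 := by norm_num
    have e5 : (q : ℝ) ^ (2 * (-(1 / 2)) : ℝ) = (q : ℝ)⁻¹ := by
      rw [show (2 * (-(1 / 2)) : ℝ) = -1 by norm_num, Real.rpow_neg_one]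
    have e6 : (q : ℝ) ^ (-(1 / 2) : ℝ) = ((q : ℝ) ^ (1 / 2 : ℝ))⁻¹ := Real.rpow_neg hq0.le _
    have e7 : (q : ℝ) ^ (1 / 2 : ℝ) * (q : ℝ) ^ (1 / 2 : ℝ) = q := by
      rw [← Real.rpow_add hq0]; norm_num
    have e8 : t ^ (1 / 2 : ℝ) * t ^ (1 / 2 : ℝ) = t := by
      rw [← Real.rpow_add ht]; norm_num
    rw [e1, e2, e4, e5] at h'
    rw [e2, e6]
    set Q := (q : ℝ) ^ (1 / 2 : ℝ) with hQ
    set T := t ^ (1 / 2 : ℝ) with hTT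
    have hQ0 : 0 < Q := by positivity
    have hT0 : 0 < T := by positivity
    rw [← e7, ← e8] at h' ⊢
    field_simp at h' ⊢
    linarith

end

section

noncomputable def cs (s : ℤ) : ℝ := if s = 1 then 1 else Real.pi

noncomputable def Lr (s : ℤ) (k : ℕ) : ℝ := cs s * ∫ t in Set.Ioi (0 : ℝ), Phi s k t * t ^ (-(1 / 2) : ℝ)

theorem Phi_bound_zero (s : ℤ) (k : ℕ) (hk : 0 < k) (h : FEP s k) :
    ∃ C : ℝ, 0 ≤ C ∧ ∀ t, 0 < t → |Phi s k t| ≤ C * t ^ (1 / 2 : ℝ) := by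
  obtain ⟨C, hC, hb⟩ := Phi_bound (a := 1) (by norm_num) le_rfl
  have hk' : (0 : ℝ) < k := by exact_mod_cast hk
  refine ⟨(k : ℝ) ^ (-(1 / 2) : ℝ) * (C * k ^ 2), by positivity, fun t ht => ?_⟩
  rw [h t ht]
  have h1 := hb s k (1 / ((k : ℝ) ^ 2 * t)) (by positivity)
  rw [Real.rpow_neg_one, one_div, inv_inv, ← one_div] at h1
  calc (k : ℝ) ^ (-(1 / 2) : ℝ) * t ^ (-(1 / 2) : ℝ) * |Phi s k (1 / ((k : ℝ) ^ 2 * t))|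
      ≤ (k : ℝ) ^ (-(1 / 2) : ℝ) * t ^ (-(1 / 2) : ℝ) * (C * (k ^ 2 * t)) := by
        gcongr
    _ = (k : ℝ) ^ (-(1 / 2) : ℝ) * (C * k ^ 2) * (t ^ (-(1 / 2) : ℝ) * t) := by ring
    _ = _ := by
        congr 1
        rw [← Real.rpow_add_one' ht.le (by norm_num)]; norm_num

open MeasureTheory Filter Topology Asymptotics

theorem mellin_diff (s : ℤ) (k : ℕ) (hk : 0 < k) (h : FEP s k) (δ : ℝ) :
    DifferentiableAt ℂ (mellin (fun t => ((Phi s k t * t ^ (-(δ / 2)) : ℝ) : ℂ))) (((1 + δ) / 2 : ℝ) : ℂ) := by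
  obtain ⟨C, hC, hb⟩ := Phi_bound (a := 1) (by norm_num) le_rfl
  obtain ⟨C0, hC0, hb0⟩ := Phi_bound_zero s k hk h
  refine mellin_differentiableAt_of_isBigO_rpow (a := 1 + δ / 2) (b := -(1 / 2 - δ / 2)) ?_ ?_ ?_ ?_ ?_
  · refine ContinuousOn.locallyIntegrableOn ?_ measurableSet_Ioi
    refine Complex.continuous_ofReal.comp_continuousOn ((Phi_cont s k).mul ?_)
    exact fun t ht => (Real.continuousAt_rpow_const t _ (Or.inl (ne_of_gt ht))).continuousWithinAt
  · refine IsBigO.of_bound C ?_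
    filter_upwards [eventually_gt_atTop 0] with t ht
    rw [Complex.norm_real, norm_mul, Real.norm_eq_abs, Real.norm_of_nonneg (by positivity), Real.norm_of_nonneg (by positivity)]
    calc |Phi s k t| * t ^ (-(δ / 2)) ≤ C * t ^ (-1 : ℝ) * t ^ (-(δ / 2)) := by gcongr; exact hb s k t ht
      _ = _ := by rw [mul_assoc, ← Real.rpow_add ht]; ring_nf
  · rw [Complex.ofReal_re]; linarith
  · refine IsBigO.of_bound C0 ?_
    filter_upwards [self_mem_nhdsWithin] with t ht
    have ht : 0 < t := ht
    rw [Complex.norm_real, norm_mul, Real.norm_eq_abs, Real.norm_of_nonneg (by positivity), Real.norm_of_nonneg (by positivity)]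
    calc |Phi s k t| * t ^ (-(δ / 2)) ≤ C0 * t ^ (1 / 2 : ℝ) * t ^ (-(δ / 2)) := by gcongr; exact hb0 t ht
      _ = _ := by rw [mul_assoc, ← Real.rpow_add ht]; ring_nf
  · rw [Complex.ofReal_re]; linarith

theorem LS_shift (f : ℕ → ℂ) {z : ℂ} (hz : 1 < z.re) (hf : ∀ n, ‖f n‖ ≤ 1) :
    LSeries f z = ∑' n : ℕ, f (n + 1) / ((n + 1 : ℝ) : ℂ) ^ z := by
  have hs : LSeriesSummable f z := LSeriesSummable_of_bounded_of_one_lt_re (m := 1) (fun n _ => hf n) hz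
  rw [LSeries, Summable.tsum_eq_zero_add hs, LSeries.term_zero, zero_add]
  refine tsum_congr fun n => ?_
  rw [LSeries.term_of_ne_zero (by omega)]
  push_cast; rfl

theorem LS_summ (s : ℤ) (k : ℕ) {σ : ℝ} (hσ : 1 < σ) :
    Summable fun n : ℕ => ‖((kro (s * k) (n + 1) : ℝ) : ℂ)‖ / |(n + 1 : ℝ)| ^ σ := by
  refine Summable.of_nonneg_of_le (fun n => by positivity) (fun n => ?_) (summable_shift (a := σ / 2) (by linarith))
  rw [abs_of_pos (by positivity), Complex.norm_real, Real.norm_eq_abs, div_eq_mul_inv, ← Real.rpow_neg (by positivity)]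
  push_cast
  rw [show -(2 * (σ / 2)) = -σ by ring]
  exact mul_le_of_le_one_left (by positivity) (abs_kro_le _ _)

theorem L_mellin {s : ℤ} (hs1 : s = 1 ∨ s = -1) {k q : ℕ} [NeZero q] (hq : q = (s * k).natAbs)
    (hf : IsFundamentalDiscriminant (s * k))
    (χ : DirichletCharacter ℂ q) (h2 : χ ^ 2 = 1) (hp : χ.IsPrimitive)
    (hs : χ (-1) = if 0 < s * (k : ℤ) then 1 else -1) {σ δ : ℝ} (hσ : 1 < σ) (hδ : δ = if s = 1 then 0 else 1) :
    Complex.Gammaℝ (σ + δ) * DirichletCharacter.LFunction χ σ =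
      mellin (fun t => ((Phi s k t * t ^ (-(δ / 2)) : ℝ) : ℂ)) (((σ + δ) / 2 : ℝ) : ℂ) := by
  have hσ' : 1 < (σ : ℂ).re := by simpa using hσ
  rw [DirichletCharacter.LFunction_eq_LSeries χ hσ', LS_shift _ hσ' (fun n => chi_norm_le χ _), ← tsum_mul_left]
  have hc := chi_kro hq hf χ h2 hp hs
  simp_rw [hc]
  have hsum := LS_summ s k hσ
  rcases hs1 with rfl | rfl
  · simp only [if_true] at hδ
    subst hδ
    have := hasSum_mellin_pi_mul_sq (a := fun n : ℕ => ((kro (1 * k) (n + 1) : ℝ) : ℂ)) (r := fun n : ℕ => (n + 1 : ℝ))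
      (F := fun t => ((Phi 1 k t * t ^ (-((0 : ℝ) / 2)) : ℝ) : ℂ)) (s := (σ : ℂ)) (by simp; linarith) ?_ (by simpa using hsum)
    · rw [show (((σ + 0) / 2 : ℝ) : ℂ) = (σ : ℂ) / 2 by push_cast; ring, ← this.tsum_eq]
      refine tsum_congr fun n => ?_
      rw [abs_of_pos (by positivity)]
      simp only [Complex.ofReal_zero, add_zero]
      ring
    · intro t ht
      have h1 := (Phi_summable 1 k (Set.mem_Ioi.mp ht)).hasSum.mapL Complex.ofRealCLM
      simp only [zero_div, neg_zero, Real.rpow_zero, mul_one]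
      refine h1.congr_fun fun n => ?_
      have h0 : (n + 1 : ℝ) ≠ 0 := by positivity
      rw [if_neg h0]
      simp only [Complex.ofRealCLM_apply, psi, if_true]
      push_cast
      ring_nf
  · rw [if_neg (by norm_num)] at hδ
    subst hδ
    have := hasSum_mellin_pi_mul_sq' (a := fun n : ℕ => ((kro (-1 * k) (n + 1) : ℝ) : ℂ)) (r := fun n : ℕ => (n + 1 : ℝ))
      (F := fun t => ((Phi (-1) k t * t ^ (-((1 : ℝ) / 2)) : ℝ) : ℂ)) (s := (σ : ℂ)) (by simp; linarith) ?_ (by simpa using hsum)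
    · rw [show (((σ + 1) / 2 : ℝ) : ℂ) = ((σ : ℂ) + 1) / 2 by push_cast; ring, ← this.tsum_eq]
      refine tsum_congr fun n => ?_
      have h0 : (0 : ℝ) < (n + 1 : ℝ) := by positivity
      rw [abs_of_pos (by positivity), sign_pos h0]
      simp only [Complex.ofReal_one, SignType.coe_one, mul_one]
      ring
    · intro t ht
      have ht' : 0 < t := ht
      have h1 := ((Phi_summable (-1) k (Set.mem_Ioi.mp ht)).hasSum.mul_right (t ^ (-((1 : ℝ) / 2)))).mapL Complex.ofRealCLM
      refine h1.congr_fun fun n => ?_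
      simp only [Complex.ofRealCLM_apply]
      have e1 : psi (-1) ((n + 1 : ℝ) ^ 2 * t) = t ^ (1 / 2 : ℝ) * ((n + 1 : ℝ) * Real.exp (-Real.pi * (n + 1 : ℝ) ^ 2 * t)) := by
        rw [psi, if_neg (by norm_num), Real.sqrt_mul (by positivity), Real.sqrt_sq (by positivity), Real.sqrt_eq_rpow]
        ring_nf
      have e2 : t ^ (-(1 / 2) : ℝ) * t ^ (1 / 2 : ℝ) = 1 := by
        rw [← Real.rpow_add ht']; simp
      rw [e1]
      have e3 : ∀ A B : ℝ, A * (t ^ (1 / 2 : ℝ) * B) * t ^ (-(1 / 2) : ℝ) = A * B := by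
        intro A B
        calc _ = (t ^ (-(1 / 2) : ℝ) * t ^ (1 / 2 : ℝ)) * (A * B) := by ring
          _ = _ := by rw [e2, one_mul]
      rw [e3]
      push_cast
      ring_nf

theorem L_eq {s : ℤ} (hs1 : s = 1 ∨ s = -1) {k q : ℕ} [NeZero q] (hq : q = (s * k).natAbs)
    (hf : IsFundamentalDiscriminant (s * k))
    (χ : DirichletCharacter ℂ q) (h1 : χ ≠ 1) (h2 : χ ^ 2 = 1) (hp : χ.IsPrimitive)
    (hs : χ (-1) = if 0 < s * (k : ℤ) then 1 else -1) :
    DirichletCharacter.LFunction χ 1 = (Lr s k : ℂ) := by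
  have hk : 0 < k := by
    have := fund_one_lt hf
    rw [Int.natAbs_mul] at this
    rcases Nat.eq_zero_or_pos k with h | h
    · simp [h] at this
    · exact h
  have hFE := FEP_of hs1 hq hf χ h2 hp hs
  obtain ⟨δ, hδ⟩ : ∃ δ : ℝ, δ = if s = 1 then 0 else 1 := ⟨_, rfl⟩
  have hδ0 : 0 ≤ δ := by rw [hδ]; split_ifs <;> norm_num
  have key : ∀ σ : ℝ, 1 < σ → DirichletCharacter.LFunction χ σ = (Complex.Gammaℝ (σ + δ))⁻¹ *
      mellin (fun t => ((Phi s k t * t ^ (-(δ / 2)) : ℝ) : ℂ)) (((σ + δ) / 2 : ℝ) : ℂ) := by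
    intro σ hσ
    rw [← L_mellin hs1 hq hf χ h2 hp hs hσ hδ, inv_mul_cancel_left₀]
    apply Complex.Gammaℝ_ne_zero_of_re_pos
    simp; linarith
  have c0 : Tendsto (fun σ : ℝ => (σ : ℂ)) (𝓝[>] 1) (𝓝 1) := by
    have : Tendsto (fun σ : ℝ => (σ : ℂ)) (𝓝 1) (𝓝 ((1 : ℝ) : ℂ)) := Complex.continuous_ofReal.tendsto 1
    simpa using this.mono_left nhdsWithin_le_nhds
  have c1 : Tendsto (fun σ : ℝ => DirichletCharacter.LFunction χ σ) (𝓝[>] 1) (𝓝 (DirichletCharacter.LFunction χ 1)) :=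
    ((DirichletCharacter.differentiable_LFunction h1).continuous.tendsto 1).comp c0
  have c2 : Tendsto (fun σ : ℝ => (Complex.Gammaℝ (σ + δ))⁻¹) (𝓝[>] 1) (𝓝 (Complex.Gammaℝ (1 + δ))⁻¹) :=
    (Complex.differentiable_Gammaℝ_inv.continuous.tendsto _).comp (c0.add_const _)
  have c3 : Tendsto (fun σ : ℝ => (((σ + δ) / 2 : ℝ) : ℂ)) (𝓝[>] 1) (𝓝 (((1 + δ) / 2 : ℝ) : ℂ)) := by
    have : Continuous fun σ : ℝ => (((σ + δ) / 2 : ℝ) : ℂ) := by fun_prop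
    exact (this.tendsto 1).mono_left nhdsWithin_le_nhds
  have c4 := c2.mul ((mellin_diff s k hk hFE δ).continuousAt.tendsto.comp c3)
  have c5 := tendsto_nhds_unique (c1.congr' (by
    filter_upwards [self_mem_nhdsWithin] with σ hσ
    exact key σ hσ)) c4
  rw [c5, Lr, Complex.ofReal_mul, ← integral_complex_ofReal]
  congr 1
  · rcases hs1 with rfl | rfl
    · simp [hδ, cs, Complex.Gammaℝ_one]
    · simp only [hδ, cs]
      rw [if_neg (by norm_num), if_neg (by norm_num)]
      rw [Complex.Gammaℝ_def]
      norm_num [Complex.Gamma_one]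
      rw [Complex.cpow_neg_one, inv_inv]
  · rw [mellin]
    refine setIntegral_congr_fun measurableSet_Ioi fun t ht => ?_
    have ht' : 0 < t := ht
    simp only [smul_eq_mul]
    rw [show ((((1 + δ) / 2 : ℝ) : ℂ) - 1) = (((1 + δ) / 2 - 1 : ℝ) : ℂ) by push_cast; ring, ← Complex.ofReal_cpow ht'.le,
      ← Complex.ofReal_mul]
    congr 1
    rw [mul_left_comm, ← Real.rpow_add ht']
    ring_nf

end

section

open MeasureTheory Filter Topology Set

noncomputable def W (s : ℤ) (z : ℝ) : ℝ := cs s * ∫ v in Ioi z, psi s v * v ^ (-(1 / 2) : ℝ)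

theorem cs_pos (s : ℤ) : 0 < cs s := by
  unfold cs; split_ifs
  · norm_num
  · exact Real.pi_pos

theorem cs_le (s : ℤ) : cs s ≤ 4 := by
  unfold cs; split_ifs
  · norm_num
  · exact Real.pi_le_four

theorem exp_int (j : ℝ) (hj : 0 ≤ j) : IntegrableOn (fun v : ℝ => Real.exp (-v) * v ^ (j - 1 / 2)) (Ioi 0) := by
  have := Real.GammaIntegral_convergent (s := j + 1 / 2) (by linarith)
  refine this.congr_fun (fun v _ => ?_) measurableSet_Ioi
  simp only
  rw [show j + 1 / 2 - 1 = j - 1 / 2 by ring]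

theorem rpow_contOn (a : ℝ) : ContinuousOn (fun v : ℝ => v ^ a) (Ioi 0) :=
  fun t ht => (Real.continuousAt_rpow_const t _ (Or.inl (ne_of_gt ht))).continuousWithinAt

theorem psi_int (s : ℤ) : IntegrableOn (fun v : ℝ => psi s v * v ^ (-(1 / 2) : ℝ)) (Ioi 0) := by
  refine Integrable.mono' (exp_int 0 le_rfl) ?_ ?_
  · exact ((psi_cont s).continuousOn.mul (rpow_contOn _)).aestronglyMeasurable measurableSet_Ioi
  · filter_upwards [ae_restrict_mem measurableSet_Ioi] with v hv
    have hv' : (0 : ℝ) < v := hv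
    rw [norm_mul, Real.norm_of_nonneg (psi_nonneg _ _), Real.norm_of_nonneg (by positivity)]
    rw [show (0 - 1 / 2 : ℝ) = -(1 / 2) by norm_num]
    gcongr
    exact psi_le_exp s hv'.le

theorem W_zero {s : ℤ} : W s 0 = 1 := by
  unfold W cs psi
  split_ifs
  · have := Real.integral_rpow_mul_exp_neg_mul_Ioi (a := 1 / 2) (r := Real.pi) (by norm_num) Real.pi_pos
    rw [Real.Gamma_one_half_eq, Real.sqrt_eq_rpow, ← Real.mul_rpow (by positivity) (by positivity)] at this
    rw [one_div_mul_cancel Real.pi_ne_zero, Real.one_rpow] at this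
    rw [one_mul]
    refine Eq.trans ?_ this
    refine setIntegral_congr_fun measurableSet_Ioi fun v hv => ?_
    rw [mul_comm]; norm_num
  · have := Real.integral_rpow_mul_exp_neg_mul_Ioi (a := 1) (r := Real.pi) (by norm_num) Real.pi_pos
    rw [Real.Gamma_one, Real.rpow_one, mul_one] at this
    have h2 : ∫ v in Ioi (0 : ℝ), √v * Real.exp (-Real.pi * v) * v ^ (-(1 / 2) : ℝ) = 1 / Real.pi := by
      rw [← this]
      refine setIntegral_congr_fun measurableSet_Ioi fun v hv => ?_
      have hv' : (0 : ℝ) < v := hv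
      have e2 : v ^ (1 / 2 : ℝ) * v ^ (-(1 / 2) : ℝ) = 1 := by
        rw [← Real.rpow_add hv']; simp
      rw [Real.sqrt_eq_rpow, mul_right_comm, e2]; norm_num
    rw [h2, mul_one_div_cancel Real.pi_ne_zero]

theorem psi_int_nonneg (s : ℤ) {S : Set ℝ} (hS : S ⊆ Ioi 0) (hm : MeasurableSet S) :
    0 ≤ ∫ v in S, psi s v * v ^ (-(1 / 2) : ℝ) :=
  setIntegral_nonneg hm fun v hv => mul_nonneg (psi_nonneg _ _) (Real.rpow_nonneg (le_of_lt (hS hv)) _)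

theorem W_nonneg (s : ℤ) {z : ℝ} (hz : 0 ≤ z) : 0 ≤ W s z :=
  mul_nonneg (cs_pos s).le (psi_int_nonneg s (Ioi_subset_Ioi hz) measurableSet_Ioi)

theorem W_split (s : ℤ) {z : ℝ} (hz : 0 ≤ z) :
    1 - W s z = cs s * ∫ v in Ioc 0 z, psi s v * v ^ (-(1 / 2) : ℝ) := by
  have h0 := W_zero (s := s)
  rw [W] at h0
  rw [W]
  nth_rewrite 1 [← h0]
  rw [← mul_sub]
  congr 1
  rw [← Ioc_union_Ioi_eq_Ioi hz, setIntegral_union (Ioc_disjoint_Ioi le_rfl) measurableSet_Ioi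
    ((psi_int s).mono_set Ioc_subset_Ioi_self) ((psi_int s).mono_set (Ioi_subset_Ioi hz))]
  ring

theorem W_le_one (s : ℤ) {z : ℝ} (hz : 0 ≤ z) : W s z ≤ 1 := by
  have h := W_split s hz
  have := mul_nonneg (cs_pos s).le (psi_int_nonneg s (S := Ioc 0 z) Ioc_subset_Ioi_self measurableSet_Ioc)
  linarith

theorem W_near (s : ℤ) {z : ℝ} (hz : 0 ≤ z) : 1 - W s z ≤ 8 * z ^ (1 / 2 : ℝ) := by
  rw [W_split s hz]
  have h1 : IntegrableOn (fun v : ℝ => v ^ (-(1 / 2) : ℝ)) (Ioc 0 z) := by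
    rw [← intervalIntegrable_iff_integrableOn_Ioc_of_le hz]
    exact intervalIntegral.intervalIntegrable_rpow' (by norm_num)
  have h2 : ∫ v in Ioc 0 z, psi s v * v ^ (-(1 / 2) : ℝ) ≤ ∫ v in Ioc 0 z, v ^ (-(1 / 2) : ℝ) := by
    refine setIntegral_mono_on ((psi_int s).mono_set Ioc_subset_Ioi_self) h1 measurableSet_Ioc fun v hv => ?_
    have := psi_le_exp s hv.1.le
    have h3 := Real.exp_le_one_iff.mpr (by linarith [hv.1] : -v ≤ 0)
    exact mul_le_of_le_one_left (Real.rpow_nonneg hv.1.le _) (this.trans h3)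
  rw [← intervalIntegral.integral_of_le hz (f := fun v : ℝ => v ^ (-(1 / 2) : ℝ)), integral_rpow (Or.inl (by norm_num)),
    show (-(1 / 2) + 1 : ℝ) = 1 / 2 by norm_num, Real.zero_rpow (by norm_num), sub_zero] at h2
  have h3 : (0 : ℝ) ≤ z ^ (1 / 2 : ℝ) := by positivity
  have h4 := mul_le_mul (cs_le s) (h2) (psi_int_nonneg s (S := Ioc 0 z) Ioc_subset_Ioi_self measurableSet_Ioc) (by norm_num)
  linarith

theorem W_decay (j : ℕ) : ∃ C : ℝ, 1 ≤ C ∧ ∀ (s : ℤ) (z : ℝ), 0 < z → W s z ≤ C / z ^ j := by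
  refine ⟨max 1 (4 * ∫ v in Ioi (0 : ℝ), Real.exp (-v) * v ^ ((j : ℝ) - 1 / 2)), le_max_left _ _, fun s z hz => ?_⟩
  rw [le_div_iff₀ (by positivity), W]
  refine le_trans ?_ (le_max_right _ _)
  have h1 := exp_int j (by positivity)
  have h2 : (∫ v in Ioi z, psi s v * v ^ (-(1 / 2) : ℝ)) * z ^ j ≤ ∫ v in Ioi z, Real.exp (-v) * v ^ ((j : ℝ) - 1 / 2) := by
    rw [← integral_mul_const]
    refine setIntegral_mono_on (((psi_int s).mono_set (Ioi_subset_Ioi hz.le)).mul_const _)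
      (h1.mono_set (Ioi_subset_Ioi hz.le)) measurableSet_Ioi fun v hv => ?_
    have hv' : z < v := hv
    have hv0 : 0 < v := hz.trans hv'
    rw [sub_eq_add_neg, Real.rpow_add hv0, Real.rpow_natCast, mul_assoc, mul_comm (v ^ j)]
    exact mul_le_mul (psi_le_exp s hv0.le) (by gcongr) (by positivity) (by positivity)
  have h3 : ∫ v in Ioi z, Real.exp (-v) * v ^ ((j : ℝ) - 1 / 2) ≤ ∫ v in Ioi (0 : ℝ), Real.exp (-v) * v ^ ((j : ℝ) - 1 / 2) := by
    refine setIntegral_mono_set h1 ?_ (Ioi_subset_Ioi hz.le).eventuallyLE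
    filter_upwards [ae_restrict_mem measurableSet_Ioi] with v hv
    have hv' : (0 : ℝ) < v := hv
    positivity
  have h0 : 0 ≤ (∫ v in Ioi z, psi s v * v ^ (-(1 / 2) : ℝ)) * z ^ j :=
    mul_nonneg (psi_int_nonneg s (Ioi_subset_Ioi hz.le) measurableSet_Ioi) (by positivity)
  rw [mul_assoc]
  exact mul_le_mul (cs_le s) (h2.trans h3) h0 (by norm_num)

/-- smoothed sum -/
noncomputable def Ax (s : ℤ) (k : ℕ) (x : ℝ) : ℝ :=
  ∑' n : ℕ, (kro (s * k) (n + 1) : ℝ) * ((1 / (n + 1 : ℝ)) * W s ((n + 1 : ℝ) ^ 2 / x ^ 2))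

theorem W_scale (s : ℤ) (n : ℕ) {x : ℝ} (hx : 0 < x) :
    (1 / (n + 1 : ℝ)) * W s ((n + 1 : ℝ) ^ 2 / x ^ 2) =
      cs s * ∫ t in Ioi (1 / x ^ 2), psi s ((n + 1 : ℝ) ^ 2 * t) * t ^ (-(1 / 2) : ℝ) := by
  have hn : (0 : ℝ) < n + 1 := by positivity
  have h := integral_comp_mul_left_Ioi (fun v => psi s v * v ^ (-(1 / 2) : ℝ)) (1 / x ^ 2) (b := (n + 1 : ℝ) ^ 2) (by positivity)
  have h2 : ∫ t in Ioi (1 / x ^ 2), psi s ((n + 1 : ℝ) ^ 2 * t) * ((n + 1 : ℝ) ^ 2 * t) ^ (-(1 / 2) : ℝ) =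
      ∫ t in Ioi (1 / x ^ 2), (1 / (n + 1 : ℝ)) * (psi s ((n + 1 : ℝ) ^ 2 * t) * t ^ (-(1 / 2) : ℝ)) := by
    refine setIntegral_congr_fun measurableSet_Ioi fun t ht => ?_
    have ht' : 0 < t := lt_trans (by positivity) (Set.mem_Ioi.mp ht)
    rw [Real.mul_rpow (by positivity) ht'.le, ← Real.rpow_natCast, ← Real.rpow_mul hn.le]
    norm_num
    rw [Real.rpow_neg_one]
    ring
  rw [h2, integral_const_mul, smul_eq_mul] at h
  rw [W, mul_left_comm, mul_one_div] at *
  congr 1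
  have : ∫ t in Ioi (1 / x ^ 2), psi s ((n + 1 : ℝ) ^ 2 * t) * t ^ (-(1 / 2) : ℝ) =
    (n + 1 : ℝ) * ((1 / (n + 1 : ℝ)) * ∫ t in Ioi (1 / x ^ 2), psi s ((n + 1 : ℝ) ^ 2 * t) * t ^ (-(1 / 2) : ℝ)) := by
      field_simp
  rw [this, h]
  field_simp

end

section

open MeasureTheory Filter Topology Set

theorem W_term_le : ∃ C : ℝ, 1 ≤ C ∧ ∀ (s : ℤ) (n : ℕ) (x : ℝ), 0 < x →
    (1 / (n + 1 : ℝ)) * W s ((n + 1 : ℝ) ^ 2 / x ^ 2) ≤ C * x ^ 2 * ((n + 1 : ℕ) : ℝ) ^ (-(2 * 1) : ℝ) := by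
  obtain ⟨C, hC, h⟩ := W_decay 1
  refine ⟨C, hC, fun s n x hx => ?_⟩
  have h1 := h s ((n + 1 : ℝ) ^ 2 / x ^ 2) (by positivity)
  have h2 : (1 / (n + 1 : ℝ)) ≤ 1 := by
    rw [div_le_one (by positivity)]; linarith [(Nat.cast_nonneg n : (0:ℝ) ≤ n)]
  have h3 := W_nonneg s (z := (n + 1 : ℝ) ^ 2 / x ^ 2) (by positivity)
  calc (1 / (n + 1 : ℝ)) * W s ((n + 1 : ℝ) ^ 2 / x ^ 2) ≤ 1 * (C / ((n + 1 : ℝ) ^ 2 / x ^ 2) ^ 1) :=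
        mul_le_mul h2 h1 h3 (by norm_num)
    _ = _ := by
        rw [Real.rpow_neg (by positivity), show (2 * 1 : ℝ) = (2 : ℕ) by norm_num, Real.rpow_natCast]
        push_cast
        field_simp

theorem Phi_intOn (s : ℤ) (k : ℕ) (hk : 0 < k) (h : FEP s k) :
    IntegrableOn (fun t => Phi s k t * t ^ (-(1 / 2) : ℝ)) (Ioi 0) := by
  obtain ⟨C, hC, hb⟩ := Phi_bound (a := 1) (by norm_num) le_rfl
  obtain ⟨C0, hC0, hb0⟩ := Phi_bound_zero s k hk h
  have hm : ContinuousOn (fun t => Phi s k t * t ^ (-(1 / 2) : ℝ)) (Ioi 0) := (Phi_cont s k).mul (rpow_contOn _)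
  rw [← Ioc_union_Ioi_eq_Ioi (zero_le_one' ℝ)]
  refine IntegrableOn.union ?_ ?_
  · refine Integrable.mono' (integrableOn_const (C := C0) (by simp)) ((hm.mono Ioc_subset_Ioi_self).aestronglyMeasurable measurableSet_Ioc) ?_
    filter_upwards [ae_restrict_mem measurableSet_Ioc] with t ht
    have ht' : 0 < t := ht.1
    rw [norm_mul, Real.norm_eq_abs, Real.norm_of_nonneg (by positivity)]
    calc _ ≤ C0 * t ^ (1 / 2 : ℝ) * t ^ (-(1 / 2) : ℝ) := by gcongr; exact hb0 t ht'
      _ = C0 := by rw [mul_assoc, ← Real.rpow_add ht']; simp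
  · have := integrableOn_Ioi_rpow_of_lt (a := -(3 / 2)) (by norm_num) (zero_lt_one' ℝ)
    refine Integrable.mono' (this.const_mul C) ((hm.mono (Ioi_subset_Ioi zero_le_one)).aestronglyMeasurable measurableSet_Ioi) ?_
    filter_upwards [ae_restrict_mem measurableSet_Ioi] with t ht
    have ht' : 0 < t := lt_trans zero_lt_one ht
    rw [norm_mul, Real.norm_eq_abs, Real.norm_of_nonneg (by positivity)]
    calc _ ≤ C * t ^ (-1 : ℝ) * t ^ (-(1 / 2) : ℝ) := by gcongr; exact hb s k t ht'
      _ = _ := by rw [mul_assoc, ← Real.rpow_add ht']; norm_num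

theorem Ax_eq (s : ℤ) (k : ℕ) {x : ℝ} (hx : 0 < x) :
    Ax s k x = cs s * ∫ t in Ioi (1 / x ^ 2), Phi s k t * t ^ (-(1 / 2) : ℝ) := by
  obtain ⟨C, hC, hW⟩ := W_term_le
  have hx2 : 0 < 1 / x ^ 2 := by positivity
  have hI : ∀ n : ℕ, IntegrableOn (fun t => psi s ((n + 1 : ℝ) ^ 2 * t) * t ^ (-(1 / 2) : ℝ)) (Ioi (1 / x ^ 2)) := by
    intro n
    have h1 := psi_int s
    have h2 := integrableOn_Ioi_comp_mul_left_iff (fun v : ℝ => psi s v * v ^ (-(1 / 2) : ℝ)) 0 (a := (n + 1 : ℝ) ^ 2) (by positivity)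
    rw [mul_zero] at h2
    have h3 := (h2.mpr h1).mono_set (Ioi_subset_Ioi hx2.le)
    refine (h3.const_mul (n + 1 : ℝ)).congr ?_
    filter_upwards [ae_restrict_mem measurableSet_Ioi] with t ht
    have ht' : 0 < t := hx2.trans ht
    rw [Real.mul_rpow (by positivity) ht'.le, ← Real.rpow_natCast, ← Real.rpow_mul (by positivity)]
    norm_num
    rw [Real.rpow_neg_one]
    field_simp
  have hN : ∀ n : ℕ, ∫ t in Ioi (1 / x ^ 2), ‖(kro (s * k) (n + 1) : ℝ) * psi s ((n + 1 : ℝ) ^ 2 * t) * t ^ (-(1 / 2) : ℝ)‖ ≤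
      (cs s)⁻¹ * (C * x ^ 2 * ((n + 1 : ℕ) : ℝ) ^ (-(2 * 1) : ℝ)) := by
    intro n
    have h1 := hW s n x hx
    rw [W_scale s n hx] at h1
    rw [le_inv_mul_iff₀ (cs_pos s)]
    refine le_trans ?_ h1
    refine mul_le_mul_of_nonneg_left ?_ (cs_pos s).le
    refine integral_mono_of_nonneg (Eventually.of_forall fun t => norm_nonneg _) (hI n) ?_
    filter_upwards [ae_restrict_mem measurableSet_Ioi] with t ht
    have ht' : 0 < t := hx2.trans ht
    rw [norm_mul, Real.norm_of_nonneg (by positivity : (0 : ℝ) ≤ t ^ (-(1 / 2) : ℝ))]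
    exact mul_le_mul_of_nonneg_right (Phi_term_le s k n t) (by positivity)
  have key := hasSum_integral_of_summable_integral_norm (μ := volume.restrict (Ioi (1 / x ^ 2)))
    (F := fun (n : ℕ) t => (kro (s * k) (n + 1) : ℝ) * psi s ((n + 1 : ℝ) ^ 2 * t) * t ^ (-(1 / 2) : ℝ))
    (fun n => by simpa only [mul_assoc] using (hI n).const_mul (kro (s * k) (n + 1) : ℝ))
    (Summable.of_nonneg_of_le (fun n => by positivity) hN (((summable_shift (a := 1) (by norm_num)).mul_left _).mul_left _))
  have h4 : ∫ t in Ioi (1 / x ^ 2), Phi s k t * t ^ (-(1 / 2) : ℝ) =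
      ∫ t in Ioi (1 / x ^ 2), ∑' n : ℕ, (kro (s * k) (n + 1) : ℝ) * psi s ((n + 1 : ℝ) ^ 2 * t) * t ^ (-(1 / 2) : ℝ) := by
    refine integral_congr_ae ?_
    filter_upwards with t
    rw [Phi, tsum_mul_right]
  rw [h4, ← key.tsum_eq, ← tsum_mul_left, Ax]
  refine tsum_congr fun n => ?_
  rw [W_scale s n hx]
  simp_rw [mul_assoc]
  rw [integral_const_mul]
  ring

noncomputable def Bx (s : ℤ) (k : ℕ) (x : ℝ) : ℝ := Lr s k - Ax s k x

theorem Bx_bound (s : ℤ) (k : ℕ) (hk : 0 < k) (h : FEP s k) {x : ℝ} (hx : 0 < x) :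
    |Bx s k x| ≤ 4 * (k : ℝ) ^ (-(1 / 2) : ℝ) * ∫ w in (0 : ℝ)..(k ^ 2 / x ^ 2), |Phi s k (1 / w)| / w := by
  have hk' : (0 : ℝ) < k := by exact_mod_cast hk
  have hx2 : 0 < 1 / x ^ 2 := by positivity
  have hI := Phi_intOn s k hk h
  have e1 : Bx s k x = cs s * ∫ t in (0 : ℝ)..(1 / x ^ 2), Phi s k t * t ^ (-(1 / 2) : ℝ) := by
    rw [Bx, Ax_eq s k hx, Lr, ← mul_sub, intervalIntegral.integral_of_le hx2.le]
    congr 1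
    rw [← Ioc_union_Ioi_eq_Ioi hx2.le, setIntegral_union (Ioc_disjoint_Ioi le_rfl) measurableSet_Ioi
      (hI.mono_set Ioc_subset_Ioi_self) (hI.mono_set (Ioi_subset_Ioi hx2.le))]
    ring_nf
  have e2 : |∫ t in (0 : ℝ)..(1 / x ^ 2), Phi s k t * t ^ (-(1 / 2) : ℝ)| ≤
      ∫ t in (0 : ℝ)..(1 / x ^ 2), (k : ℝ) ^ (-(1 / 2) : ℝ) * k ^ 2 * (|Phi s k (1 / ((k : ℝ) ^ 2 * t))| / ((k : ℝ) ^ 2 * t)) := by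
    refine (intervalIntegral.abs_integral_le_integral_abs hx2.le).trans (le_of_eq ?_)
    rw [intervalIntegral.integral_of_le hx2.le, intervalIntegral.integral_of_le hx2.le]
    refine setIntegral_congr_fun measurableSet_Ioc fun t ht => ?_
    have ht' : 0 < t := ht.1
    have e3 : t ^ (-(1 / 2) : ℝ) * t ^ (-(1 / 2) : ℝ) = t⁻¹ := by
      rw [← Real.rpow_add ht', ← Real.rpow_neg_one]; norm_num
    rw [abs_mul, h t ht', abs_of_pos (by positivity : (0 : ℝ) < t ^ (-(1 / 2) : ℝ))]
    calc _ = (k : ℝ) ^ (-(1 / 2) : ℝ) * (t ^ (-(1 / 2) : ℝ) * t ^ (-(1 / 2) : ℝ)) * |Phi s k (1 / ((k : ℝ) ^ 2 * t))| := by ring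
      _ = _ := by rw [e3]; field_simp
  rw [intervalIntegral.integral_const_mul,
    intervalIntegral.integral_comp_mul_left (fun w => |Phi s k (1 / w)| / w) (by positivity : (k : ℝ) ^ 2 ≠ 0)] at e2
  rw [e1, abs_mul, abs_of_pos (cs_pos s)]
  rw [mul_zero, mul_one_div, smul_eq_mul, ← mul_assoc, mul_assoc _ ((k : ℝ) ^ 2), mul_inv_cancel₀ (by positivity), mul_one] at e2
  rw [mul_assoc]
  exact mul_le_mul (cs_le s) e2 (abs_nonneg _) (by norm_num)

end

section

open MeasureTheory Filter Topology Set

theorem sum_Icc_range (f : ℕ → ℝ) (M : ℕ) : ∑ n ∈ Finset.Icc 1 M, f n = ∑ i ∈ Finset.range M, f (i + 1) := by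
  induction M with
  | zero => simp
  | succ M ih => rw [Finset.sum_Icc_succ_top (by omega), Finset.sum_range_succ, ih]

theorem Phi_tendsto (s : ℤ) (k : ℕ) {t : ℝ} (ht : 0 < t) :
    Tendsto (fun M : ℕ => DP (Finset.Icc 1 M) (fun n => psi s ((n : ℝ) ^ 2 * t)) (s * k)) atTop (𝓝 (Phi s k t)) := by
  have h := (Phi_summable s k ht).hasSum.tendsto_sum_nat
  refine h.congr fun M => ?_
  rw [DP, sum_Icc_range]
  refine Finset.sum_congr rfl fun i _ => ?_
  push_cast
  ring

theorem Phi_ms (η : ℝ) (hη : 0 < η) (hη4 : η < 1 / 4) : ∃ C : ℝ, 1 ≤ C ∧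
    ∀ (s : ℤ) (N : ℕ) (w : ℝ), (s = 1 ∨ s = -1) → 1 ≤ N → 1 ≤ w → w ≤ N →
      ∑ k ∈ FD s N, (Phi s k (1 / w)) ^ 2 ≤ C * (N * w ^ (1 / 2 + 2 * η)) := by
  obtain ⟨C, hC, h⟩ := ms_item η hη hη4
  obtain ⟨K, hK⟩ : ∃ K : ℝ, K = ∑' n : ℕ, (n : ℝ) ^ (-1 - η) := ⟨_, rfl⟩
  refine ⟨C * (1 + K ^ 2), by nlinarith [sq_nonneg K], fun s N w hs hN hw hwN => ?_⟩
  have hw0 : 0 < w := by linarith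
  have lim := tendsto_finsetSum (FD s N) fun k _ => (Phi_tendsto s k (t := 1 / w) (by positivity)).pow 2
  refine le_of_tendsto' lim fun M => ?_
  set c : ℕ → ℝ := fun n => psi s ((n : ℝ) ^ 2 * (1 / w)) with hc
  set u := w ^ (1 / 2 : ℝ) with hu
  have hu0 : 0 < u := by positivity
  have hu2 : u ^ 2 = w := by rw [hu, ← Real.rpow_natCast, ← Real.rpow_mul hw0.le]; norm_num
  have hcn : ∀ n ∈ Finset.Icc 1 M, |c n| ≤ u / max (n : ℝ) u := by
    intro n hn
    have hn0 : (0 : ℝ) < n := by exact_mod_cast (Finset.mem_Icc.mp hn).1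
    rw [abs_of_nonneg (psi_nonneg _ _)]
    have hv : 0 < (n : ℝ) ^ 2 * (1 / w) := by positivity
    rcases le_total (n : ℝ) u with h1 | h1
    · rw [max_eq_right h1, div_self hu0.ne']
      exact (psi_le_exp s hv.le).trans (Real.exp_le_one_iff.mpr (by linarith))
    · rw [max_eq_left h1]
      refine (psi_le_rpow s (a := 1 / 2) (by norm_num) (by norm_num) hv).trans (le_of_eq ?_)
      rw [← hu2, show (n : ℝ) ^ 2 * (1 / u ^ 2) = (n / u) ^ 2 by field_simp, ← Real.rpow_natCast, ← Real.rpow_mul (by positivity)]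
      norm_num
      rw [Real.rpow_neg_one, inv_div]
  have h1 := h s N (Finset.Icc 1 M) c u u hs hN (fun n hn => by have := (Finset.mem_Icc.mp hn).1; omega) hu0 hu0.le hcn
  refine h1.trans ?_
  have h2 : ∑ n ∈ Finset.Icc 1 M, |c n| * (n : ℝ) ^ (1 / 2 + η) ≤ w ^ (3 / 4 + η) * K := by
    have h3 : ∀ n ∈ Finset.Icc 1 M, |c n| * (n : ℝ) ^ (1 / 2 + η) ≤ w ^ (3 / 4 + η) * (n : ℝ) ^ (-1 - η) := by
      intro n hn
      have hn0 : (0 : ℝ) < n := by exact_mod_cast (Finset.mem_Icc.mp hn).1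
      rw [abs_of_nonneg (psi_nonneg _ _)]
      have hv : 0 < (n : ℝ) ^ 2 * (1 / w) := by positivity
      have h4 := psi_le_rpow s (a := 3 / 4 + η) (by linarith) (by linarith) hv
      calc c n * (n : ℝ) ^ (1 / 2 + η) ≤ ((n : ℝ) ^ 2 * (1 / w)) ^ (-(3 / 4 + η)) * (n : ℝ) ^ (1 / 2 + η) := by gcongr
        _ = _ := by
          rw [Real.mul_rpow (by positivity) (by positivity), one_div, Real.inv_rpow hw0.le, Real.rpow_neg hw0.le, inv_inv,
            ← Real.rpow_natCast, ← Real.rpow_mul hn0.le, mul_right_comm, ← Real.rpow_add hn0, mul_comm]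
          congr 2
          push_cast; ring
    refine (Finset.sum_le_sum h3).trans ?_
    rw [← Finset.mul_sum, hK]
    exact mul_le_mul_of_nonneg_left ((summable_eta η hη).sum_le_tsum _ (fun n _ => by positivity)) (by positivity)
  have h5 : 0 ≤ ∑ n ∈ Finset.Icc 1 M, |c n| * (n : ℝ) ^ (1 / 2 + η) := Finset.sum_nonneg fun n _ => by positivity
  have h6 : (∑ n ∈ Finset.Icc 1 M, |c n| * (n : ℝ) ^ (1 / 2 + η)) ^ 2 ≤ (w ^ (3 / 4 + η) * K) ^ 2 := by gcongr
  have h7 : (w ^ (3 / 4 + η)) ^ 2 ≤ N * w ^ (1 / 2 + 2 * η) := by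
    rw [← Real.rpow_natCast, ← Real.rpow_mul hw0.le]
    calc w ^ ((3 / 4 + η) * (2 : ℕ)) = w * w ^ (1 / 2 + 2 * η) := by
          rw [← Real.rpow_one_add' hw0.le (by linarith)]; congr 1; push_cast; ring
      _ ≤ _ := by gcongr
  have h8 : (N : ℝ) * u ^ 2 * u ^ (4 * η - 1) = N * w ^ (1 / 2 + 2 * η) := by
    rw [hu2, hu, ← Real.rpow_mul hw0.le, mul_assoc, ← Real.rpow_one_add' hw0.le (by linarith)]
    congr 2; ring
  rw [h8, mul_assoc]
  refine mul_le_mul_of_nonneg_left ?_ (by linarith)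
  rw [mul_pow] at h6
  nlinarith [mul_le_mul_of_nonneg_right h7 (sq_nonneg K)]

end

section

open MeasureTheory Filter Topology Set

theorem Phi_inv_cont (s : ℤ) (k : ℕ) : ContinuousOn (fun w => Phi s k (1 / w)) (Ioi 0) := by
  refine (Phi_cont s k).comp (continuousOn_const.div continuousOn_id fun w hw => ne_of_gt hw) fun w hw => ?_
  have : (0 : ℝ) < w := hw
  simpa using this

theorem G_int (s : ℤ) (k : ℕ) (a b : ℝ) (ha : 0 ≤ a) (hb : a ≤ b) :
    IntervalIntegrable (fun w => |Phi s k (1 / w)| / w) volume a b := by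
  obtain ⟨C, hC, h⟩ := Phi_bound (a := 1) (by norm_num) le_rfl
  rw [intervalIntegrable_iff_integrableOn_Ioc_of_le hb]
  have hs : Ioc a b ⊆ Ioi 0 := fun w hw => lt_of_le_of_lt ha hw.1
  refine Integrable.mono' (integrableOn_const (C := C) (by simp)) ?_ ?_
  · refine ContinuousOn.aestronglyMeasurable ?_ measurableSet_Ioc
    exact ((Phi_inv_cont s k).abs.div continuousOn_id fun w hw => ne_of_gt hw).mono hs
  · filter_upwards [ae_restrict_mem measurableSet_Ioc] with w hw
    have hw0 : 0 < w := hs hw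
    rw [norm_div, Real.norm_eq_abs, abs_abs, Real.norm_of_nonneg hw0.le, div_le_iff₀ hw0]
    have := h s k (1 / w) (by positivity)
    rwa [Real.rpow_neg_one, one_div, inv_inv, ← one_div] at this

theorem Bx_point (η : ℝ) (hη : 0 < η) (hη2 : η < 1 / 2) : ∃ C : ℝ, 1 ≤ C ∧
    ∀ (s : ℤ) (k N : ℕ) (x : ℝ), 0 < k → k ≤ N → (N : ℝ) ≤ x ^ 2 → 1 ≤ x → FEP s k → |Bx s k x| ≤ C * N ^ (2 * η) := by
  obtain ⟨C, hC, h⟩ := Phi_bound (a := 1 / 2 + η) (by linarith) (by linarith)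
  refine ⟨8 * C, by linarith, fun s k N x hk hkN hNx hx1 hFE => ?_⟩
  have hx : 0 < x := by linarith
  have hk' : (0 : ℝ) < k := by exact_mod_cast hk
  have hkN' : (k : ℝ) ≤ N := by exact_mod_cast hkN
  have hz : (0 : ℝ) ≤ k ^ 2 / x ^ 2 := by positivity
  refine (Bx_bound s k hk hFE hx).trans ?_
  have h1 : ∫ w in (0 : ℝ)..(k ^ 2 / x ^ 2), |Phi s k (1 / w)| / w ≤ ∫ w in (0 : ℝ)..(k ^ 2 / x ^ 2), C * w ^ (-1 / 2 + η) := by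
    refine intervalIntegral.integral_mono_on_of_le_Ioo hz (G_int s k _ _ le_rfl hz)
      ((intervalIntegral.intervalIntegrable_rpow' (by linarith)).const_mul C) fun w hw => ?_
    have hw0 : 0 < w := hw.1
    have h2 := h s k (1 / w) (by positivity)
    rw [one_div, Real.inv_rpow hw0.le, Real.rpow_neg hw0.le, inv_inv, ← one_div] at h2
    rw [div_le_iff₀ hw0, mul_assoc, ← Real.rpow_add_one' hw0.le (by linarith)]
    rwa [show -1 / 2 + η + 1 = 1 / 2 + η by ring]
  rw [intervalIntegral.integral_const_mul, integral_rpow (Or.inl (by linarith)),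
    Real.zero_rpow (by linarith), sub_zero, show -1 / 2 + η + 1 = 1 / 2 + η by ring] at h1
  have h3 : ((k : ℝ) ^ 2 / x ^ 2) ^ (1 / 2 + η) = k / x * (k / x) ^ (2 * η) := by
    rw [← div_pow, ← Real.rpow_natCast, ← Real.rpow_mul (by positivity), ← Real.rpow_one_add' (by positivity) (by linarith)]
    congr 1; push_cast; ring
  have h4 : ((k : ℝ) / x) ^ (2 * η) ≤ N ^ (2 * η) := by
    refine Real.rpow_le_rpow (by positivity) ?_ (by positivity)
    rw [div_le_iff₀ hx]; nlinarith
  have h5 : (k : ℝ) ^ (-(1 / 2) : ℝ) * (k / x) ≤ 1 := by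
    have : (k : ℝ) ^ (-(1 / 2) : ℝ) * k = √k := by
      rw [← Real.rpow_add_one' hk'.le (by norm_num), Real.sqrt_eq_rpow]; norm_num
    rw [← mul_div_assoc, this, div_le_one hx]
    exact Real.sqrt_le_iff.mpr ⟨hx.le, hkN'.trans hNx⟩
  have h6 : C * (((k : ℝ) ^ 2 / x ^ 2) ^ (1 / 2 + η) / (1 / 2 + η)) ≤ 2 * C * (k / x * (k / x) ^ (2 * η)) := by
    rw [h3, mul_comm 2 C, mul_assoc]
    refine mul_le_mul_of_nonneg_left ?_ (by linarith)
    rw [div_le_iff₀ (by linarith)]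
    have : 0 ≤ (k : ℝ) / x * (k / x) ^ (2 * η) := by positivity
    nlinarith
  calc 4 * (k : ℝ) ^ (-(1 / 2) : ℝ) * ∫ w in (0 : ℝ)..(k ^ 2 / x ^ 2), |Phi s k (1 / w)| / w
      ≤ 4 * (k : ℝ) ^ (-(1 / 2) : ℝ) * (2 * C * (k / x * (k / x) ^ (2 * η))) := by
        refine mul_le_mul_of_nonneg_left (h1.trans h6) (by positivity)
    _ = 8 * C * (((k : ℝ) ^ (-(1 / 2) : ℝ) * (k / x)) * (k / x) ^ (2 * η)) := by ring
    _ ≤ 8 * C * (1 * N ^ (2 * η)) := by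
        refine mul_le_mul_of_nonneg_left ?_ (by linarith)
        exact mul_le_mul h5 h4 (by positivity) (by norm_num)
    _ = _ := by ring

theorem integral_cs (f g : ℝ → ℝ) {a b : ℝ} (hab : a ≤ b) (hf : IntervalIntegrable (fun w => f w ^ 2) volume a b)
    (hg : IntervalIntegrable (fun w => g w ^ 2) volume a b) (hfg : IntervalIntegrable (fun w => f w * g w) volume a b) :
    (∫ w in a..b, f w * g w) ^ 2 ≤ (∫ w in a..b, f w ^ 2) * ∫ w in a..b, g w ^ 2 := by
  have h : ∀ l : ℝ, 0 ≤ (∫ w in a..b, f w ^ 2) * (l * l) + (-2 * ∫ w in a..b, f w * g w) * l + ∫ w in a..b, g w ^ 2 := by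
    intro l
    have h1 : 0 ≤ ∫ w in a..b, (f w * l - g w) ^ 2 := intervalIntegral.integral_nonneg hab fun w _ => sq_nonneg _
    have h2 : ∀ w, (f w * l - g w) ^ 2 = (l * l) * f w ^ 2 + (-2 * l) * (f w * g w) + g w ^ 2 := fun w => by ring
    simp_rw [h2] at h1
    rw [intervalIntegral.integral_add ((hf.const_mul _).add (hfg.const_mul _)) hg,
      intervalIntegral.integral_add (hf.const_mul _) (hfg.const_mul _), intervalIntegral.integral_const_mul,
      intervalIntegral.integral_const_mul] at h1
    linarith
  have := discrim_le_zero h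
  rw [discrim] at this
  nlinarith

theorem I_intble (s : ℤ) (k : ℕ) (e b : ℝ) (hb : 1 ≤ b) :
    IntervalIntegrable (fun w => Phi s k (1 / w) ^ 2 * w ^ e) volume 1 b := by
  refine ContinuousOn.intervalIntegrable ?_
  rw [uIcc_of_le hb]
  refine ContinuousOn.mono (((Phi_inv_cont s k).pow 2).mul (rpow_contOn e)) fun w hw => ?_
  exact lt_of_lt_of_le zero_lt_one hw.1

theorem rpow_intble (e b : ℝ) (hb : 1 ≤ b) :
    IntervalIntegrable (fun w : ℝ => w ^ e) volume 1 b := by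
  refine ContinuousOn.intervalIntegrable ?_
  rw [uIcc_of_le hb]
  exact (rpow_contOn e).mono fun w hw => lt_of_lt_of_le zero_lt_one hw.1

theorem G_one_bound : ∃ C : ℝ, 1 ≤ C ∧ ∀ (s : ℤ) (k : ℕ) (z Z : ℝ), 0 ≤ z → z ≤ Z → 1 ≤ Z →
    (∫ w in (0 : ℝ)..z, |Phi s k (1 / w)| / w) ^ 2 ≤
      C * (1 + z ^ (1 / 2 : ℝ) * ∫ w in (1 : ℝ)..Z, Phi s k (1 / w) ^ 2 * w ^ (-(3 / 2) : ℝ)) := by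
  obtain ⟨C, hC, h⟩ := Phi_bound (a := 1) (by norm_num) le_rfl
  refine ⟨4 * C ^ 2, by nlinarith, fun s k z Z hz hzZ hZ => ?_⟩
  have hpt : ∀ w, 0 < w → |Phi s k (1 / w)| / w ≤ C := by
    intro w hw
    rw [div_le_iff₀ hw]
    have := h s k (1 / w) (by positivity)
    rwa [Real.rpow_neg_one, one_div, inv_inv, ← one_div] at this
  have hnn : ∀ w, 1 ≤ w → 0 ≤ Phi s k (1 / w) ^ 2 * w ^ (-(3 / 2) : ℝ) := by
    intro w hw
    have : 0 < w := by linarith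
    positivity
  have hle : ∀ y, 0 ≤ y → y ≤ 1 → ∫ w in (0 : ℝ)..y, |Phi s k (1 / w)| / w ≤ C := by
    intro y hy hy1
    calc ∫ w in (0 : ℝ)..y, |Phi s k (1 / w)| / w ≤ ∫ w in (0 : ℝ)..y, C :=
          intervalIntegral.integral_mono_on_of_le_Ioo hy (G_int s k _ _ le_rfl hy) intervalIntegrable_const
            fun w hw => hpt w hw.1
      _ ≤ C := by simp; nlinarith
  have hge : ∀ y, 0 ≤ y → 0 ≤ ∫ w in (0 : ℝ)..y, |Phi s k (1 / w)| / w := fun y hy =>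
    intervalIntegral.integral_nonneg hy fun w hw => div_nonneg (abs_nonneg _) hw.1
  have hIZ : 0 ≤ ∫ w in (1 : ℝ)..Z, Phi s k (1 / w) ^ 2 * w ^ (-(3 / 2) : ℝ) :=
    intervalIntegral.integral_nonneg hZ fun w hw => hnn w hw.1
  rcases le_total z 1 with hz1 | hz1
  · have h1 : (∫ w in (0 : ℝ)..z, |Phi s k (1 / w)| / w) ^ 2 ≤ C ^ 2 := pow_le_pow_left₀ (hge z hz) (hle z hz hz1) 2
    have : 0 ≤ z ^ (1 / 2 : ℝ) * ∫ w in (1 : ℝ)..Z, Phi s k (1 / w) ^ 2 * w ^ (-(3 / 2) : ℝ) := by positivity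
    nlinarith [mul_nonneg (sq_nonneg C) this]
  · rw [← intervalIntegral.integral_add_adjacent_intervals (G_int s k 0 1 le_rfl zero_le_one) (G_int s k 1 z zero_le_one hz1)]
    have h1 := pow_le_pow_left₀ (hge 1 zero_le_one) (hle 1 zero_le_one le_rfl) 2
    have e0 : ∀ w ∈ uIcc 1 z, |Phi s k (1 / w)| / w = (|Phi s k (1 / w)| * w ^ (-(3 / 4) : ℝ)) * w ^ (-(1 / 4) : ℝ) := by
      intro w hw
      rw [uIcc_of_le hz1] at hw
      have hw0 : 0 < w := by linarith [hw.1]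
      rw [mul_assoc, ← Real.rpow_add hw0, div_eq_mul_inv, ← Real.rpow_neg_one]
      norm_num
    have e1 : ∀ w ∈ uIcc 1 z, (|Phi s k (1 / w)| * w ^ (-(3 / 4) : ℝ)) ^ 2 = Phi s k (1 / w) ^ 2 * w ^ (-(3 / 2) : ℝ) := by
      intro w hw
      rw [uIcc_of_le hz1] at hw
      have hw0 : 0 < w := by linarith [hw.1]
      rw [mul_pow, sq_abs, ← Real.rpow_natCast (w ^ _), ← Real.rpow_mul hw0.le]
      norm_num
    have e2 : ∀ w ∈ uIcc 1 z, (w ^ (-(1 / 4) : ℝ)) ^ 2 = w ^ (-(1 / 2) : ℝ) := by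
      intro w hw
      rw [uIcc_of_le hz1] at hw
      have hw0 : 0 < w := by linarith [hw.1]
      rw [← Real.rpow_natCast (w ^ _), ← Real.rpow_mul hw0.le]
      norm_num
    have h2 : (∫ w in (1 : ℝ)..z, |Phi s k (1 / w)| / w) ^ 2 ≤
        (∫ w in (1 : ℝ)..z, Phi s k (1 / w) ^ 2 * w ^ (-(3 / 2) : ℝ)) * ∫ w in (1 : ℝ)..z, w ^ (-(1 / 2) : ℝ) := by
      rw [intervalIntegral.integral_congr e0]
      refine (integral_cs _ _ hz1 ?_ ?_ ?_).trans (le_of_eq ?_)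
      · refine (I_intble s k (-(3 / 2)) z hz1).congr fun w hw => (e1 w (uIoc_subset_uIcc hw)).symm
      · refine (rpow_intble (-(1 / 2)) z hz1).congr fun w hw => (e2 w (uIoc_subset_uIcc hw)).symm
      · exact (G_int s k 1 z zero_le_one hz1).congr fun w hw => e0 w (uIoc_subset_uIcc hw)
      · rw [intervalIntegral.integral_congr e1, intervalIntegral.integral_congr e2]
    have h3 : ∫ w in (1 : ℝ)..z, w ^ (-(1 / 2) : ℝ) ≤ 2 * z ^ (1 / 2 : ℝ) := by
      rw [integral_rpow (Or.inl (by norm_num))]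
      norm_num
      have : (0 : ℝ) ≤ z ^ (1 / 2 : ℝ) := by positivity
      linarith
    have h4 : ∫ w in (1 : ℝ)..z, Phi s k (1 / w) ^ 2 * w ^ (-(3 / 2) : ℝ) ≤
        ∫ w in (1 : ℝ)..Z, Phi s k (1 / w) ^ 2 * w ^ (-(3 / 2) : ℝ) := by
      refine intervalIntegral.integral_mono_interval le_rfl hz1 hzZ ?_ (I_intble s k _ Z hZ)
      filter_upwards [ae_restrict_mem measurableSet_Ioc] with w hw
      exact hnn w hw.1.le
    have h5 := mul_le_mul h4 h3 (intervalIntegral.integral_nonneg hz1 fun w hw =>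
      Real.rpow_nonneg (by linarith [hw.1]) _) hIZ
    set X := ∫ w in (0 : ℝ)..1, |Phi s k (1 / w)| / w
    set Y := ∫ w in (1 : ℝ)..z, |Phi s k (1 / w)| / w
    set I := ∫ w in (1 : ℝ)..Z, Phi s k (1 / w) ^ 2 * w ^ (-(3 / 2) : ℝ)
    have h6 : 0 ≤ z ^ (1 / 2 : ℝ) * I := by positivity
    nlinarith [sq_nonneg (X - Y), mul_nonneg (by nlinarith : 0 ≤ C ^ 2 - 1) h6]

end

section

open MeasureTheory Filter Topology Set

theorem sum_inv_le (η : ℝ) (hη : 0 < η) : ∃ C : ℝ, 1 ≤ C ∧ ∀ (N : ℕ) (S : Finset ℕ), (∀ n ∈ S, 1 ≤ n ∧ n ≤ N) →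
    ∑ n ∈ S, (1 / (n : ℝ)) ≤ C * (N : ℝ) ^ η := by
  refine ⟨max 1 (∑' n : ℕ, (n : ℝ) ^ (-1 - η)), le_max_left _ _, fun N S hS => ?_⟩
  have h1 : ∀ n ∈ S, (1 / (n : ℝ)) ≤ (N : ℝ) ^ η * (n : ℝ) ^ (-1 - η) := by
    intro n hn
    have hn0 : (0 : ℝ) < n := by exact_mod_cast (hS n hn).1
    have hnN : (n : ℝ) ≤ N := by exact_mod_cast (hS n hn).2
    have h2 : (n : ℝ) ^ η ≤ (N : ℝ) ^ η := Real.rpow_le_rpow hn0.le hnN hη.le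
    calc (1 / (n : ℝ)) = (n : ℝ) ^ η * (n : ℝ) ^ (-1 - η) := by
          rw [← Real.rpow_add hn0, one_div, ← Real.rpow_neg_one]; congr 1; ring
      _ ≤ _ := by gcongr
  refine (Finset.sum_le_sum h1).trans ?_
  rw [← Finset.mul_sum, mul_comm]
  refine mul_le_mul_of_nonneg_right ?_ (by positivity)
  exact ((summable_eta η hη).sum_le_tsum _ (fun n _ => by positivity)).trans (le_max_right _ _)

theorem Bx_ms (η : ℝ) (hη : 0 < η) (hη4 : η < 1 / 4) : ∃ C : ℝ, 1 ≤ C ∧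
    ∀ (s : ℤ) (N : ℕ) (x : ℝ), (s = 1 ∨ s = -1) → 1 ≤ N → (N : ℝ) ≤ x ^ 2 → 0 < x → x ≤ N →
      (∀ k ∈ FD s N, FEP s k) → ∑ k ∈ FD s N, (Bx s k x) ^ 2 ≤ C * ((N : ℝ) ^ (1 + 2 * η) / x) := by
  obtain ⟨C1, hC1, h1⟩ := G_one_bound
  obtain ⟨C2, hC2, h2⟩ := Phi_ms η hη hη4
  obtain ⟨C3, hC3, h3⟩ := sum_inv_le (2 * η) (by linarith)
  refine ⟨16 * C1 * (C3 + C2 / (2 * η)), ?_, fun s N x hs hN hNx hx hxN hFE => ?_⟩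
  · have : 0 < C2 / (2 * η) := by positivity
    nlinarith
  have hN0 : (0 : ℝ) < N := by exact_mod_cast hN
  have hN1 : (1 : ℝ) ≤ N := by exact_mod_cast hN
  set Z : ℝ := N ^ 2 / x ^ 2 with hZ
  have hZ1 : 1 ≤ Z := by rw [hZ, one_le_div (by positivity)]; gcongr
  have hZN : Z ≤ N := by
    rw [hZ, div_le_iff₀ (by positivity)]; nlinarith
  set I : ℕ → ℝ := fun k => ∫ w in (1 : ℝ)..Z, Phi s k (1 / w) ^ 2 * w ^ (-(3 / 2) : ℝ) with hI
  have hk1 : ∀ k ∈ FD s N, (Bx s k x) ^ 2 ≤ 16 * C1 * (1 / (k : ℝ)) + 16 * C1 * (1 / x * I k) := by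
    intro k hk
    obtain ⟨⟨hk1, hkN⟩, -⟩ := mem_FD.mp hk
    have hk0 : (0 : ℝ) < k := by exact_mod_cast hk1
    have hkN' : (k : ℝ) ≤ N := by exact_mod_cast hkN
    have hB := Bx_bound s k hk1 (hFE k hk) hx
    have hG := h1 s k (k ^ 2 / x ^ 2) Z (by positivity) (by rw [hZ]; gcongr) hZ1
    rw [← sq_abs]
    refine (pow_le_pow_left₀ (abs_nonneg _) hB 2).trans ?_
    rw [mul_pow, mul_pow, ← Real.rpow_natCast ((k : ℝ) ^ _), ← Real.rpow_mul hk0.le]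
    have e1 : (k : ℝ) ^ (-(1 / 2) * ((2 : ℕ) : ℝ)) = 1 / k := by
      rw [show (-(1 / 2) * ((2 : ℕ) : ℝ)) = -1 by norm_num, Real.rpow_neg_one, one_div]
    have e2 : ((k : ℝ) ^ 2 / x ^ 2) ^ (1 / 2 : ℝ) = k / x := by
      rw [← div_pow, ← Real.sqrt_eq_rpow, Real.sqrt_sq (by positivity)]
    rw [e1]
    rw [e2] at hG
    calc (4 : ℝ) ^ 2 * (1 / k) * (∫ w in (0 : ℝ)..(k ^ 2 / x ^ 2), |Phi s k (1 / w)| / w) ^ 2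
        ≤ 4 ^ 2 * (1 / k) * (C1 * (1 + k / x * I k)) := mul_le_mul_of_nonneg_left hG (by positivity)
      _ = _ := by field_simp; ring
  refine (Finset.sum_le_sum hk1).trans ?_
  rw [Finset.sum_add_distrib, ← Finset.mul_sum, ← Finset.mul_sum, ← Finset.mul_sum]
  have hS1 := h3 N (FD s N) fun n hn => (mem_FD.mp hn).1
  have hS2 : ∑ k ∈ FD s N, I k ≤ C2 / (2 * η) * (N : ℝ) ^ (1 + 2 * η) := by
    rw [hI, ← intervalIntegral.integral_finsetSum fun k _ => I_intble s k _ Z hZ1]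
    have e3 : ∀ w, ∑ k ∈ FD s N, Phi s k (1 / w) ^ 2 * w ^ (-(3 / 2) : ℝ) = (∑ k ∈ FD s N, Phi s k (1 / w) ^ 2) * w ^ (-(3 / 2) : ℝ) :=
      fun w => (Finset.sum_mul _ _ _).symm
    calc ∫ w in (1 : ℝ)..Z, ∑ k ∈ FD s N, Phi s k (1 / w) ^ 2 * w ^ (-(3 / 2) : ℝ)
        ≤ ∫ w in (1 : ℝ)..Z, C2 * N * w ^ (2 * η - 1) := by
          refine intervalIntegral.integral_mono_on hZ1 ?_ ((rpow_intble _ Z hZ1).const_mul _) fun w hw => ?_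
          · have := IntervalIntegrable.sum (FD s N) (f := fun k w => Phi s k (1 / w) ^ 2 * w ^ (-(3 / 2) : ℝ)) (fun k _ => I_intble s k (-(3 / 2)) Z hZ1)
            refine this.congr fun w _ => ?_
            simp
          · have hw0 : 0 < w := by linarith [hw.1]
            rw [e3]
            have := h2 s N w hs hN hw.1 (hw.2.trans hZN)
            calc _ ≤ C2 * (N * w ^ (1 / 2 + 2 * η)) * w ^ (-(3 / 2) : ℝ) := by gcongr
              _ = C2 * N * (w ^ (1 / 2 + 2 * η) * w ^ (-(3 / 2) : ℝ)) := by ring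
              _ = _ := by rw [← Real.rpow_add hw0]; ring_nf
      _ = C2 * N * ((Z ^ (2 * η) - 1) / (2 * η)) := by
          rw [intervalIntegral.integral_const_mul, integral_rpow (Or.inl (by linarith))]
          simp
      _ ≤ C2 * N * (N ^ (2 * η) / (2 * η)) := by
          have : Z ^ (2 * η) ≤ N ^ (2 * η) := Real.rpow_le_rpow (by linarith) hZN (by linarith)
          gcongr
          linarith
      _ = _ := by
          rw [Real.rpow_add hN0, Real.rpow_one]; ring
  have hS3 : (N : ℝ) ^ (2 * η) ≤ (N : ℝ) ^ (1 + 2 * η) / x := by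
    rw [le_div_iff₀ hx, Real.rpow_add hN0, Real.rpow_one, mul_comm]
    gcongr
  have a1 : ∑ i ∈ FD s N, 1 / (i : ℝ) ≤ C3 * ((N : ℝ) ^ (1 + 2 * η) / x) :=
    hS1.trans (mul_le_mul_of_nonneg_left hS3 (by linarith))
  have a2 : 1 / x * ∑ k ∈ FD s N, I k ≤ C2 / (2 * η) * ((N : ℝ) ^ (1 + 2 * η) / x) := by
    calc _ ≤ 1 / x * (C2 / (2 * η) * (N : ℝ) ^ (1 + 2 * η)) := by gcongr
      _ = _ := by ring
  have a3 : 0 ≤ 16 * C1 := by linarith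
  have b1 := mul_le_mul_of_nonneg_left a1 a3
  have b2 := mul_le_mul_of_nonneg_left a2 a3
  linarith

end

section

open Finset

abbrev AF := ArithmeticFunction ℝ

/-- twisted partial sum of an arithmetic function -/
noncomputable def DA (L : ℕ) (F : AF) (Δ : ℤ) : ℝ := DP (Icc 1 L) (fun n => F n) Δ

theorem max_mul_max_ge (a b H1 H2 : ℝ) (ha : 0 ≤ a) (hb : 0 ≤ b) (h1 : 0 ≤ H1) (h2 : 0 ≤ H2) :
    max (a * b) (H1 * H2) ≤ max a H1 * max b H2 :=
  max_le (mul_le_mul (le_max_left _ _) (le_max_left _ _) hb (ha.trans (le_max_left _ _)))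
    (mul_le_mul (le_max_right _ _) (le_max_right _ _) h2 (ha.trans (le_max_left _ _)))

theorem conv_bound {ι : Type*} [DecidableEq ι] (S : Finset ι) (F : ι → AF) (H : ι → ℝ) (K : ℝ) (hK : 0 ≤ K)
    (hH : ∀ i ∈ S, 0 ≤ H i)
    (hF : ∀ i ∈ S, ∀ n : ℕ, n ≠ 0 → |F i n| ≤ K / max (n : ℝ) (H i)) (n : ℕ) (hn : n ≠ 0) :
    |(∏ i ∈ S, F i) n| ≤ K ^ #S * (n.divisors.card : ℝ) ^ #S / max (n : ℝ) (∏ i ∈ S, H i) := by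
  induction S using Finset.induction_on generalizing n with
  | empty =>
    simp only [prod_empty, card_empty, pow_zero, mul_one]
    have h1 : (1 : ℝ) ≤ n := by exact_mod_cast Nat.one_le_iff_ne_zero.mpr hn
    rw [max_eq_left h1, ArithmeticFunction.one_apply]
    split_ifs with h
    · subst h; simp
    · simp
  | insert a S ha ih =>
    rw [prod_insert ha, card_insert_of_notMem ha, ArithmeticFunction.mul_apply, prod_insert ha]
    have hHa := hH a (mem_insert_self _ _)
    have hP : 0 ≤ ∏ i ∈ S, H i := prod_nonneg fun i hi => hH i (mem_insert_of_mem hi)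
    have hn0 : (0 : ℝ) < n := by exact_mod_cast Nat.pos_of_ne_zero hn
    have hmx : 0 < max (n : ℝ) (H a * ∏ i ∈ S, H i) := lt_of_lt_of_le hn0 (le_max_left _ _)
    have hd : ∀ x ∈ n.divisorsAntidiagonal, |F a x.1 * (∏ i ∈ S, F i) x.2| ≤
        K ^ (#S + 1) * (n.divisors.card : ℝ) ^ #S / max (n : ℝ) (H a * ∏ i ∈ S, H i) := by
      intro x hx
      rw [Nat.mem_divisorsAntidiagonal] at hx
      have hx1 : x.1 ≠ 0 := by rintro h; simp [h] at hx; omega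
      have hx2 : x.2 ≠ 0 := by rintro h; simp [h] at hx; omega
      have e1 := hF a (mem_insert_self _ _) x.1 hx1
      have e2 := ih (fun i hi => hH i (mem_insert_of_mem hi)) (fun i hi => hF i (mem_insert_of_mem hi)) x.2 hx2
      have hx1' : (0 : ℝ) < x.1 := by exact_mod_cast Nat.pos_of_ne_zero hx1
      have hx2' : (0 : ℝ) < x.2 := by exact_mod_cast Nat.pos_of_ne_zero hx2
      have hdc : (x.2.divisors.card : ℝ) ≤ n.divisors.card := by
        exact_mod_cast card_le_card (Nat.divisors_subset_of_dvd hn (Dvd.intro_left _ hx.1))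
      have m1 : 0 < max (x.1 : ℝ) (H a) := lt_of_lt_of_le hx1' (le_max_left _ _)
      have m2 : 0 < max (x.2 : ℝ) (∏ i ∈ S, H i) := lt_of_lt_of_le hx2' (le_max_left _ _)
      have hm := max_mul_max_ge x.1 x.2 (H a) (∏ i ∈ S, H i) hx1'.le hx2'.le hHa hP
      have hc : ((x.1 : ℝ)) * x.2 = n := by exact_mod_cast hx.1
      rw [hc] at hm
      rw [abs_mul]
      calc |F a x.1| * |(∏ i ∈ S, F i) x.2| ≤ (K / max (x.1 : ℝ) (H a)) *
            (K ^ #S * (x.2.divisors.card : ℝ) ^ #S / max (x.2 : ℝ) (∏ i ∈ S, H i)) :=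
            mul_le_mul e1 e2 (abs_nonneg _) (by positivity)
        _ = K ^ (#S + 1) * (x.2.divisors.card : ℝ) ^ #S / (max (x.1 : ℝ) (H a) * max (x.2 : ℝ) (∏ i ∈ S, H i)) := by
            rw [div_mul_div_comm]; ring
        _ ≤ _ := by
            apply div_le_div₀ (by positivity) _ hmx hm
            gcongr
    refine (abs_sum_le_sum_abs _ _).trans ((sum_le_card_nsmul _ _ _ hd).trans (le_of_eq ?_))
    have : #n.divisorsAntidiagonal = #n.divisors := by
      rw [← Nat.map_div_right_divisors, card_map]
    rw [this, nsmul_eq_mul]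
    ring

theorem conv_supp {ι : Type*} [DecidableEq ι] (S : Finset ι) (F : ι → AF) (M : ι → ℝ) (hM : ∀ i ∈ S, 0 ≤ M i)
    (hF : ∀ i ∈ S, ∀ n : ℕ, M i < n → F i n = 0) (n : ℕ) (hn : ∏ i ∈ S, M i < n) :
    (∏ i ∈ S, F i) n = 0 := by
  induction S using Finset.induction_on generalizing n with
  | empty =>
    simp only [prod_empty] at hn ⊢
    rw [ArithmeticFunction.one_apply_ne]
    rintro rfl
    simp at hn
  | insert a S ha ih =>
    rw [prod_insert ha] at hn ⊢
    rw [ArithmeticFunction.mul_apply]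
    apply sum_eq_zero
    intro x hx
    rw [Nat.mem_divisorsAntidiagonal] at hx
    have hc : ((x.1 : ℝ)) * x.2 = n := by exact_mod_cast hx.1
    by_cases h1 : M a < x.1
    · rw [hF a (mem_insert_self _ _) _ h1, zero_mul]
    · rw [ih (fun i hi => hM i (mem_insert_of_mem hi)) (fun i hi => hF i (mem_insert_of_mem hi)), mul_zero]
      by_contra h2
      push Not at h1 h2
      have := mul_le_mul h1 h2 (Nat.cast_nonneg _) (hM a (mem_insert_self _ _))
      linarith

theorem DP_mul (F G : AF) (A B : ℝ) (hA : ∀ n : ℕ, A < n → F n = 0) (hB : ∀ n : ℕ, B < n → G n = 0)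
    (hA0 : 0 ≤ A) (L : ℕ) (hL : A * B ≤ L) (Δ : ℤ) :
    DA L (F * G) Δ = DA L F Δ * DA L G Δ := by
  unfold DA DP
  rw [sum_mul_sum, ← sum_product']
  have h1 : ∀ n ∈ Icc 1 L, (F * G) n * (kro Δ n : ℝ) =
      ∑ x ∈ n.divisorsAntidiagonal, (F x.1 * kro Δ x.1) * (G x.2 * kro Δ x.2) := by
    intro n hn
    rw [ArithmeticFunction.mul_apply, sum_mul]
    apply sum_congr rfl
    intro x hx
    rw [Nat.mem_divisorsAntidiagonal] at hx
    have hx1 : x.1 ≠ 0 := by rintro h; simp [h] at hx; omega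
    have hx2 : x.2 ≠ 0 := by rintro h; simp [h] at hx; omega
    rw [← hx.1, kro_mul Δ hx1 hx2]
    push_cast; ring
  rw [sum_congr rfl h1, sum_sigma']
  symm
  apply sum_bij_ne_zero (fun x _ _ => (⟨x.1 * x.2, x⟩ : (_ : ℕ) × ℕ × ℕ))
  · intro x hx hne
    rw [mem_product, mem_Icc, mem_Icc] at hx
    have hF : F x.1 ≠ 0 := by intro h; simp [h] at hne
    have hG : G x.2 ≠ 0 := by intro h; simp [h] at hne
    have a1 : (x.1 : ℝ) ≤ A := by by_contra h; exact hF (hA _ (not_le.mp h))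
    have a2 : (x.2 : ℝ) ≤ B := by by_contra h; exact hG (hB _ (not_le.mp h))
    have a3 : ((x.1 * x.2 : ℕ) : ℝ) ≤ L := by
      push_cast; exact (mul_le_mul a1 a2 (Nat.cast_nonneg _) hA0).trans hL
    have a4 : x.1 * x.2 ≤ L := by exact_mod_cast a3
    rw [mem_sigma, mem_Icc, Nat.mem_divisorsAntidiagonal]
    have a5 : 0 < x.1 * x.2 := Nat.mul_pos hx.1.1 hx.2.1
    exact ⟨⟨a5, a4⟩, rfl, a5.ne'⟩
  · intro x _ _ y _ _ h
    simp at h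
    exact h.2
  · rintro ⟨n, x⟩ hx hne
    rw [mem_sigma, mem_Icc, Nat.mem_divisorsAntidiagonal] at hx
    obtain ⟨⟨h1, h2⟩, h3, h4⟩ := hx
    simp only at h1 h2 h3 h4 hne
    have p1 : 0 < x.1 := Nat.pos_of_ne_zero (by rintro h; simp [h] at h3; omega)
    have p2 : 0 < x.2 := Nat.pos_of_ne_zero (by rintro h; simp [h] at h3; omega)
    refine ⟨x, ?_, hne, ?_⟩
    · rw [mem_product, mem_Icc, mem_Icc]
      refine ⟨⟨p1, ?_⟩, p2, ?_⟩ <;> nlinarith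
    · simp [h3]
  · intro x _ _; rfl

theorem DP_prod {ι : Type*} [DecidableEq ι] (S : Finset ι) (F : ι → AF) (M : ι → ℝ) (hM : ∀ i ∈ S, 1 ≤ M i)
    (hF : ∀ i ∈ S, ∀ n : ℕ, M i < n → F i n = 0) (L : ℕ) (hL : ∏ i ∈ S, M i ≤ L) (Δ : ℤ) :
    DA L (∏ i ∈ S, F i) Δ = ∏ i ∈ S, DA L (F i) Δ := by
  induction S using Finset.induction_on with
  | empty =>
    simp only [prod_empty] at hL ⊢
    unfold DA DP
    have : 1 ≤ L := by exact_mod_cast hL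
    rw [sum_eq_single 1]
    · simp [kro_one]
    · intro b _ hb; beta_reduce; rw [ArithmeticFunction.one_apply_ne hb, zero_mul]
    · intro h; simp at h; omega
  | insert a S ha ih =>
    rw [prod_insert ha] at hL ⊢
    rw [prod_insert ha]
    have h1 := hM a (mem_insert_self _ _)
    have h2 : 1 ≤ ∏ i ∈ S, M i := by
      have := prod_le_prod (s := S) (f := fun _ => (1 : ℝ)) (g := M) (fun _ _ => zero_le_one) (fun i hi => hM i (mem_insert_of_mem hi))
      simpa using this
    rw [DP_mul (F a) (∏ i ∈ S, F i) (M a) (∏ i ∈ S, M i) (hF a (mem_insert_self _ _))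
      (conv_supp S F M (fun i hi => zero_le_one.trans (hM i (mem_insert_of_mem hi))) (fun i hi => hF i (mem_insert_of_mem hi)))
      (by linarith) L hL, ih (fun i hi => hM i (mem_insert_of_mem hi)) (fun i hi => hF i (mem_insert_of_mem hi))]
    nlinarith

/-- subset with sum in a window -/
theorem exists_window {ι : Type*} [DecidableEq ι] (U : Finset ι) (α : ι → ℝ) (c : ℝ) (hc : 0 ≤ c)
    (hα : ∀ i ∈ U, 0 ≤ α i ∧ α i < 1 / 3) (h : c ≤ ∑ i ∈ U, α i) :
    ∃ T ⊆ U, c ≤ ∑ i ∈ T, α i ∧ ∑ i ∈ T, α i < c + 1 / 3 := by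
  induction U using Finset.induction_on with
  | empty =>
    simp only [sum_empty] at h
    exact ⟨∅, Subset.refl _, by simpa using h, by simp; linarith⟩
  | insert a S ha ih =>
    by_cases h2 : c ≤ ∑ i ∈ S, α i
    · obtain ⟨T, hT, h3⟩ := ih (fun i hi => hα i (mem_insert_of_mem hi)) h2
      exact ⟨T, hT.trans (subset_insert _ _), h3⟩
    · refine ⟨insert a S, Subset.refl _, h, ?_⟩
      rw [sum_insert ha]
      have := (hα a (mem_insert_self _ _)).2
      push Not at h2
      linarith

theorem exists_balance {ι : Type*} [DecidableEq ι] (U : Finset ι) (α : ι → ℝ)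
    (hα : ∀ i ∈ U, 0 ≤ α i ∧ α i < 1 / 3) :
    ∃ S ⊆ U, ∃ T ⊆ U, Disjoint S T ∧ ∑ i ∈ S, α i + ∑ i ∈ T, α i = ∑ i ∈ U, α i ∧
      ∑ i ∈ S, α i ≤ ∑ i ∈ T, α i + 1 / 3 ∧ ∑ i ∈ T, α i ≤ ∑ i ∈ S, α i + 1 / 3 := by
  induction U using Finset.induction_on with
  | empty => exact ⟨∅, Subset.refl _, ∅, Subset.refl _, disjoint_empty_left _, by simp, by simp, by simp⟩
  | insert a U ha ih =>
    obtain ⟨S, hS, T, hT, hd, h1, h2, h3⟩ := ih (fun i hi => hα i (mem_insert_of_mem hi))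
    obtain ⟨e1, e2⟩ := hα a (mem_insert_self _ _)
    have haS : a ∉ S := fun h => ha (hS h)
    have haT : a ∉ T := fun h => ha (hT h)
    rcases le_total (∑ i ∈ S, α i) (∑ i ∈ T, α i) with h | h
    · refine ⟨insert a S, insert_subset_insert _ hS, T, hT.trans (subset_insert _ _), ?_, ?_, ?_, ?_⟩
      · rw [disjoint_insert_left]; exact ⟨haT, hd⟩
      all_goals (rw [sum_insert haS]; try rw [sum_insert ha]); linarith
    · refine ⟨S, hS.trans (subset_insert _ _), insert a T, insert_subset_insert _ hT, ?_, ?_, ?_, ?_⟩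
      · rw [disjoint_insert_right]; exact ⟨haS, hd⟩
      all_goals (rw [sum_insert haT]; try rw [sum_insert ha]); linarith

theorem combi {ι : Type*} [DecidableEq ι] (U : Finset ι) (α : ι → ℝ) (hα : ∀ i ∈ U, 0 ≤ α i ∧ α i ≤ 2 / 3)
    (h : 2 / 3 ≤ ∑ i ∈ U, α i) (Q : Finset ι → ℝ → Prop)
    (Q1 : ∀ S ⊆ U, (∀ i ∈ S, α i < 1 / 3) → Q S (max (1 - ∑ i ∈ S, α i) (∑ i ∈ S, α i)))
    (Q2 : ∀ i ∈ U, 1 / 3 ≤ α i → Q {i} (1 - α i)) :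
    ∃ S ⊆ U, ∃ T ⊆ U, Disjoint S T ∧ ∃ e1 e2, e1 + e2 ≤ 4 / 3 ∧ Q S e1 ∧ Q T e2 := by
  by_cases h1 : ∃ a ∈ U, 1 / 3 ≤ α a
  · obtain ⟨a, ha, h1⟩ := h1
    by_cases h2 : ∃ b ∈ U, b ≠ a ∧ 1 / 3 ≤ α b
    · obtain ⟨b, hb, hab, h2⟩ := h2
      exact ⟨{a}, by simpa using ha, {b}, by simpa using hb, by simpa using hab.symm, _, _, by linarith, Q2 a ha h1, Q2 b hb h2⟩
    · push Not at h2
      have e : ∀ i ∈ U.erase a, 0 ≤ α i ∧ α i < 1 / 3 := fun i hi =>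
        ⟨(hα i (mem_of_mem_erase hi)).1, h2 i (mem_of_mem_erase hi) (ne_of_mem_erase hi)⟩
      have hs := add_sum_erase U α ha
      obtain ⟨T, hT, h3, h4⟩ := exists_window (U.erase a) α (2 / 3 - α a) (by linarith [(hα a ha).2]) e (by linarith)
      refine ⟨{a}, by simpa using ha, T, hT.trans (erase_subset _ _), ?_, _, _, ?_, Q2 a ha h1,
        Q1 T (hT.trans (erase_subset _ _)) fun i hi => (e i (hT hi)).2⟩
      · rw [disjoint_singleton_left]; intro h; exact notMem_erase a U (hT h)
      · rcases max_choice (1 - ∑ i ∈ T, α i) (∑ i ∈ T, α i) with h | h <;> rw [h] <;> linarith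
  · push Not at h1
    have e : ∀ i ∈ U, 0 ≤ α i ∧ α i < 1 / 3 := fun i hi => ⟨(hα i hi).1, h1 i hi⟩
    obtain ⟨U', hU, h3, h4⟩ := exists_window U α (2 / 3) (by norm_num) e h
    obtain ⟨S, hS, T, hT, hd, g1, g2, g3⟩ := exists_balance U' α fun i hi => e i (hU hi)
    refine ⟨S, hS.trans hU, T, hT.trans hU, hd, _, _, ?_, Q1 S (hS.trans hU) fun i hi => (e i (hU (hS hi))).2,
      Q1 T (hT.trans hU) fun i hi => (e i (hU (hT hi))).2⟩
    rcases max_choice (1 - ∑ i ∈ T, α i) (∑ i ∈ T, α i) with h | h <;>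
    rcases max_choice (1 - ∑ i ∈ S, α i) (∑ i ∈ S, α i) with h' | h' <;> rw [h, h'] <;> linarith

end

section

open Finset

/-- the smoothed coefficient -/
noncomputable def Wt (s : ℤ) (x : ℝ) (n : ℕ) : ℝ := (1 / (n : ℝ)) * W s ((n : ℝ) ^ 2 / x ^ 2)

noncomputable def lam (J : ℕ) : ℝ := 2 / (3 * J)

noncomputable def xx (N J j : ℕ) : ℝ := (N : ℝ) ^ ((j : ℝ) * lam J)

noncomputable def al (J : ℕ) : ℕ → ℝ
  | 0 => 0
  | j + 1 => (j : ℝ) * lam J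

noncomputable def ct (s : ℤ) (N J : ℕ) : ℕ → ℕ → ℝ
  | 0, n => Wt s (xx N J 0) n
  | j + 1, n => Wt s (xx N J (j + 1)) n - Wt s (xx N J j) n

theorem Wt_zero (s : ℤ) (x : ℝ) : Wt s x 0 = 0 := by simp [Wt]

theorem ct_zero (s : ℤ) (N J j : ℕ) : ct s N J j 0 = 0 := by
  cases j <;> simp [ct, Wt_zero]

open Classical in
noncomputable def cc (s : ℤ) (N J : ℕ) (η : ℝ) (j : ℕ) : AF :=
  ⟨fun n => if (n : ℝ) ≤ (N : ℝ) ^ (al J j + lam J + η) then ct s N J j n else 0, by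
    simp [ct_zero]⟩

noncomputable def bb : AF := ⟨fun n => 1 / (n : ℝ), by simp⟩

noncomputable def rr (s : ℤ) (N J : ℕ) (η : ℝ) : AF := bb - ∑ j ∈ range (J + 1), cc s N J η j

theorem cc_of_le {s : ℤ} {N J : ℕ} {η : ℝ} {j n : ℕ} (h : (n : ℝ) ≤ (N : ℝ) ^ (al J j + lam J + η)) :
    cc s N J η j n = ct s N J j n := if_pos h

theorem cc_of_lt {s : ℤ} {N J : ℕ} {η : ℝ} {j n : ℕ} (h : (N : ℝ) ^ (al J j + lam J + η) < n) :
    cc s N J η j n = 0 := if_neg (not_le.mpr h)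

theorem lam_nonneg (J : ℕ) : 0 ≤ lam J := by unfold lam; positivity

theorem al_nonneg (J j : ℕ) : 0 ≤ al J j := by
  cases j
  · exact le_refl _
  · exact mul_nonneg (Nat.cast_nonneg _) (lam_nonneg J)

theorem J_lam (J : ℕ) (hJ : 1 ≤ J) : (J : ℝ) * lam J = 2 / 3 := by
  unfold lam
  have : (0 : ℝ) < J := by exact_mod_cast hJ
  field_simp

theorem j_lam_le (J j : ℕ) (hJ : 1 ≤ J) (hj : j ≤ J) : (j : ℝ) * lam J ≤ 2 / 3 := by
  rw [← J_lam J hJ]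
  have : (j : ℝ) ≤ J := by exact_mod_cast hj
  exact mul_le_mul_of_nonneg_right this (lam_nonneg J)

theorem al_le (J j : ℕ) (hJ : 1 ≤ J) (hj : j ≤ J + 1) : al J j ≤ 2 / 3 := by
  cases j
  · simp only [al]; norm_num
  · exact j_lam_le J _ hJ (by omega)

theorem al_last (J : ℕ) (hJ : 1 ≤ J) : al J (J + 1) = 2 / 3 := J_lam J hJ

theorem al_ge (J j : ℕ) : (j : ℝ) * lam J ≤ al J j + lam J := by
  cases j with
  | zero => simp [al, lam_nonneg]
  | succ j => simp only [al]; push_cast; linarith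

theorem one_le_xx (N J j : ℕ) (hN : 1 ≤ N) : 1 ≤ xx N J j :=
  Real.one_le_rpow (by exact_mod_cast hN) (mul_nonneg (Nat.cast_nonneg _) (lam_nonneg J))

theorem xx_le (N J j : ℕ) (hN : 1 ≤ N) (hJ : 1 ≤ J) (hj : j ≤ J) : xx N J j ≤ N := by
  have h1 : (1 : ℝ) ≤ N := by exact_mod_cast hN
  have := Real.rpow_le_rpow_of_exponent_le h1 (show (j : ℝ) * lam J ≤ 1 by linarith [j_lam_le J j hJ hj])
  rwa [Real.rpow_one] at this

theorem Wt_nonneg (s : ℤ) (x : ℝ) (n : ℕ) : 0 ≤ Wt s x n :=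
  mul_nonneg (by positivity) (W_nonneg s (by positivity))

theorem Wt_le (s : ℤ) (x : ℝ) (n : ℕ) : Wt s x n ≤ 1 / n :=
  mul_le_of_le_one_right (by positivity) (W_le_one s (by positivity))

theorem Wt_near (s : ℤ) (x : ℝ) (hx : 0 < x) (n : ℕ) (hn : n ≠ 0) : 1 / (n : ℝ) - Wt s x n ≤ 8 / x := by
  have hn0 : (0 : ℝ) < n := by exact_mod_cast Nat.pos_of_ne_zero hn
  have h := W_near s (z := (n : ℝ) ^ 2 / x ^ 2) (by positivity)
  rw [← div_pow, ← Real.rpow_natCast, ← Real.rpow_mul (by positivity)] at h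
  norm_num at h
  unfold Wt
  rw [← div_pow]
  have e : 1 / (n : ℝ) - 1 / n * W s ((n / x) ^ 2) = 1 / n * (1 - W s ((n / x) ^ 2)) := by ring
  rw [e]
  calc 1 / (n : ℝ) * (1 - W s ((n / x) ^ 2)) ≤ 1 / n * (8 * (n / x)) :=
        mul_le_mul_of_nonneg_left (by linarith) (by positivity)
    _ = 8 / x := by field_simp

theorem Wt_tail (η : ℝ) (hη : 0 < η) : ∃ C : ℝ, 1 ≤ C ∧ ∀ (s : ℤ) (n N : ℕ) (x : ℝ), 1 ≤ N → 1 ≤ x → x ≤ N →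
    x * (N : ℝ) ^ η < n → Wt s x n ≤ C / ((N : ℝ) ^ 2 * (n : ℝ) ^ 2) := by
  obtain ⟨m, hm⟩ := exists_nat_ge (2 / η)
  obtain ⟨C, hC, h⟩ := W_decay (m + 1)
  refine ⟨C, hC, fun s n N x hN hx1 hxN hn => ?_⟩
  have hN1 : (1 : ℝ) ≤ N := by exact_mod_cast hN
  have hN0 : (0 : ℝ) < N := by linarith
  have hx0 : 0 < x := by linarith
  have hNη : (1 : ℝ) ≤ (N : ℝ) ^ η := Real.one_le_rpow hN1 hη.le
  have hn1 : (1 : ℝ) < n := lt_of_le_of_lt (by nlinarith) hn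
  have hn0 : (0 : ℝ) < n := by linarith
  have h1 := h s ((n : ℝ) ^ 2 / x ^ 2) (by positivity)
  have h2 : C / ((n : ℝ) ^ 2 / x ^ 2) ^ (m + 1) = C * ((x / n) ^ (2 * m) * (x / n) ^ 2) := by
    rw [← div_pow, ← pow_mul, ← pow_add, div_eq_mul_inv, ← inv_pow, inv_div]
    ring_nf
  have h3 : x / n ≤ (N : ℝ) ^ (-η) := by
    rw [Real.rpow_neg hN0.le, div_le_iff₀ hn0, inv_mul_eq_div, le_div_iff₀ (by linarith)]
    exact hn.le
  have h4 : (x / n) ^ (2 * m) ≤ 1 / (N : ℝ) ^ 4 := by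
    calc (x / n) ^ (2 * m) ≤ ((N : ℝ) ^ (-η)) ^ (2 * m) := pow_le_pow_left₀ (by positivity) h3 _
      _ = (N : ℝ) ^ (-η * ((2 * m : ℕ) : ℝ)) := by rw [Real.rpow_mul hN0.le, Real.rpow_natCast]
      _ ≤ (N : ℝ) ^ (-4 : ℝ) := by
          apply Real.rpow_le_rpow_of_exponent_le hN1
          rw [div_le_iff₀ hη] at hm
          push_cast; linarith
      _ = 1 / (N : ℝ) ^ 4 := by
          rw [Real.rpow_neg hN0.le, one_div]; norm_cast
  have h5 : (x / n) ^ 2 ≤ (N / n) ^ 2 := by gcongr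
  have h6 : W s ((n : ℝ) ^ 2 / x ^ 2) ≤ C * (1 / (N : ℝ) ^ 4 * (N / n) ^ 2) := by
    rw [h2] at h1
    refine h1.trans (mul_le_mul_of_nonneg_left (mul_le_mul h4 h5 (by positivity) (by positivity)) (by linarith))
  have h7 : C * (1 / (N : ℝ) ^ 4 * (N / n) ^ 2) = C / ((N : ℝ) ^ 2 * (n : ℝ) ^ 2) := by field_simp
  rw [h7] at h6
  unfold Wt
  refine le_trans ?_ h6
  exact mul_le_of_le_one_left (W_nonneg s (by positivity)) (by rw [div_le_one hn0]; exact hn1.le)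

theorem ct_bound (s : ℤ) (N J j : ℕ) (hN : 1 ≤ N) (n : ℕ) (hn : n ≠ 0) :
    |ct s N J j n| ≤ 8 / max (n : ℝ) ((N : ℝ) ^ (al J j)) := by
  have hn0 : (0 : ℝ) < n := by exact_mod_cast Nat.pos_of_ne_zero hn
  have hn1 : (1 : ℝ) ≤ n := by exact_mod_cast Nat.pos_of_ne_zero hn
  cases j with
  | zero =>
    simp only [ct, al, Real.rpow_zero]
    rw [max_eq_left hn1, abs_of_nonneg (Wt_nonneg _ _ _)]
    refine (Wt_le _ _ _).trans ?_
    gcongr; norm_num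
  | succ j =>
    have hx : 1 ≤ xx N J j := one_le_xx N J j hN
    have hx' : 1 ≤ xx N J (j + 1) := one_le_xx N J (j + 1) hN
    have hle : xx N J j ≤ xx N J (j + 1) := by
      apply Real.rpow_le_rpow_of_exponent_le (by exact_mod_cast hN)
      push_cast; nlinarith [lam_nonneg J]
    have a1 := Wt_le s (xx N J j) n
    have a2 := Wt_le s (xx N J (j + 1)) n
    have b1 := Wt_nonneg s (xx N J j) n
    have b2 := Wt_nonneg s (xx N J (j + 1)) n
    have c1 := Wt_near s (xx N J j) (by linarith) n hn
    have c2 := Wt_near s (xx N J (j + 1)) (by linarith) n hn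
    have d : 8 / xx N J (j + 1) ≤ 8 / xx N J j := by gcongr
    have e : (N : ℝ) ^ (al J (j + 1)) = xx N J j := rfl
    simp only [ct]
    rw [e]
    rcases le_total (n : ℝ) (xx N J j) with h | h
    · rw [max_eq_right h, abs_le]; constructor <;> linarith
    · rw [max_eq_left h]
      have : 1 / (n : ℝ) ≤ 8 / n := by gcongr; norm_num
      rw [abs_le]; constructor <;> linarith

theorem ct_tail (η : ℝ) (hη : 0 < η) : ∃ C : ℝ, 1 ≤ C ∧ ∀ (s : ℤ) (N J j n : ℕ), 1 ≤ N → 1 ≤ J → j ≤ J →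
    |ct s N J j n - cc s N J η j n| ≤ C / ((N : ℝ) ^ 2 * (n : ℝ) ^ 2) := by
  obtain ⟨C, hC, h⟩ := Wt_tail η hη
  refine ⟨C, hC, fun s N J j n hN hJ hj => ?_⟩
  rcases le_or_gt (n : ℝ) ((N : ℝ) ^ (al J j + lam J + η)) with h1 | h1
  · rw [cc_of_le h1, sub_self, abs_zero]; positivity
  · rw [cc_of_lt h1, sub_zero]
    have hN1 : (1 : ℝ) ≤ N := by exact_mod_cast hN
    have key : ∀ i : ℕ, i ≤ j → Wt s (xx N J i) n ≤ C / ((N : ℝ) ^ 2 * (n : ℝ) ^ 2) := by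
      intro i hi
      apply h s n N _ hN (one_le_xx N J i hN) (xx_le N J i hN hJ (by omega))
      refine lt_of_le_of_lt ?_ h1
      unfold xx
      rw [← Real.rpow_add (by linarith)]
      apply Real.rpow_le_rpow_of_exponent_le hN1
      have := al_ge J j
      have : (i : ℝ) * lam J ≤ j * lam J := mul_le_mul_of_nonneg_right (by exact_mod_cast hi) (lam_nonneg J)
      linarith
    cases j with
    | zero => simp only [ct]; rw [abs_of_nonneg (Wt_nonneg _ _ _)]; exact key 0 le_rfl
    | succ j =>
      simp only [ct]
      have a1 := key j (by omega)
      have a2 := key (j + 1) le_rfl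
      have b1 := Wt_nonneg s (xx N J j) n
      have b2 := Wt_nonneg s (xx N J (j + 1)) n
      rw [abs_le]; constructor <;> linarith

theorem ct_sum (s : ℤ) (N J j n : ℕ) : ∑ i ∈ range (j + 1), ct s N J i n = Wt s (xx N J j) n := by
  induction j with
  | zero => simp [ct]
  | succ j ih => rw [sum_range_succ, ih]; simp [ct]

theorem cc_bound (s : ℤ) (N J j : ℕ) (η : ℝ) (hN : 1 ≤ N) (n : ℕ) (hn : n ≠ 0) :
    |cc s N J η j n| ≤ 8 / max (n : ℝ) ((N : ℝ) ^ (al J j)) := by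
  have := ct_bound s N J j hN n hn
  rcases le_or_gt (n : ℝ) ((N : ℝ) ^ (al J j + lam J + η)) with h1 | h1
  · rw [cc_of_le h1]; exact this
  · rw [cc_of_lt h1, abs_zero]; exact (abs_nonneg _).trans this

theorem af_sum_apply {ι : Type*} (S : Finset ι) (F : ι → AF) (n : ℕ) : (∑ i ∈ S, F i) n = ∑ i ∈ S, F i n := by
  classical
  induction S using Finset.induction_on with
  | empty => simp
  | insert a S ha ih => rw [sum_insert ha, sum_insert ha, ArithmeticFunction.add_apply, ih]

theorem rr_bound (J : ℕ) (hJ : 1 ≤ J) (η : ℝ) (hη : 0 < η) : ∃ K : ℝ, 1 ≤ K ∧ ∀ (s : ℤ) (N n : ℕ), 1 ≤ N → n ≠ 0 →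
    |rr s N J η n| ≤ K / max (n : ℝ) ((N : ℝ) ^ (al J (J + 1))) := by
  obtain ⟨C, hC, h⟩ := ct_tail η hη
  refine ⟨8 + (J + 1) * C, by nlinarith, fun s N n hN hn => ?_⟩
  have hn0 : (0 : ℝ) < n := by exact_mod_cast Nat.pos_of_ne_zero hn
  have hn1 : (1 : ℝ) ≤ n := by exact_mod_cast Nat.pos_of_ne_zero hn
  have hN1 : (1 : ℝ) ≤ N := by exact_mod_cast hN
  have e : rr s N J η n = (1 / (n : ℝ) - Wt s (xx N J J) n) + ∑ j ∈ range (J + 1), (ct s N J j n - cc s N J η j n) := by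
    rw [sum_sub_distrib, ct_sum, ← af_sum_apply]
    unfold rr
    rw [sub_eq_add_neg bb, ArithmeticFunction.add_apply, ArithmeticFunction.neg_apply]
    have : bb n = 1 / (n : ℝ) := rfl
    rw [this]; ring
  have hx := one_le_xx N J J hN
  have hxN := xx_le N J J hN hJ le_rfl
  have e2 : (N : ℝ) ^ (al J (J + 1)) = xx N J J := rfl
  have hm0 : 0 < max (n : ℝ) (xx N J J) := lt_of_lt_of_le hn0 (le_max_left _ _)
  have h1 : |1 / (n : ℝ) - Wt s (xx N J J) n| ≤ 8 / max (n : ℝ) (xx N J J) := by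
    have a1 := Wt_le s (xx N J J) n
    have b1 := Wt_nonneg s (xx N J J) n
    have c1 := Wt_near s (xx N J J) (by linarith) n hn
    rw [abs_of_nonneg (by linarith)]
    rcases le_total (n : ℝ) (xx N J J) with h | h
    · rw [max_eq_right h]; exact c1
    · rw [max_eq_left h]
      have : 1 / (n : ℝ) ≤ 8 / n := by gcongr; norm_num
      linarith
  have h2 : ∀ j ∈ range (J + 1), |ct s N J j n - cc s N J η j n| ≤ C / max (n : ℝ) (xx N J J) := by
    intro j hj
    refine (h s N J j n hN hJ (by rw [mem_range] at hj; omega)).trans ?_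
    apply div_le_div_of_nonneg_left (by linarith) hm0
    have q1 : (1 : ℝ) ≤ (n : ℝ) ^ 2 := one_le_pow₀ hn1
    have q2 : (1 : ℝ) ≤ (N : ℝ) ^ 2 := one_le_pow₀ hN1
    apply max_le <;> nlinarith
  rw [e, e2]
  have h3 := (abs_sum_le_sum_abs _ _).trans (sum_le_card_nsmul _ _ _ h2)
  rw [card_range, nsmul_eq_mul] at h3
  refine (abs_add_le _ _).trans ((add_le_add h1 h3).trans (le_of_eq ?_))
  push_cast; ring

noncomputable def At (s : ℤ) (N J k : ℕ) : ℕ → ℝ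
  | 0 => Ax s k (xx N J 0)
  | j + 1 => Ax s k (xx N J (j + 1)) - Ax s k (xx N J j)

theorem At_sum (s : ℤ) (N J k j : ℕ) : ∑ i ∈ range (j + 1), At s N J k i = Ax s k (xx N J j) := by
  induction j with
  | zero => simp [At]
  | succ j ih => rw [sum_range_succ, ih]; simp [At]

theorem Ax_summable (s : ℤ) (k : ℕ) (x : ℝ) (hx : 0 < x) :
    Summable fun n : ℕ => (kro (s * k) (n + 1) : ℝ) * Wt s x (n + 1) := by
  obtain ⟨C, hC, hW⟩ := W_term_le
  refine Summable.of_norm_bounded ((summable_shift (a := 1) (by norm_num)).mul_left (C * x ^ 2)) fun n => ?_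
  have h1 := hW s n x hx
  have h2 : Wt s x (n + 1) = (1 / (n + 1 : ℝ)) * W s ((n + 1 : ℝ) ^ 2 / x ^ 2) := by unfold Wt; push_cast; rfl
  rw [← h2] at h1
  rw [Real.norm_eq_abs, abs_mul, abs_of_nonneg (Wt_nonneg _ _ _)]
  exact (mul_le_of_le_one_left (Wt_nonneg _ _ _) (abs_kro_le _ _)).trans h1

theorem Ax_tsum (s : ℤ) (k : ℕ) (x : ℝ) : Ax s k x = ∑' n : ℕ, (kro (s * k) (n + 1) : ℝ) * Wt s x (n + 1) := by
  unfold Ax Wt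
  push_cast
  rfl

theorem At_hasSum (s : ℤ) (N J k j : ℕ) (hN : 1 ≤ N) :
    HasSum (fun n : ℕ => (kro (s * k) (n + 1) : ℝ) * ct s N J j (n + 1)) (At s N J k j) := by
  have key : ∀ i, HasSum (fun n : ℕ => (kro (s * k) (n + 1) : ℝ) * Wt s (xx N J i) (n + 1)) (Ax s k (xx N J i)) := by
    intro i
    rw [Ax_tsum]
    exact (Ax_summable s k _ (by linarith [one_le_xx N J i hN])).hasSum
  cases j with
  | zero => exact key 0
  | succ j =>
    have := (key (j + 1)).sub (key j)
    have e : (fun n : ℕ => (kro (s * k) (n + 1) : ℝ) * ct s N J (j + 1) (n + 1)) =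
        fun n : ℕ => (kro (s * k) (n + 1) : ℝ) * Wt s (xx N J (j + 1)) (n + 1) -
          (kro (s * k) (n + 1) : ℝ) * Wt s (xx N J j) (n + 1) := by
      funext n; simp only [ct]; ring
    rw [e]
    exact this

theorem At_DA (η : ℝ) (hη : 0 < η) : ∃ C : ℝ, 1 ≤ C ∧ ∀ (s : ℤ) (N J j k L : ℕ), 1 ≤ N → 1 ≤ J → j ≤ J →
    (N : ℝ) ^ (al J j + lam J + η) ≤ L →
    |At s N J k j - DA L (cc s N J η j) (s * k)| ≤ C / (N : ℝ) ^ 2 := by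
  obtain ⟨C, hC, h⟩ := ct_tail η hη
  have hs : Summable fun n : ℕ => ((n + 1 : ℕ) : ℝ) ^ (-(2 * 1) : ℝ) := summable_shift (a := 1) (by norm_num)
  refine ⟨max 1 (C * ∑' n : ℕ, ((n + 1 : ℕ) : ℝ) ^ (-(2 * 1) : ℝ)), le_max_left _ _, fun s N J j k L hN hJ hj hL => ?_⟩
  have hN1 : (1 : ℝ) ≤ N := by exact_mod_cast hN
  have h1 : HasSum (fun n : ℕ => (kro (s * k) (n + 1) : ℝ) * cc s N J η j (n + 1)) (DA L (cc s N J η j) (s * k)) := by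
    have : DA L (cc s N J η j) (s * k) = ∑ n ∈ range L, (kro (s * k) (n + 1) : ℝ) * cc s N J η j (n + 1) := by
      unfold DA DP
      rw [sum_Icc_range]
      exact sum_congr rfl fun n _ => mul_comm _ _
    rw [this]
    apply hasSum_sum_of_ne_finset_zero
    intro n hn
    rw [cc_of_lt, mul_zero]
    refine lt_of_le_of_lt hL ?_
    rw [mem_range, not_lt] at hn
    exact_mod_cast Nat.lt_succ_of_le hn
  have h2 := (At_hasSum s N J k j hN).sub h1
  rw [← h2.tsum_eq]
  refine le_trans (b := C * (∑' n : ℕ, ((n + 1 : ℕ) : ℝ) ^ (-(2 * 1) : ℝ)) / (N : ℝ) ^ 2) ?_ (by gcongr; exact le_max_right _ _)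
  rw [mul_div_right_comm]
  rw [← Real.norm_eq_abs]
  refine tsum_of_norm_bounded (hs.hasSum.mul_left (C / (N : ℝ) ^ 2)) fun n => ?_
  rw [← mul_sub, Real.norm_eq_abs, abs_mul]
  refine (mul_le_of_le_one_left (abs_nonneg _) (abs_kro_le _ _)).trans ((h s N J j (n + 1) hN hJ hj).trans (le_of_eq ?_))
  rw [Real.rpow_neg (by positivity)]
  norm_num
  field_simp

end

section

open Finset

noncomputable def Fp (s : ℤ) (N J : ℕ) (η : ℝ) (j : ℕ) : AF := if j ≤ J then cc s N J η j else rr s N J η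

noncomputable def Vp (s : ℤ) (N J : ℕ) (η : ℝ) (L j k : ℕ) : ℝ :=
  if j ≤ J then DA L (cc s N J η j) (s * k) else Lr s k - ∑ i ∈ range (J + 1), DA L (cc s N J η i) (s * k)

theorem Fp_sum (s : ℤ) (N J : ℕ) (η : ℝ) : ∑ j ∈ range (J + 2), Fp s N J η j = bb := by
  rw [sum_range_succ]
  have : ∑ j ∈ range (J + 1), Fp s N J η j = ∑ j ∈ range (J + 1), cc s N J η j :=
    sum_congr rfl fun j hj => if_pos (by rw [mem_range] at hj; omega)
  rw [this]
  unfold Fp rr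
  rw [if_neg (by omega)]
  abel

theorem Vp_sum (s : ℤ) (N J : ℕ) (η : ℝ) (L k : ℕ) : ∑ j ∈ range (J + 2), Vp s N J η L j k = Lr s k := by
  rw [sum_range_succ]
  have : ∑ j ∈ range (J + 1), Vp s N J η L j k = ∑ j ∈ range (J + 1), DA L (cc s N J η j) (s * k) :=
    sum_congr rfl fun j hj => if_pos (by rw [mem_range] at hj; omega)
  rw [this]
  unfold Vp
  rw [if_neg (by omega)]
  ring

theorem Fp_bound (J : ℕ) (hJ : 1 ≤ J) (η : ℝ) (hη : 0 < η) : ∃ K : ℝ, 1 ≤ K ∧ ∀ (s : ℤ) (N j n : ℕ), 1 ≤ N → j ≤ J + 1 →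
    n ≠ 0 → |Fp s N J η j n| ≤ K / max (n : ℝ) ((N : ℝ) ^ (al J j)) := by
  obtain ⟨K, hK, h⟩ := rr_bound J hJ η hη
  refine ⟨max 8 K, le_max_of_le_right hK, fun s N j n hN hj hn => ?_⟩
  have hn0 : (0 : ℝ) < n := by exact_mod_cast Nat.pos_of_ne_zero hn
  have hm0 : 0 < max (n : ℝ) ((N : ℝ) ^ (al J j)) := lt_of_lt_of_le hn0 (le_max_left _ _)
  unfold Fp
  split_ifs with h1
  · exact (cc_bound s N J j η hN n hn).trans (div_le_div_of_nonneg_right (le_max_left _ _) hm0.le)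
  · have : j = J + 1 := by omega
    subst this
    exact (h s N n hN hn).trans (div_le_div_of_nonneg_right (le_max_right _ _) hm0.le)

theorem FD_card (s : ℤ) (N : ℕ) : ((#(FD s N) : ℕ) : ℝ) ≤ N := by
  have : FD s N ⊆ Icc 1 N := fun k hk => by
    rw [mem_Icc]; exact (mem_FD.mp hk).1
  have h := card_le_card this
  rw [Nat.card_Icc] at h
  exact_mod_cast h

theorem Vp_eq (s : ℤ) (N J : ℕ) (η : ℝ) (L k j : ℕ) (hj : j ≤ J) :
    Vp s N J η L j k = DA L (Fp s N J η j) (s * k) := by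
  unfold Vp Fp; rw [if_pos hj, if_pos hj]

theorem L_ge (t J N j : ℕ) (η : ℝ) (ht : 1 ≤ t) (hJ : 1 ≤ J) (hN : 1 ≤ N) (hj : j ≤ J) (hη1 : η < 1 / 8) :
    (N : ℝ) ^ (al J j + lam J + η) ≤ ((N ^ (3 * t) : ℕ) : ℝ) := by
  push_cast
  rw [← Real.rpow_natCast]
  apply Real.rpow_le_rpow_of_exponent_le (by exact_mod_cast hN)
  have h1 := al_le J j hJ (by omega)
  have h2 := j_lam_le J 1 hJ hJ
  have h3 : (1 : ℝ) ≤ t := by exact_mod_cast ht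
  push_cast at h2 ⊢
  linarith

theorem Vp_last (η : ℝ) (hη : 0 < η) (hη1 : η < 1 / 8) (J t : ℕ) (hJ : 1 ≤ J) (ht : 1 ≤ t) : ∃ C : ℝ, 1 ≤ C ∧
    ∀ (s : ℤ) (N k : ℕ), 1 ≤ N →
    |Vp s N J η (N ^ (3 * t)) (J + 1) k - Bx s k (xx N J J)| ≤ C / (N : ℝ) ^ 2 := by
  obtain ⟨C, hC, h⟩ := At_DA η hη
  refine ⟨(J + 1) * C, by nlinarith, fun s N k hN => ?_⟩
  have e : Vp s N J η (N ^ (3 * t)) (J + 1) k - Bx s k (xx N J J) =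
      ∑ j ∈ range (J + 1), (At s N J k j - DA (N ^ (3 * t)) (cc s N J η j) (s * k)) := by
    rw [sum_sub_distrib, At_sum]
    unfold Vp Bx
    rw [if_neg (by omega)]
    ring
  rw [e]
  have h3 := (abs_sum_le_sum_abs _ _).trans (sum_le_card_nsmul (range (J + 1))
    (fun j => |At s N J k j - DA (N ^ (3 * t)) (cc s N J η j) (s * k)|) (C / (N : ℝ) ^ 2) fun j hj =>
    h s N J j k _ hN hJ (by rw [mem_range] at hj; omega) (L_ge t J N j η ht hJ hN (by rw [mem_range] at hj; omega) hη1))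
  rw [card_range, nsmul_eq_mul] at h3
  refine h3.trans (le_of_eq ?_)
  push_cast; ring

theorem xx_sq (N J i : ℕ) (hN : 1 ≤ N) (h : 1 / 2 ≤ (i : ℝ) * lam J) : (N : ℝ) ≤ xx N J i ^ 2 := by
  have hN1 : (1 : ℝ) ≤ N := by exact_mod_cast hN
  unfold xx
  rw [← Real.rpow_natCast, ← Real.rpow_mul (by linarith)]
  calc (N : ℝ) = (N : ℝ) ^ (1 : ℝ) := (Real.rpow_one _).symm
    _ ≤ _ := by
      apply Real.rpow_le_rpow_of_exponent_le hN1
      push_cast; linarith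

theorem Vp_point (η : ℝ) (hη : 0 < η) (hη1 : η < 1 / 8) (J t : ℕ) (hJ : 1 ≤ J) (ht : 1 ≤ t) : ∃ K : ℝ, 1 ≤ K ∧
    ∀ (s : ℤ) (N j k : ℕ), 1 ≤ N → j ≤ J + 1 → k ∈ FD s N → FEP s k →
    |Vp s N J η (N ^ (3 * t)) j k| ≤ K * (N : ℝ) ^ (3 * t * η) := by
  obtain ⟨C, hC, h⟩ := Vp_last η hη hη1 J t hJ ht
  obtain ⟨C2, hC2, h2⟩ := Bx_point η hη (by linarith)
  obtain ⟨C3, hC3, h3⟩ := sum_inv_le η hη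
  refine ⟨C + C2 + 8 * C3, by linarith, fun s N j k hN hj hk hF => ?_⟩
  have hN1 : (1 : ℝ) ≤ N := by exact_mod_cast hN
  have ht1 : (1 : ℝ) ≤ t := by exact_mod_cast ht
  have hp : (1 : ℝ) ≤ (N : ℝ) ^ (3 * t * η) := Real.one_le_rpow hN1 (by positivity)
  by_cases hjJ : j ≤ J
  · unfold Vp
    rw [if_pos hjJ]
    unfold DA DP
    have h4 := h3 (N ^ (3 * t)) (Icc 1 (N ^ (3 * t))) (fun n hn => mem_Icc.mp hn)
    have h5 : (((N ^ (3 * t) : ℕ) : ℝ)) ^ η = (N : ℝ) ^ (3 * t * η) := by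
      push_cast
      rw [← Real.rpow_natCast, ← Real.rpow_mul (by linarith)]
      push_cast; rfl
    rw [h5] at h4
    have h6 : ∀ n ∈ Icc 1 (N ^ (3 * t)), |cc s N J η j n * (kro (s * k) n : ℝ)| ≤ 8 * (1 / (n : ℝ)) := by
      intro n hn
      have hn1 := (mem_Icc.mp hn).1
      have hn0 : (0 : ℝ) < n := by exact_mod_cast hn1
      rw [abs_mul]
      refine (mul_le_of_le_one_right (abs_nonneg _) (abs_kro_le _ _)).trans ((cc_bound s N J j η hN n (by omega)).trans ?_)
      rw [mul_one_div]
      exact div_le_div_of_nonneg_left (by norm_num) hn0 (le_max_left _ _)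
    refine (abs_sum_le_sum_abs _ _).trans ((sum_le_sum h6).trans ?_)
    rw [← mul_sum]
    nlinarith
  · have : j = J + 1 := by omega
    subst this
    have a1 := h s N k hN
    have hkm := (mem_FD.mp hk).1
    have a2 := h2 s k N (xx N J J) (by omega) hkm.2 (xx_sq N J J hN (by rw [J_lam J hJ]; norm_num)) (one_le_xx N J J hN) hF
    have a3 : (N : ℝ) ^ (2 * η) ≤ (N : ℝ) ^ (3 * t * η) := by
      apply Real.rpow_le_rpow_of_exponent_le hN1
      nlinarith
    have a4 : C / (N : ℝ) ^ 2 ≤ C := div_le_self (by linarith) (one_le_pow₀ hN1)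
    have a5 := abs_sub_abs_le_abs_sub (Vp s N J η (N ^ (3 * t)) (J + 1) k) (Bx s k (xx N J J))
    nlinarith

theorem Vp_ms (η : ℝ) (hη : 0 < η) (hη1 : η < 1 / 8) (J t : ℕ) (hJ : 1 ≤ J) (ht : 1 ≤ t) : ∃ K : ℝ, 1 ≤ K ∧
    ∀ (s : ℤ) (N j : ℕ), (s = 1 ∨ s = -1) → 1 ≤ N → j ≤ J + 1 → (∀ k ∈ FD s N, FEP s k) → 1 / 2 ≤ al J j →
    ∑ k ∈ FD s N, (Vp s N J η (N ^ (3 * t)) j k) ^ 2 ≤ K * (N : ℝ) ^ (1 - al J j + 2 * η) := by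
  obtain ⟨C, hC, h⟩ := Vp_last η hη hη1 J t hJ ht
  obtain ⟨C1, hC1, h1⟩ := At_DA η hη
  obtain ⟨C2, hC2, h2⟩ := Bx_ms η hη (by linarith)
  refine ⟨6 * C2 + 3 * C ^ 2 + 3 * C1 ^ 2, by nlinarith, fun s N j hs hN hj hF hal => ?_⟩
  have hN1 : (1 : ℝ) ≤ N := by exact_mod_cast hN
  have hN0 : (0 : ℝ) < N := by linarith
  cases j with
  | zero => simp only [al] at hal; norm_num at hal
  | succ i =>
    have hal' : 1 / 2 ≤ (i : ℝ) * lam J := hal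
    have hB : ∀ l, i ≤ l → l ≤ J → ∑ k ∈ FD s N, (Bx s k (xx N J l)) ^ 2 ≤ C2 * (N : ℝ) ^ (1 - al J (i + 1) + 2 * η) := by
      intro l hl hlJ
      have hil : (i : ℝ) * lam J ≤ l * lam J := mul_le_mul_of_nonneg_right (by exact_mod_cast hl) (lam_nonneg J)
      refine (h2 s N (xx N J l) hs hN (xx_sq N J l hN (hal'.trans hil)) (by linarith [one_le_xx N J l hN])
        (xx_le N J l hN hJ hlJ) hF).trans ?_
      apply mul_le_mul_of_nonneg_left _ (by linarith)
      unfold xx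
      rw [← Real.rpow_sub hN0]
      apply Real.rpow_le_rpow_of_exponent_le hN1
      simp only [al]
      linarith
    have hcst : ∀ (D : ℝ), ∑ k ∈ FD s N, (D / (N : ℝ) ^ 2) ^ 2 ≤ D ^ 2 * (N : ℝ) ^ (1 - al J (i + 1) + 2 * η) := by
      intro D
      rw [sum_const, nsmul_eq_mul]
      have q1 : (1 : ℝ) ≤ (N : ℝ) ^ (1 - al J (i + 1) + 2 * η) :=
        Real.one_le_rpow hN1 (by linarith [al_le J (i + 1) hJ hj])
      have q2 := FD_card s N
      have q3 : (D / (N : ℝ) ^ 2) ^ 2 ≤ D ^ 2 / N := by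
        rw [div_pow, ← pow_mul]
        apply div_le_div_of_nonneg_left (by positivity) hN0
        exact le_self_pow₀ hN1 (by norm_num)
      calc (#(FD s N) : ℝ) * (D / (N : ℝ) ^ 2) ^ 2 ≤ N * (D ^ 2 / N) :=
            mul_le_mul q2 q3 (by positivity) hN0.le
        _ = D ^ 2 * 1 := by field_simp
        _ ≤ _ := mul_le_mul_of_nonneg_left q1 (by positivity)
    set P := (N : ℝ) ^ (1 - al J (i + 1) + 2 * η)
    have hP : 0 ≤ P := by positivity
    by_cases hij : i + 1 ≤ J
    · have key : ∀ k ∈ FD s N, (Vp s N J η (N ^ (3 * t)) (i + 1) k) ^ 2 ≤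
          3 * (Bx s k (xx N J i)) ^ 2 + 3 * (Bx s k (xx N J (i + 1))) ^ 2 + 3 * (C1 / (N : ℝ) ^ 2) ^ 2 := by
        intro k hk
        have a1 := h1 s N J (i + 1) k _ hN hJ hij (L_ge t J N (i + 1) η ht hJ hN hij hη1)
        have a2 : Vp s N J η (N ^ (3 * t)) (i + 1) k = Bx s k (xx N J i) - Bx s k (xx N J (i + 1)) -
            (At s N J k (i + 1) - DA (N ^ (3 * t)) (cc s N J η (i + 1)) (s * k)) := by
          unfold Vp
          rw [if_pos hij]
          simp only [At, Bx]; ring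
        have a3 := sq_le_sq' (by linarith [(abs_le.mp a1).1]) (abs_le.mp a1).2
        rw [a2]
        set u := Bx s k (xx N J i)
        set v := Bx s k (xx N J (i + 1))
        set w := At s N J k (i + 1) - DA (N ^ (3 * t)) (cc s N J η (i + 1)) (s * k)
        nlinarith [sq_nonneg (u + v), sq_nonneg (u + w), sq_nonneg (v - w)]
      refine (sum_le_sum key).trans ?_
      rw [sum_add_distrib, sum_add_distrib, ← mul_sum, ← mul_sum, ← mul_sum]
      have b1 := hB i le_rfl (by omega)
      have b2 := hB (i + 1) (by omega) hij
      have b3 := hcst C1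
      have b4 : 0 ≤ C ^ 2 * P := by positivity
      linarith
    · have : i = J := by omega
      subst this
      have key : ∀ k ∈ FD s N, (Vp s N i η (N ^ (3 * t)) (i + 1) k) ^ 2 ≤
          3 * (Bx s k (xx N i i)) ^ 2 + 3 * (C / (N : ℝ) ^ 2) ^ 2 := by
        intro k hk
        have a1 := h s N k hN
        have a3 := sq_le_sq' (by linarith [(abs_le.mp a1).1]) (abs_le.mp a1).2
        set u := Bx s k (xx N i i)
        set v := Vp s N i η (N ^ (3 * t)) (i + 1) k
        nlinarith [sq_nonneg (v - 2 * u)]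
      refine (sum_le_sum key).trans ?_
      rw [sum_add_distrib, ← mul_sum, ← mul_sum]
      have b1 := hB i le_rfl le_rfl
      have b3 := hcst C
      have b4 : 0 ≤ C1 ^ 2 * P := by positivity
      have b5 : 0 ≤ C2 * P := by positivity
      linarith

end

section

open Finset

noncomputable def Mn (F : AF) : ℝ := ∑' n : ℕ, F n * GG n

open Classical in
theorem sq_summable (δ : ℝ) (hδ : 0 < δ) :
    Summable fun n : ℕ => if IsSquare n then (n : ℝ) ^ (-(1 / 2) - δ) else 0 := by
  have hi : Function.Injective fun m : ℕ => m * m := fun a b h => Nat.mul_self_inj.mp h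
  rw [← hi.summable_iff]
  · have := summable_eta (2 * δ) (by linarith)
    refine this.congr fun m => ?_
    simp only [Function.comp_apply]
    rw [if_pos ⟨m, rfl⟩]
    push_cast
    rw [← sq, ← Real.rpow_natCast, ← Real.rpow_mul (Nat.cast_nonneg _)]
    congr 1; push_cast; ring
  · intro n hn
    rw [if_neg]
    rintro ⟨m, rfl⟩
    exact hn ⟨m, rfl⟩

theorem GG_abs_le (n : ℕ) : 0 ≤ GG n ∧ GG n ≤ 1 := by
  unfold GG
  split_ifs
  · exact ⟨gg_nonneg n, gg_le_one n⟩
  · exact ⟨le_rfl, zero_le_one⟩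

open Classical in
theorem Mn_term (δ : ℝ) (hδ : 0 < δ) (hδ1 : δ < 1 / 4) (F : AF) (K H : ℝ) (hK : 0 ≤ K) (hH : 1 ≤ H)
    (hF : ∀ n : ℕ, n ≠ 0 → |F n| ≤ K * (n : ℝ) ^ δ / max (n : ℝ) H) (n : ℕ) :
    ‖F n * GG n‖ ≤ (K * H ^ (-(1 / 2 - 2 * δ))) * (if IsSquare n then (n : ℝ) ^ (-(1 / 2) - δ) else 0) := by
  by_cases hn : n = 0
  · subst hn
    simp only [ArithmeticFunction.map_zero, zero_mul, norm_zero]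
    positivity
  have hn0 : (0 : ℝ) < n := by exact_mod_cast Nat.pos_of_ne_zero hn
  by_cases hsq : IsSquare n
  · rw [if_pos hsq, Real.norm_eq_abs, abs_mul, abs_of_nonneg (GG_abs_le n).1]
    refine (mul_le_of_le_one_right (abs_nonneg _) (GG_abs_le n).2).trans ((hF n hn).trans ?_)
    have hm0 : 0 < max (n : ℝ) H := lt_of_lt_of_le hn0 (le_max_left _ _)
    have h1 : (n : ℝ) ^ (1 / 2 + 2 * δ) * H ^ (1 / 2 - 2 * δ) ≤ max (n : ℝ) H := by
      calc (n : ℝ) ^ (1 / 2 + 2 * δ) * H ^ (1 / 2 - 2 * δ) ≤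
            (max (n : ℝ) H) ^ (1 / 2 + 2 * δ) * (max (n : ℝ) H) ^ (1 / 2 - 2 * δ) := by
            apply mul_le_mul
            · exact Real.rpow_le_rpow hn0.le (le_max_left _ _) (by linarith)
            · exact Real.rpow_le_rpow (by linarith) (le_max_right _ _) (by linarith)
            · positivity
            · positivity
        _ = max (n : ℝ) H := by rw [← Real.rpow_add hm0]; norm_num
    calc K * (n : ℝ) ^ δ / max (n : ℝ) H ≤ K * (n : ℝ) ^ δ / ((n : ℝ) ^ (1 / 2 + 2 * δ) * H ^ (1 / 2 - 2 * δ)) :=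
          div_le_div_of_nonneg_left (by positivity) (by positivity) h1
      _ = _ := by
          have e1 : (n : ℝ) ^ (-(1 / 2) - δ) = (n : ℝ) ^ δ / (n : ℝ) ^ (1 / 2 + 2 * δ) := by
            rw [← Real.rpow_sub hn0]; congr 1; ring
          rw [e1, Real.rpow_neg (by linarith)]
          field_simp
  · rw [if_neg hsq]
    have : GG n = 0 := by unfold GG; rw [if_neg hsq]
    rw [this]; simp

theorem Mn_summable (δ : ℝ) (hδ : 0 < δ) (hδ1 : δ < 1 / 4) (F : AF) (K H : ℝ) (hK : 0 ≤ K) (hH : 1 ≤ H)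
    (hF : ∀ n : ℕ, n ≠ 0 → |F n| ≤ K * (n : ℝ) ^ δ / max (n : ℝ) H) : Summable fun n : ℕ => F n * GG n :=
  Summable.of_norm_bounded ((sq_summable δ hδ).mul_left _) (Mn_term δ hδ hδ1 F K H hK hH hF)

theorem Mn_bound (δ : ℝ) (hδ : 0 < δ) (hδ1 : δ < 1 / 4) : ∃ C : ℝ, 1 ≤ C ∧ ∀ (F : AF) (K H : ℝ), 0 ≤ K → 1 ≤ H →
    (∀ n : ℕ, n ≠ 0 → |F n| ≤ K * (n : ℝ) ^ δ / max (n : ℝ) H) → |Mn F| ≤ C * K * H ^ (-(1 / 2 - 2 * δ)) := by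
  classical
  refine ⟨max 1 (∑' n : ℕ, if IsSquare n then (n : ℝ) ^ (-(1 / 2) - δ) else 0), le_max_left _ _, fun F K H hK hH hF => ?_⟩
  have h := tsum_of_norm_bounded ((sq_summable δ hδ).hasSum.mul_left (K * H ^ (-(1 / 2 - 2 * δ)))) (Mn_term δ hδ hδ1 F K H hK hH hF)
  rw [Real.norm_eq_abs] at h
  have h2 : 0 ≤ K * H ^ (-(1 / 2 - 2 * δ)) := by positivity
  refine h.trans ((mul_le_mul_of_nonneg_left (le_max_right 1 _) h2).trans (le_of_eq ?_))
  ring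

theorem tup_bound (η : ℝ) (hη : 0 < η) (J t : ℕ) (hJ : 1 ≤ J) (ht : 1 ≤ t) : ∃ K : ℝ, 1 ≤ K ∧
    ∀ (s : ℤ) (N : ℕ) (j : Fin t → ℕ) (S : Finset (Fin t)) (n : ℕ), 1 ≤ N → (∀ i, j i ≤ J + 1) → n ≠ 0 →
    |(∏ i ∈ S, Fp s N J η (j i)) n| ≤ K * (n : ℝ) ^ η / max (n : ℝ) ((N : ℝ) ^ (∑ i ∈ S, al J (j i))) := by
  obtain ⟨K, hK, h⟩ := Fp_bound J hJ η hη
  have ht0 : (0 : ℝ) < t := by exact_mod_cast ht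
  obtain ⟨C, hC, hd⟩ := divisor_bound (η / t) (by positivity)
  refine ⟨K ^ t * C ^ t, one_le_mul_of_one_le_of_one_le (one_le_pow₀ hK) (one_le_pow₀ hC), fun s N j S n hN hj hn => ?_⟩
  have hN0 : (0 : ℝ) < N := by exact_mod_cast hN
  have hn0 : (0 : ℝ) < n := by exact_mod_cast Nat.pos_of_ne_zero hn
  have h1 := conv_bound S (fun i => Fp s N J η (j i)) (fun i => (N : ℝ) ^ (al J (j i))) K (by linarith)
    (fun i _ => by positivity) (fun i _ m hm => h s N (j i) m hN (hj i) hm) n hn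
  rw [← Real.rpow_sum_of_pos hN0] at h1
  refine h1.trans ?_
  have hm0 : 0 < max (n : ℝ) ((N : ℝ) ^ (∑ i ∈ S, al J (j i))) := lt_of_lt_of_le hn0 (le_max_left _ _)
  apply div_le_div_of_nonneg_right _ hm0.le
  have hS : #S ≤ t := by simpa using card_le_univ S
  have hc1 : (1 : ℝ) ≤ n.divisors.card := by
    exact_mod_cast card_pos.mpr ⟨1, Nat.one_mem_divisors.mpr hn⟩
  have q1 : K ^ #S ≤ K ^ t := pow_le_pow_right₀ hK hS
  have q2 : (n.divisors.card : ℝ) ^ #S ≤ C ^ t * (n : ℝ) ^ η := by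
    calc (n.divisors.card : ℝ) ^ #S ≤ (n.divisors.card : ℝ) ^ t := pow_le_pow_right₀ hc1 hS
      _ ≤ (C * (n : ℝ) ^ (η / t)) ^ t := pow_le_pow_left₀ (by linarith) (hd n hn) _
      _ = C ^ t * (n : ℝ) ^ η := by
          rw [mul_pow, ← Real.rpow_natCast (_ ^ _), ← Real.rpow_mul hn0.le, div_mul_cancel₀ _ ht0.ne']
  rw [mul_assoc]
  exact mul_le_mul q1 q2 (by positivity) (by positivity)

theorem tup_supp (η : ℝ) (hη : 0 < η) (s : ℤ) (N J t : ℕ) (hN : 1 ≤ N) (j : Fin t → ℕ) (S : Finset (Fin t))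
    (hj : ∀ i ∈ S, j i ≤ J) (n : ℕ) (hn : (N : ℝ) ^ (∑ i ∈ S, al J (j i) + t * (lam J + η)) < n) :
    (∏ i ∈ S, Fp s N J η (j i)) n = 0 := by
  have hN0 : (0 : ℝ) < N := by exact_mod_cast hN
  have hN1 : (1 : ℝ) ≤ N := by exact_mod_cast hN
  apply conv_supp S (fun i => Fp s N J η (j i)) (fun i => (N : ℝ) ^ (al J (j i) + lam J + η))
    (fun i _ => by positivity)
  · intro i hi m hm
    unfold Fp
    rw [if_pos (hj i hi)]
    exact cc_of_lt hm
  · refine lt_of_le_of_lt ?_ hn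
    rw [← Real.rpow_sum_of_pos hN0]
    apply Real.rpow_le_rpow_of_exponent_le hN1
    simp only [add_assoc]
    rw [sum_add_distrib, sum_const, nsmul_eq_mul]
    have hS : (#S : ℝ) ≤ t := by
      have : #S ≤ t := by simpa using card_le_univ S
      exact_mod_cast this
    have : (#S : ℝ) * (lam J + η) ≤ t * (lam J + η) := mul_le_mul_of_nonneg_right hS (by linarith [lam_nonneg J])
    linarith

theorem tup_al (J t : ℕ) (hJ : 1 ≤ J) (j : Fin t → ℕ) (hj : ∀ i, j i ≤ J + 1) (S : Finset (Fin t)) :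
    0 ≤ ∑ i ∈ S, al J (j i) ∧ ∑ i ∈ S, al J (j i) ≤ 2 / 3 * t := by
  refine ⟨sum_nonneg fun i _ => al_nonneg J _, ?_⟩
  have h := sum_le_card_nsmul S (fun i => al J (j i)) (2 / 3) fun i _ => al_le J (j i) hJ (hj i)
  have hS : (#S : ℝ) ≤ t := by
    have : #S ≤ t := by simpa using card_le_univ S
    exact_mod_cast this
  rw [nsmul_eq_mul] at h
  linarith

theorem tup_DA (η : ℝ) (hη : 0 < η) (hη1 : η < 1 / 8) (s : ℤ) (N J t k : ℕ) (hN : 1 ≤ N) (hJ : 1 ≤ J) (ht : 1 ≤ t)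
    (j : Fin t → ℕ) (S : Finset (Fin t))
    (hj : ∀ i ∈ S, j i ≤ J) :
    ∏ i ∈ S, Vp s N J η (N ^ (3 * t)) (j i) k = DA (N ^ (3 * t)) (∏ i ∈ S, Fp s N J η (j i)) (s * k) := by
  have hN0 : (0 : ℝ) < N := by exact_mod_cast hN
  have hN1 : (1 : ℝ) ≤ N := by exact_mod_cast hN
  rw [DP_prod S (fun i => Fp s N J η (j i)) (fun i => (N : ℝ) ^ (3 : ℝ))]
  · exact prod_congr rfl fun i hi => Vp_eq s N J η _ k (j i) (hj i hi)
  · exact fun i _ => Real.one_le_rpow hN1 (by norm_num)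
  · intro i hi n hn
    unfold Fp
    rw [if_pos (hj i hi)]
    apply cc_of_lt
    refine lt_of_le_of_lt ?_ hn
    apply Real.rpow_le_rpow_of_exponent_le hN1
    have h1 := al_le J (j i) hJ (by have := hj i hi; omega)
    have h2 := j_lam_le J 1 hJ hJ
    push_cast at h2
    linarith
  · rw [prod_const]
    push_cast
    have hS : #S ≤ t := by simpa using card_le_univ S
    rw [pow_mul]
    norm_cast
    exact Nat.pow_le_pow_right (Nat.pos_of_ne_zero (by positivity)) hS

theorem tup_wsum (η : ℝ) (hη : 0 < η) (J t : ℕ) (hJ : 1 ≤ J) (ht : 1 ≤ t) : ∃ K : ℝ, 1 ≤ K ∧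
    ∀ (s : ℤ) (N : ℕ) (j : Fin t → ℕ) (S : Finset (Fin t)) (β : ℝ) (L : ℕ), 1 ≤ N → (∀ i, j i ≤ J + 1) →
    (∀ i ∈ S, j i ≤ J) → 0 ≤ β →
    ∑ n ∈ Icc 1 L, |(∏ i ∈ S, Fp s N J η (j i)) n| * (n : ℝ) ^ β ≤
      K * (N : ℝ) ^ ((∑ i ∈ S, al J (j i) + t * (lam J + η)) * (β + 2 * η)) := by
  obtain ⟨K, hK, h⟩ := tup_bound η hη J t hJ ht
  have hs := summable_eta η hη
  refine ⟨K * max 1 (∑' n : ℕ, (n : ℝ) ^ (-1 - η)), one_le_mul_of_one_le_of_one_le hK (le_max_left _ _),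
    fun s N j S β L hN hj hjS hβ => ?_⟩
  have hN0 : (0 : ℝ) < N := by exact_mod_cast hN
  set E := ∑ i ∈ S, al J (j i) + t * (lam J + η)
  have key : ∀ n ∈ Icc 1 L, |(∏ i ∈ S, Fp s N J η (j i)) n| * (n : ℝ) ^ β ≤
      K * (N : ℝ) ^ (E * (β + 2 * η)) * (n : ℝ) ^ (-1 - η) := by
    intro n hn
    have hn1 := (mem_Icc.mp hn).1
    have hn0 : (0 : ℝ) < n := by exact_mod_cast hn1
    by_cases hM : (N : ℝ) ^ E < n
    · rw [tup_supp η hη s N J t hN j S hjS n hM, abs_zero, zero_mul]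
      positivity
    · push Not at hM
      have h1 := h s N j S n hN hj (by omega)
      have h2 : K * (n : ℝ) ^ η / max (n : ℝ) ((N : ℝ) ^ (∑ i ∈ S, al J (j i))) ≤ K * (n : ℝ) ^ η / n :=
        div_le_div_of_nonneg_left (by positivity) hn0 (le_max_left _ _)
      have h3 : (n : ℝ) ^ (β + 2 * η) ≤ (N : ℝ) ^ (E * (β + 2 * η)) := by
        rw [Real.rpow_mul hN0.le]
        exact Real.rpow_le_rpow hn0.le hM (by linarith)
      calc |(∏ i ∈ S, Fp s N J η (j i)) n| * (n : ℝ) ^ β ≤ (K * (n : ℝ) ^ η / n) * (n : ℝ) ^ β :=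
            mul_le_mul_of_nonneg_right (h1.trans h2) (by positivity)
        _ = K * (n : ℝ) ^ (β + 2 * η) * (n : ℝ) ^ (-1 - η) := by
            rw [mul_assoc K, ← Real.rpow_add hn0]
            have : (n : ℝ) ^ (β + 2 * η + (-1 - η)) = (n : ℝ) ^ η * (n : ℝ) ^ β / n := by
              rw [← Real.rpow_add hn0]
              conv_rhs => rw [← Real.rpow_one (n : ℝ), ← Real.rpow_mul hn0.le, ← Real.rpow_sub hn0]
              congr 1; ring
            rw [this]; ring
        _ ≤ _ := by
            apply mul_le_mul_of_nonneg_right _ (by positivity)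
            exact mul_le_mul_of_nonneg_left h3 (by linarith)
  refine (sum_le_sum key).trans ?_
  rw [← mul_sum]
  have h5 : ∑ n ∈ Icc 1 L, (n : ℝ) ^ (-1 - η) ≤ max 1 (∑' n : ℕ, (n : ℝ) ^ (-1 - η)) :=
    (hs.sum_le_tsum _ fun n _ => by positivity).trans (le_max_right _ _)
  refine (mul_le_mul_of_nonneg_left h5 (by positivity)).trans (le_of_eq ?_)
  ring

end

section

open Finset

theorem tup_ms (η : ℝ) (hη : 0 < η) (hη1 : η < 1 / 8) (J t : ℕ) (hJ : 1 ≤ J) (ht : 1 ≤ t) (hl : lam J ≤ η) :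
    ∃ K : ℝ, 1 ≤ K ∧ ∀ (s : ℤ) (N : ℕ) (j : Fin t → ℕ) (S : Finset (Fin t)), (s = 1 ∨ s = -1) → 1 ≤ N →
    (∀ i, j i ≤ J + 1) → (∀ i ∈ S, j i ≤ J) →
    ∑ k ∈ FD s N, (∏ i ∈ S, Vp s N J η (N ^ (3 * t)) (j i) k) ^ 2 ≤
      K * (N : ℝ) ^ (max (1 - ∑ i ∈ S, al J (j i)) (∑ i ∈ S, al J (j i)) + 9 * t * η) := by
  obtain ⟨K, hK, hb⟩ := tup_bound η hη J t hJ ht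
  obtain ⟨K2, hK2, hw⟩ := tup_wsum η hη J t hJ ht
  obtain ⟨C, hC, hm⟩ := ms_item η hη (by linarith)
  refine ⟨C * (K ^ 2 + K2 ^ 2), ?_, fun s N j S hs hN hj hjS => ?_⟩
  · have : 1 ≤ K ^ 2 := one_le_pow₀ hK
    nlinarith [sq_nonneg K2]
  have hN0 : (0 : ℝ) < N := by exact_mod_cast hN
  have hN1 : (1 : ℝ) ≤ N := by exact_mod_cast hN
  have ht1 : (1 : ℝ) ≤ t := by exact_mod_cast ht
  obtain ⟨θ0, θ1⟩ := tup_al J t hJ j hj S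
  have hw1 := hw s N j S (1 / 2 + η) (N ^ (3 * t)) hN hj hjS (by linarith)
  have hm1 := hm s N (Icc 1 (N ^ (3 * t))) (fun n => (∏ i ∈ S, Fp s N J η (j i)) n) (K * (N : ℝ) ^ (3 * t * η))
    ((N : ℝ) ^ (∑ i ∈ S, al J (j i))) hs hN (fun n hn => by have := (mem_Icc.mp hn).1; omega) (by positivity) (by positivity) ?_
  · set θ := ∑ i ∈ S, al J (j i)
    have e1 : ∑ k ∈ FD s N, (∏ i ∈ S, Vp s N J η (N ^ (3 * t)) (j i) k) ^ 2 =
        ∑ k ∈ FD s N, (DP (Icc 1 (N ^ (3 * t))) (fun n => (∏ i ∈ S, Fp s N J η (j i)) n) (s * k)) ^ 2 := by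
      apply sum_congr rfl
      intro k _
      rw [tup_DA η hη hη1 s N J t k hN hJ ht j S hjS]
      rfl
    rw [e1]
    refine hm1.trans ?_
    rw [mul_assoc C]
    apply mul_le_mul_of_nonneg_left _ (by linarith)
    rw [add_mul]
    set P := (N : ℝ) ^ (max (1 - θ) θ + 9 * t * η)
    have hte : 0 < t * η := by positivity
    apply add_le_add
    · have : (N : ℝ) * (K * (N : ℝ) ^ (3 * t * η)) ^ 2 * ((N : ℝ) ^ θ) ^ (4 * η - 1) =
          K ^ 2 * (N : ℝ) ^ (1 + 3 * t * η * 2 + θ * (4 * η - 1)) := by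
        rw [mul_pow, ← Real.rpow_natCast ((N : ℝ) ^ (3 * t * η)), ← Real.rpow_mul hN0.le, ← Real.rpow_mul hN0.le, Real.rpow_add hN0,
          Real.rpow_add hN0, Real.rpow_one]
        push_cast; ring
      rw [this]
      apply mul_le_mul_of_nonneg_left _ (by positivity)
      apply Real.rpow_le_rpow_of_exponent_le hN1
      have := le_max_left (1 - θ) θ
      nlinarith
    · have h0 : 0 ≤ ∑ n ∈ Icc 1 (N ^ (3 * t)), |(∏ i ∈ S, Fp s N J η (j i)) n| * (n : ℝ) ^ (1 / 2 + η) :=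
        sum_nonneg fun n _ => by positivity
      refine (pow_le_pow_left₀ h0 hw1 2).trans ?_
      rw [mul_pow, ← Real.rpow_natCast ((N : ℝ) ^ _), ← Real.rpow_mul hN0.le]
      apply mul_le_mul_of_nonneg_left _ (by positivity)
      apply Real.rpow_le_rpow_of_exponent_le hN1
      have := le_max_right (1 - θ) θ
      push_cast
      have e2 : (θ + t * (lam J + η)) * (1 / 2 + η + 2 * η) * 2 = (θ + t * (lam J + η)) * (1 + 6 * η) := by ring
      rw [e2]
      have e3 : θ + t * (lam J + η) ≤ θ + 2 * (t * η) := by nlinarith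
      have e4 : (θ + t * (lam J + η)) * (1 + 6 * η) ≤ (θ + 2 * (t * η)) * (1 + 6 * η) :=
        mul_le_mul_of_nonneg_right e3 (by linarith)
      have e5 : θ * η ≤ 2 / 3 * t * η := mul_le_mul_of_nonneg_right θ1 hη.le
      have e6 : (t * η) * η ≤ (t * η) * (1 / 8) := mul_le_mul_of_nonneg_left hη1.le hte.le
      nlinarith
  · intro n hn
    have hn1 := (mem_Icc.mp hn)
    have hn0 : (0 : ℝ) < n := by exact_mod_cast hn1.1
    refine (hb s N j S n hN hj (by omega)).trans ?_
    have hm0 : 0 < max (n : ℝ) ((N : ℝ) ^ (∑ i ∈ S, al J (j i))) := lt_of_lt_of_le hn0 (le_max_left _ _)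
    apply div_le_div_of_nonneg_right _ hm0.le
    apply mul_le_mul_of_nonneg_left _ (by linarith)
    have : (n : ℝ) ≤ (N : ℝ) ^ (3 * t : ℝ) := by
      have := hn1.2
      have h2 : (n : ℝ) ≤ ((N ^ (3 * t) : ℕ) : ℝ) := by exact_mod_cast this
      push_cast at h2
      rw [← Real.rpow_natCast] at h2
      push_cast at h2
      exact h2
    rw [Real.rpow_mul hN0.le]
    exact Real.rpow_le_rpow hn0.le this hη.le

theorem tup_single (η : ℝ) (hη : 0 < η) (hη1 : η < 1 / 8) (J t : ℕ) (hJ : 1 ≤ J) (ht : 1 ≤ t) (hl : lam J ≤ η) :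
    ∃ K : ℝ, 1 ≤ K ∧ ∀ (s : ℤ) (N : ℕ) (j : Fin t → ℕ) (i : Fin t), (s = 1 ∨ s = -1) → 1 ≤ N →
    (∀ i, j i ≤ J + 1) → (∀ k ∈ FD s N, FEP s k) → 1 / 3 ≤ al J (j i) →
    ∑ k ∈ FD s N, (∏ i ∈ {i}, Vp s N J η (N ^ (3 * t)) (j i) k) ^ 2 ≤
      K * (N : ℝ) ^ (1 - al J (j i) + 9 * t * η) := by
  obtain ⟨K, hK, h1⟩ := tup_ms η hη hη1 J t hJ ht hl
  obtain ⟨K2, hK2, h2⟩ := Vp_ms η hη hη1 J t hJ ht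
  refine ⟨K + K2, by linarith, fun s N j i hs hN hj hF ha => ?_⟩
  have hN0 : (0 : ℝ) < N := by exact_mod_cast hN
  have hN1 : (1 : ℝ) ≤ N := by exact_mod_cast hN
  have ht1 : (1 : ℝ) ≤ t := by exact_mod_cast ht
  have hP : 0 ≤ (N : ℝ) ^ (1 - al J (j i) + 9 * t * η) := by positivity
  by_cases h : 1 / 2 ≤ al J (j i)
  · have h3 := h2 s N (j i) hs hN (hj i) hF h
    simp only [prod_singleton]
    refine h3.trans ?_
    have h4 : (N : ℝ) ^ (1 - al J (j i) + 2 * η) ≤ (N : ℝ) ^ (1 - al J (j i) + 9 * t * η) := by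
      apply Real.rpow_le_rpow_of_exponent_le hN1
      nlinarith
    exact mul_le_mul (by linarith) h4 (by positivity) (by linarith)
  · push Not at h
    have hjJ : j i ≤ J := by
      by_contra hc
      have : j i = J + 1 := by have := hj i; omega
      rw [this, al_last J hJ] at h
      norm_num at h
    have h3 := h1 s N j {i} hs hN hj (by simpa using hjJ)
    rw [sum_singleton, max_eq_left (by linarith)] at h3
    refine h3.trans ?_
    apply mul_le_mul_of_nonneg_right _ hP
    linarith

theorem tup_direct (η : ℝ) (hη : 0 < η) (hη1 : η < 1 / 8) (J t : ℕ) (hJ : 1 ≤ J) (ht : 1 ≤ t) (hl : lam J ≤ η) :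
    ∃ K : ℝ, 1 ≤ K ∧ ∀ (s : ℤ) (N : ℕ) (j : Fin t → ℕ), (s = 1 ∨ s = -1) → 1 ≤ N →
    (∀ i, j i ≤ J + 1) → ∑ i, al J (j i) < 2 / 3 →
    |∑ k ∈ FD s N, ∏ i, Vp s N J η (N ^ (3 * t)) (j i) k - 3 / Real.pi ^ 2 * N * Mn (∏ i, Fp s N J η (j i))| ≤
      K * (N : ℝ) ^ (2 / 3 + 5 * t * η) := by
  obtain ⟨K, hK, hw⟩ := tup_wsum η hη J t hJ ht
  obtain ⟨C, hC, hT⟩ := T2_bound η hη (by linarith)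
  refine ⟨C * K, one_le_mul_of_one_le_of_one_le hC hK, fun s N j hs hN hj hθ => ?_⟩
  have hN0 : (0 : ℝ) < N := by exact_mod_cast hN
  have hN1 : (1 : ℝ) ≤ N := by exact_mod_cast hN
  have ht1 : (1 : ℝ) ≤ t := by exact_mod_cast ht
  have hjJ : ∀ i ∈ (univ : Finset (Fin t)), j i ≤ J := by
    intro i hi
    by_contra hc
    have h1 : j i = J + 1 := by have := hj i; omega
    have h2 := single_le_sum (f := fun i => al J (j i)) (fun i _ => al_nonneg J _) hi
    simp only [h1, al_last J hJ] at h2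
    linarith
  obtain ⟨θ0, θ1⟩ := tup_al J t hJ j hj univ
  set G := ∏ i, Fp s N J η (j i) with hG
  set L := N ^ (3 * t) with hLdef
  have e1 : ∑ k ∈ FD s N, ∏ i, Vp s N J η L (j i) k = ∑ n ∈ Icc 1 L, G n * ∑ k ∈ FD s N, (kro (s * k) n : ℝ) := by
    have : ∀ k ∈ FD s N, ∏ i, Vp s N J η L (j i) k = ∑ n ∈ Icc 1 L, G n * (kro (s * k) n : ℝ) := by
      intro k _
      rw [tup_DA η hη hη1 s N J t k hN hJ ht j univ hjJ]
      rfl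
    rw [sum_congr rfl this, sum_comm]
    simp only [mul_sum]
  have hLM : (N : ℝ) ^ (∑ i, al J (j i) + t * (lam J + η)) ≤ L := by
    rw [hLdef]
    push_cast
    rw [← Real.rpow_natCast]
    apply Real.rpow_le_rpow_of_exponent_le hN1
    have h2 := j_lam_le J 1 hJ hJ
    push_cast at h2 ⊢
    nlinarith
  have e2 : Mn G = ∑ n ∈ Icc 1 L, G n * GG n := by
    unfold Mn
    apply tsum_eq_sum
    intro n hn
    by_cases h0 : n = 0
    · subst h0; simp
    · rw [hG, tup_supp η hη s N J t hN j univ hjJ n, zero_mul]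
      refine lt_of_le_of_lt hLM ?_
      rw [mem_Icc] at hn
      have : L < n := by omega
      exact_mod_cast this
  have e3 : ∑ k ∈ FD s N, ∏ i, Vp s N J η L (j i) k - 3 / Real.pi ^ 2 * N * Mn G =
      ∑ n ∈ Icc 1 L, G n * (∑ k ∈ FD s N, (kro (s * k) n : ℝ) - 3 / Real.pi ^ 2 * GG n * N) := by
    rw [e1, e2, mul_sum, ← sum_sub_distrib]
    exact sum_congr rfl fun n _ => by ring
  rw [e3]
  have key : ∀ n ∈ Icc 1 L, |G n * (∑ k ∈ FD s N, (kro (s * k) n : ℝ) - 3 / Real.pi ^ 2 * GG n * N)| ≤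
      C * (N : ℝ) ^ (1 / 2 + η) * (|G n| * (n : ℝ) ^ (1 / 4 + η)) := by
    intro n hn
    have hn1 := (mem_Icc.mp hn).1
    rw [abs_mul]
    refine (mul_le_mul_of_nonneg_left (hT s N n hs hN (by omega)) (abs_nonneg _)).trans (le_of_eq ?_)
    ring
  refine (abs_sum_le_sum_abs _ _).trans ((sum_le_sum key).trans ?_)
  rw [← mul_sum]
  have hw1 := hw s N j univ (1 / 4 + η) L hN hj hjJ (by linarith)
  refine (mul_le_mul_of_nonneg_left hw1 (by positivity)).trans ?_
  set θ := ∑ i, al J (j i)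
  have hr : C * (N : ℝ) ^ (1 / 2 + η) * (K * (N : ℝ) ^ ((θ + t * (lam J + η)) * (1 / 4 + η + 2 * η))) =
      C * K * (N : ℝ) ^ (1 / 2 + η + (θ + t * (lam J + η)) * (1 / 4 + η + 2 * η)) := by
    rw [Real.rpow_add hN0 (1 / 2 + η)]; ring
  rw [hr]
  apply mul_le_mul_of_nonneg_left _ (by positivity)
  apply Real.rpow_le_rpow_of_exponent_le hN1
  have hte : 0 < t * η := by positivity
  have e3 : θ + t * (lam J + η) ≤ 2 / 3 + 2 * (t * η) := by nlinarith
  have e4 := mul_le_mul_of_nonneg_right e3 (show 0 ≤ 1 / 4 + η + 2 * η by linarith)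
  have e6 : (t * η) * η ≤ (t * η) * (1 / 8) := mul_le_mul_of_nonneg_left hη1.le hte.le
  have e7 : η ≤ t * η := le_mul_of_one_le_left hη.le ht1
  nlinarith

theorem tup_rest (η : ℝ) (hη : 0 < η) (hη1 : η < 1 / 8) (J t : ℕ) (hJ : 1 ≤ J) (ht : 1 ≤ t) (hl : lam J ≤ η) :
    ∃ K : ℝ, 1 ≤ K ∧ ∀ (s : ℤ) (N : ℕ) (j : Fin t → ℕ), (s = 1 ∨ s = -1) → 1 ≤ N →
    (∀ i, j i ≤ J + 1) → (∀ k ∈ FD s N, FEP s k) → 2 / 3 ≤ ∑ i, al J (j i) →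
    |∑ k ∈ FD s N, ∏ i, Vp s N J η (N ^ (3 * t)) (j i) k| ≤ K * (N : ℝ) ^ (2 / 3 + 12 * (t : ℝ) ^ 2 * η) := by
  obtain ⟨K1, hK1, h1⟩ := tup_ms η hη hη1 J t hJ ht hl
  obtain ⟨K2, hK2, h2⟩ := tup_single η hη hη1 J t hJ ht hl
  obtain ⟨K3, hK3, h3⟩ := Vp_point η hη hη1 J t hJ ht
  refine ⟨K3 ^ t * (K1 + K2), one_le_mul_of_one_le_of_one_le (one_le_pow₀ hK3) (by linarith),
    fun s N j hs hN hj hF hθ => ?_⟩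
  have hN0 : (0 : ℝ) < N := by exact_mod_cast hN
  have hN1 : (1 : ℝ) ≤ N := by exact_mod_cast hN
  have ht1 : (1 : ℝ) ≤ t := by exact_mod_cast ht
  set V : Fin t → ℕ → ℝ := fun i k => Vp s N J η (N ^ (3 * t)) (j i) k with hV
  obtain ⟨S, _, T, _, hd, e1, e2, he, q1, q2⟩ := combi univ (fun i => al J (j i))
    (fun i _ => ⟨al_nonneg J _, al_le J _ hJ (hj i)⟩) hθ
    (fun S e => ∑ k ∈ FD s N, (∏ i ∈ S, V i k) ^ 2 ≤ (K1 + K2) * (N : ℝ) ^ (e + 9 * t * η))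
    (fun S _ hS => by
      refine (h1 s N j S hs hN hj fun i hi => ?_).trans (mul_le_mul_of_nonneg_right (by linarith) (by positivity))
      by_contra hc
      have h1 : j i = J + 1 := by have := hj i; omega
      have h2 := hS i hi
      rw [h1, al_last J hJ] at h2
      norm_num at h2)
    (fun i _ hi => (h2 s N j i hs hN hj hF hi).trans (mul_le_mul_of_nonneg_right (by linarith) (by positivity)))
  set B := K3 * (N : ℝ) ^ (3 * t * η) with hB
  have hB1 : 1 ≤ B := one_le_mul_of_one_le_of_one_le hK3 (Real.one_le_rpow hN1 (by positivity))
  have key : ∀ k ∈ FD s N, |∏ i, V i k| ≤ B ^ t * (|∏ i ∈ S, V i k| * |∏ i ∈ T, V i k|) := by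
    intro k hk
    have hu : (univ : Finset (Fin t)) = (S ∪ T) ∪ (univ \ (S ∪ T)) := by
      rw [union_sdiff_of_subset (subset_univ _)]
    rw [hu, prod_union disjoint_sdiff, prod_union hd, abs_mul, abs_mul, mul_comm]
    apply mul_le_mul_of_nonneg_right _ (by positivity)
    rw [abs_prod]
    refine (prod_le_prod (g := fun _ => B) (fun i _ => abs_nonneg _) fun i _ => h3 s N (j i) k hN (hj i) hk (hF k hk)).trans ?_
    rw [prod_const]
    exact pow_le_pow_right₀ hB1 (by simpa using card_le_univ (univ \ (S ∪ T)))
  refine (abs_sum_le_sum_abs _ _).trans ((sum_le_sum key).trans ?_)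
  rw [← mul_sum]
  have cs := sum_mul_sq_le_sq_mul_sq (FD s N) (fun k => |∏ i ∈ S, V i k|) (fun k => |∏ i ∈ T, V i k|)
  simp only [sq_abs] at cs
  have hprod : (∑ k ∈ FD s N, (∏ i ∈ S, V i k) ^ 2) * (∑ k ∈ FD s N, (∏ i ∈ T, V i k) ^ 2) ≤
      ((K1 + K2) * (N : ℝ) ^ (2 / 3 + 9 * t * η)) ^ 2 := by
    refine (mul_le_mul q1 q2 (sum_nonneg fun k _ => sq_nonneg _) (by positivity)).trans ?_
    have : (K1 + K2) * (N : ℝ) ^ (e1 + 9 * t * η) * ((K1 + K2) * (N : ℝ) ^ (e2 + 9 * t * η)) =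
        (K1 + K2) ^ 2 * (N : ℝ) ^ (e1 + 9 * t * η + (e2 + 9 * t * η)) := by
      rw [Real.rpow_add hN0 (e1 + 9 * t * η)]; ring
    rw [this, mul_pow, ← Real.rpow_natCast ((N : ℝ) ^ _), ← Real.rpow_mul hN0.le]
    apply mul_le_mul_of_nonneg_left _ (by positivity)
    apply Real.rpow_le_rpow_of_exponent_le hN1
    push_cast; linarith
  have hcs := abs_le_of_sq_le_sq (cs.trans hprod) (by positivity)
  rw [abs_of_nonneg (sum_nonneg fun k _ => by positivity)] at hcs
  refine (mul_le_mul_of_nonneg_left hcs (by positivity)).trans ?_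
  have : B ^ t * ((K1 + K2) * (N : ℝ) ^ (2 / 3 + 9 * t * η)) =
      K3 ^ t * (K1 + K2) * (N : ℝ) ^ (3 * t * η * t + (2 / 3 + 9 * t * η)) := by
    rw [hB, mul_pow, ← Real.rpow_natCast ((N : ℝ) ^ _), ← Real.rpow_mul hN0.le, Real.rpow_add hN0 (3 * t * η * t)]
    ring
  rw [this]
  apply mul_le_mul_of_nonneg_left _ (by positivity)
  apply Real.rpow_le_rpow_of_exponent_le hN1
  have : t * η ≤ (t : ℝ) ^ 2 * η := by
    apply mul_le_mul_of_nonneg_right _ hη.le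
    nlinarith
  nlinarith

theorem tup_all (η : ℝ) (hη : 0 < η) (hη1 : η < 1 / 8) (J t : ℕ) (hJ : 1 ≤ J) (ht : 1 ≤ t) (hl : lam J ≤ η) :
    ∃ K : ℝ, 1 ≤ K ∧ ∀ (s : ℤ) (N : ℕ) (j : Fin t → ℕ), (s = 1 ∨ s = -1) → 1 ≤ N →
    (∀ i, j i ≤ J + 1) → (∀ k ∈ FD s N, FEP s k) →
    |∑ k ∈ FD s N, ∏ i, Vp s N J η (N ^ (3 * t)) (j i) k - 3 / Real.pi ^ 2 * N * Mn (∏ i, Fp s N J η (j i))| ≤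
      K * (N : ℝ) ^ (2 / 3 + 12 * (t : ℝ) ^ 2 * η) := by
  obtain ⟨K1, hK1, h1⟩ := tup_direct η hη hη1 J t hJ ht hl
  obtain ⟨K2, hK2, h2⟩ := tup_rest η hη hη1 J t hJ ht hl
  obtain ⟨K3, hK3, h3⟩ := tup_bound η hη J t hJ ht
  obtain ⟨K4, hK4, h4⟩ := Mn_bound η hη (by linarith)
  refine ⟨K1 + K2 + K4 * K3, by nlinarith, fun s N j hs hN hj hF => ?_⟩
  have hN0 : (0 : ℝ) < N := by exact_mod_cast hN
  have hN1 : (1 : ℝ) ≤ N := by exact_mod_cast hN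
  have ht1 : (1 : ℝ) ≤ t := by exact_mod_cast ht
  have htt : t * η ≤ (t : ℝ) ^ 2 * η := by
    apply mul_le_mul_of_nonneg_right _ hη.le
    nlinarith
  have hte : η ≤ t * η := le_mul_of_one_le_left hη.le ht1
  have hte0 : 0 < t * η := by positivity
  rcases lt_or_ge (∑ i, al J (j i)) (2 / 3) with h | h
  · refine (h1 s N j hs hN hj h).trans ?_
    apply mul_le_mul _ _ (by positivity) (by positivity)
    · nlinarith
    · apply Real.rpow_le_rpow_of_exponent_le hN1
      nlinarith
  · have a1 := h2 s N j hs hN hj hF h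
    have a2 := h4 (∏ i, Fp s N J η (j i)) K3 ((N : ℝ) ^ (∑ i, al J (j i))) (by linarith)
      (Real.one_le_rpow hN1 (by linarith)) (fun n hn => h3 s N j univ n hN hj hn)
    have hpi : 3 / Real.pi ^ 2 ≤ 1 := by
      rw [div_le_one (by positivity)]
      nlinarith [Real.pi_gt_three]
    have hpi0 : 0 ≤ 3 / Real.pi ^ 2 := by positivity
    have a3 : |3 / Real.pi ^ 2 * N * Mn (∏ i, Fp s N J η (j i))| ≤ K4 * K3 * (N : ℝ) ^ (2 / 3 + 12 * (t : ℝ) ^ 2 * η) := by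
      rw [abs_mul, abs_mul, abs_of_nonneg hpi0, abs_of_nonneg hN0.le]
      calc 3 / Real.pi ^ 2 * N * |Mn (∏ i, Fp s N J η (j i))| ≤
            N * (K4 * K3 * ((N : ℝ) ^ (∑ i, al J (j i))) ^ (-(1 / 2 - 2 * η))) :=
            mul_le_mul (mul_le_of_le_one_left hN0.le hpi) a2 (abs_nonneg _) hN0.le
        _ = K4 * K3 * (N : ℝ) ^ (1 + (∑ i, al J (j i)) * (-(1 / 2 - 2 * η))) := by
            rw [← Real.rpow_mul hN0.le, Real.rpow_add hN0, Real.rpow_one]; ring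
        _ ≤ _ := by
            apply mul_le_mul_of_nonneg_left _ (by positivity)
            apply Real.rpow_le_rpow_of_exponent_le hN1
            have := mul_le_mul_of_nonneg_right h (show 0 ≤ 1 / 2 - 2 * η by linarith)
            nlinarith
    refine (abs_sub _ _).trans ((add_le_add a1 a3).trans ?_)
    have : 0 ≤ K1 * (N : ℝ) ^ (2 / 3 + 12 * (t : ℝ) ^ 2 * η) := by positivity
    nlinarith

theorem main_sum (t : ℕ) (ht : 1 ≤ t) (ε : ℝ) (hε : 0 < ε) :
    ∃ C : ℝ, 1 ≤ C ∧ ∀ (s : ℤ) (N : ℕ), (s = 1 ∨ s = -1) → 1 ≤ N → (∀ k ∈ FD s N, FEP s k) →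
    |∑ k ∈ FD s N, (Lr s k) ^ t - 3 / Real.pi ^ 2 * N * Mn (bb ^ t)| ≤ C * (N : ℝ) ^ (2 / 3 + ε) := by
  have ht1 : (1 : ℝ) ≤ t := by exact_mod_cast ht
  obtain ⟨η, hη, hη1, hηε⟩ : ∃ η : ℝ, 0 < η ∧ η < 1 / 8 ∧ 12 * (t : ℝ) ^ 2 * η ≤ ε := by
    refine ⟨min (1 / 16) (ε / (12 * (t : ℝ) ^ 2)), by positivity, lt_of_le_of_lt (min_le_left _ _) (by norm_num), ?_⟩
    have := min_le_right (1 / 16) (ε / (12 * (t : ℝ) ^ 2))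
    rw [le_div_iff₀ (by positivity)] at this
    linarith
  obtain ⟨J, hJ, hl⟩ : ∃ J : ℕ, 1 ≤ J ∧ lam J ≤ η := by
    obtain ⟨m, hm⟩ := exists_nat_ge (1 / η)
    refine ⟨m + 1, by omega, ?_⟩
    unfold lam
    rw [div_le_iff₀ hη] at hm
    rw [div_le_iff₀ (by positivity)]
    push_cast
    nlinarith
  obtain ⟨K, hK, h⟩ := tup_all η hη hη1 J t hJ ht hl
  obtain ⟨K3, hK3, h3⟩ := tup_bound η hη J t hJ ht
  refine ⟨((J : ℝ) + 2) ^ t * K, one_le_mul_of_one_le_of_one_le (one_le_pow₀ (by have : (0 : ℝ) ≤ J := Nat.cast_nonneg J; linarith)) hK,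
    fun s N hs hN hF => ?_⟩
  have hN1 : (1 : ℝ) ≤ N := by exact_mod_cast hN
  set I := Fintype.piFinset fun _ : Fin t => range (J + 2)
  have hI : ∀ p ∈ I, ∀ i, p i ≤ J + 1 := by
    intro p hp i
    have := mem_range.mp (Fintype.mem_piFinset.mp hp i)
    omega
  have e1 : ∀ k ∈ FD s N, (Lr s k) ^ t = ∑ p ∈ I, ∏ i, Vp s N J η (N ^ (3 * t)) (p i) k := by
    intro k _
    rw [← Vp_sum s N J η (N ^ (3 * t)) k]
    have := prod_univ_sum (fun _ : Fin t => range (J + 2)) (fun _ j => Vp s N J η (N ^ (3 * t)) j k)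
    rw [← this, prod_const, card_univ, Fintype.card_fin]
  have e2 : bb ^ t = ∑ p ∈ I, ∏ i, Fp s N J η (p i) := by
    rw [← Fp_sum s N J η]
    have := prod_univ_sum (fun _ : Fin t => range (J + 2)) (fun _ j => Fp s N J η j)
    rw [← this, prod_const, card_univ, Fintype.card_fin]
  have e3 : Mn (bb ^ t) = ∑ p ∈ I, Mn (∏ i, Fp s N J η (p i)) := by
    unfold Mn
    rw [e2, ← Summable.tsum_finsetSum]
    · congr 1; funext n
      rw [af_sum_apply, sum_mul]
    · intro p hp
      exact Mn_summable η hη (by linarith) _ K3 ((N : ℝ) ^ (∑ i, al J (p i))) (by linarith)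
        (Real.one_le_rpow hN1 (sum_nonneg fun i _ => al_nonneg J _)) (fun n hn => h3 s N p univ n hN (hI p hp) hn)
  rw [sum_congr rfl e1, sum_comm, e3, mul_sum, ← sum_sub_distrib]
  refine (abs_sum_le_sum_abs _ _).trans ((sum_le_card_nsmul _ _ _ fun p hp => h s N p hs hN (hI p hp) hF).trans ?_)
  rw [nsmul_eq_mul, Fintype.card_piFinset]
  simp only [card_range, prod_const, card_univ, Fintype.card_fin]
  push_cast
  rw [← mul_assoc]
  apply mul_le_mul_of_nonneg_left _ (by positivity)
  apply Real.rpow_le_rpow_of_exponent_le hN1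
  linarith

end

section

theorem tau_finite (r n : ℕ) (hn : n ≠ 0) : Finite {f : Fin r → ℕ // (∀ i, 0 < f i) ∧ ∏ i, f i = n} := by
  have : Set.Finite {f : Fin r → ℕ | (∀ i, 0 < f i) ∧ ∏ i, f i = n} := by
    refine Set.Finite.subset (Set.Finite.pi' fun _ : Fin r => Set.finite_Iic n) ?_
    rintro f ⟨-, h⟩ i
    exact Nat.le_of_dvd (Nat.pos_of_ne_zero hn) (h ▸ Finset.dvd_prod_of_mem f (Finset.mem_univ i))
  exact this.to_subtype

def tauEquiv (r n : ℕ) (hn : n ≠ 0) : {f : Fin (r + 1) → ℕ // (∀ i, 0 < f i) ∧ ∏ i, f i = n} ≃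
    Σ x : {x // x ∈ n.divisorsAntidiagonal}, {f : Fin r → ℕ // (∀ i, 0 < f i) ∧ ∏ i, f i = x.1.2} where
  toFun f := ⟨⟨(f.1 0, ∏ i, f.1 (Fin.succ i)), by
      rw [Nat.mem_divisorsAntidiagonal]
      exact ⟨(Fin.prod_univ_succ f.1).symm.trans f.2.2, hn⟩⟩, ⟨fun i => f.1 i.succ, fun i => f.2.1 _, rfl⟩⟩
  invFun y := ⟨Fin.cons y.1.1.1 y.2.1, by
      have h := Nat.mem_divisorsAntidiagonal.mp y.1.2
      constructor
      · intro i
        refine Fin.cases ?_ (fun i => ?_) i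
        · simp only [Fin.cons_zero]
          rcases Nat.eq_zero_or_pos y.1.1.1 with h0 | h0
          · rw [h0, zero_mul] at h; exact absurd h.1.symm h.2
          · exact h0
        · simp only [Fin.cons_succ]; exact y.2.2.1 i
      · rw [Fin.prod_univ_succ]
        simp only [Fin.cons_zero, Fin.cons_succ]
        rw [y.2.2.2, h.1]⟩
  left_inv f := by
    apply Subtype.ext
    funext i
    refine Fin.cases ?_ (fun i => ?_) i <;> simp
  right_inv y := by
    obtain ⟨⟨⟨a, b⟩, h⟩, ⟨f, hf, hb⟩⟩ := y
    simp only at hb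
    subst hb
    rfl

theorem tau_succ (r n : ℕ) (hn : n ≠ 0) : tau (r + 1) n = ∑ x ∈ n.divisorsAntidiagonal, tau r x.2 := by
  unfold tau
  rw [Nat.card_congr (tauEquiv r n hn)]
  have : ∀ x : {x // x ∈ n.divisorsAntidiagonal}, Finite {f : Fin r → ℕ // (∀ i, 0 < f i) ∧ ∏ i, f i = x.1.2} := fun x => by
    apply tau_finite
    have h := Nat.mem_divisorsAntidiagonal.mp x.2
    intro h0
    rw [h0, mul_zero] at h; exact absurd h.1.symm h.2
  rw [Nat.card_sigma]
  exact Finset.sum_coe_sort n.divisorsAntidiagonal fun x => Nat.card {f : Fin r → ℕ // (∀ i, 0 < f i) ∧ ∏ i, f i = x.2}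

theorem tau_zero (n : ℕ) : tau 0 n = if n = 1 then 1 else 0 := by
  unfold tau
  split_ifs with h
  · subst h
    rw [Nat.card_eq_one_iff_unique]
    exact ⟨⟨fun a b => Subtype.ext (Subsingleton.elim _ _)⟩, ⟨⟨fun i => 0, fun i => i.elim0, by simp⟩⟩⟩
  · rw [Nat.card_eq_zero]
    left
    exact ⟨fun f => h (by rw [← f.2.2]; simp)⟩

theorem bb_pow (t n : ℕ) (hn : n ≠ 0) : (bb ^ t) n = (tau t n : ℝ) / n := by
  induction t generalizing n with
  | zero =>
    rw [pow_zero, ArithmeticFunction.one_apply, tau_zero]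
    split_ifs with h
    · subst h; simp
    · simp
  | succ t ih =>
    rw [pow_succ', ArithmeticFunction.mul_apply, tau_succ t n hn]
    push_cast
    rw [Finset.sum_div]
    refine Finset.sum_congr rfl fun x hx => ?_
    have h := Nat.mem_divisorsAntidiagonal.mp hx
    have h2 : x.2 ≠ 0 := by
      intro h0
      rw [h0, mul_zero] at h; exact absurd h.1.symm h.2
    rw [ih x.2 h2, ← h.1]
    have : bb x.1 = 1 / (x.1 : ℝ) := rfl
    rw [this]
    push_cast
    rw [div_mul_div_comm, one_mul]

theorem bb_mult : bb.IsMultiplicative := by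
  refine ⟨by show 1 / ((1 : ℕ) : ℝ) = 1; simp, fun {m n} _ => ?_⟩
  show 1 / ((m * n : ℕ) : ℝ) = 1 / (m : ℝ) * (1 / (n : ℝ))
  push_cast
  rw [div_mul_div_comm, one_mul]

theorem bb_pow_mult (t : ℕ) : (bb ^ t).IsMultiplicative := by
  induction t with
  | zero => rw [pow_zero]; exact ArithmeticFunction.isMultiplicative_one
  | succ t ih => rw [pow_succ']; exact bb_mult.mul ih

theorem GG_mult {m n : ℕ} (h : m.Coprime n) : GG (m * n) = GG m * GG n := by
  have hs : IsSquare (m * n) ↔ IsSquare m ∧ IsSquare n := by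
    constructor
    · rintro ⟨c, hc⟩
      rw [← sq] at hc
      obtain ⟨d, hd⟩ := exists_eq_pow_of_mul_eq_pow (Nat.isUnit_iff.mpr h) hc
      obtain ⟨e, he⟩ := exists_eq_pow_of_mul_eq_pow (Nat.isUnit_iff.mpr h.symm) (by rw [mul_comm]; exact hc)
      exact ⟨⟨d, by rw [hd, sq]⟩, ⟨e, by rw [he, sq]⟩⟩
    · rintro ⟨h1, h2⟩; exact h1.mul h2
  have hg : gg (m * n) = gg m * gg n := by
    unfold gg
    rw [h.primeFactors_mul, Finset.prod_union h.disjoint_primeFactors]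
  unfold GG
  by_cases h1 : IsSquare m <;> by_cases h2 : IsSquare n <;> simp [hs, h1, h2, hg]

theorem GG_pp_even {p : ℕ} (hp : p.Prime) (k : ℕ) : GG (p ^ (2 * (k + 1))) = (1 + 1 / (p : ℝ))⁻¹ := by
  unfold GG gg
  rw [if_pos ⟨p ^ (k + 1), by ring⟩, Nat.primeFactors_prime_pow (by omega) hp, Finset.prod_singleton]

theorem GG_pp_odd {p : ℕ} (hp : p.Prime) (k : ℕ) (hk : ¬ Even k) : GG (p ^ k) = 0 := by
  unfold GG
  rw [if_neg]
  rintro ⟨c, hc⟩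
  apply hk
  have hc0 : c ≠ 0 := by rintro rfl; simp at hc; exact hp.ne_zero hc.1
  have := congrArg (fun n => n.factorization p) hc
  simp only [hp.factorization_pow, Nat.factorization_mul hc0 hc0] at this
  simp at this
  exact ⟨_, this⟩

theorem bb_sum (t : ℕ) : Summable fun n => (bb ^ t) n * GG n := by
  obtain ⟨C, hC, h⟩ := divisor_bound (1 / (8 * (t + 1))) (by positivity)
  refine Mn_summable (1 / 8) (by norm_num) (by norm_num) (bb ^ t) (C ^ t) 1 (by positivity) le_rfl fun n hn => ?_
  have hn1 : (1 : ℝ) ≤ n := by exact_mod_cast Nat.one_le_iff_ne_zero.mpr hn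
  have := conv_bound (Finset.univ : Finset (Fin t)) (fun _ => bb) (fun _ => 1) 1 zero_le_one (by simp) (fun i _ n hn => by
    have hn1 : (1 : ℝ) ≤ n := by exact_mod_cast Nat.one_le_iff_ne_zero.mpr hn
    rw [max_eq_left hn1]
    show |1 / (n : ℝ)| ≤ _
    rw [abs_of_nonneg (by positivity)]) n hn
  simp only [Finset.prod_const, Finset.card_univ, Fintype.card_fin, one_pow, one_mul] at this
  refine this.trans ?_
  gcongr
  calc (n.divisors.card : ℝ) ^ t ≤ (C * (n : ℝ) ^ (1 / (8 * ((t : ℝ) + 1)))) ^ t := by gcongr; exact h n hn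
    _ = C ^ t * (n : ℝ) ^ (1 / (8 * ((t : ℝ) + 1)) * t) := by rw [mul_pow, ← Real.rpow_natCast ((n : ℝ) ^ _), ← Real.rpow_mul (by positivity)]
    _ ≤ _ := by
      gcongr
      rw [div_mul_eq_mul_div, div_le_div_iff₀ (by positivity) (by norm_num)]; nlinarith

theorem Mn_const (t : ℕ) : 3 / Real.pi ^ 2 * Mn (bb ^ t) = momentConst t := by
  unfold Mn momentConst
  congr 1
  have hs := bb_sum t
  have h1 : (bb ^ t) 1 * GG 1 = 1 := by
    rw [(bb_pow_mult t).1]; simp [GG, gg]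
  rw [← EulerProduct.eulerProduct_tprod (f := fun n => (bb ^ t) n * GG n) h1 (fun {m n} h => by
    rw [(bb_pow_mult t).2 h, GG_mult h]; ring) hs.norm (by simp)]
  refine tprod_congr fun p => ?_
  have hp := p.2
  have hi : Function.Injective fun m : ℕ => 2 * m := fun a b h => by simpa using h
  have hsup : Function.support (fun e : ℕ => (bb ^ t) ((p : ℕ) ^ e) * GG ((p : ℕ) ^ e)) ⊆ Set.range fun m : ℕ => 2 * m := by
    intro e he
    by_contra hc
    apply he
    simp only
    rw [GG_pp_odd hp e, mul_zero]
    rintro ⟨m, hm⟩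
    exact hc ⟨m, by simp only; omega⟩
  rw [← hi.tsum_eq hsup]
  have hs2 : Summable fun m : ℕ => (bb ^ t) ((p : ℕ) ^ (2 * m)) * GG ((p : ℕ) ^ (2 * m)) :=
    hs.comp_injective (i := fun m : ℕ => (p : ℕ) ^ (2 * m)) fun a b h => by
      have := Nat.pow_right_injective hp.two_le h
      simpa using this
  rw [hs2.tsum_eq_zero_add]
  simp only [mul_zero, pow_zero]
  rw [h1, ← tsum_mul_left]
  congr 1
  refine tsum_congr fun k => ?_
  rw [GG_pp_even hp, bb_pow t _ (pow_ne_zero _ hp.ne_zero), mul_comm]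
  push_cast
  rfl

end

open scoped Classical in
theorem half_moment {s : ℤ} (hs1 : s = 1 ∨ s = -1) (t : ℕ) (C ε : ℝ) (hε : 0 < ε) (hC : 1 ≤ C)
    (hmain : ∀ N : ℕ, 1 ≤ N → (∀ k ∈ FD s N, FEP s k) →
      |∑ k ∈ FD s N, (Lr s k) ^ t - 3 / Real.pi ^ 2 * N * Mn (bb ^ t)| ≤ C * (N : ℝ) ^ (2 / 3 + ε))
    (χ : (Δ : ℤ) → DirichletCharacter ℂ Δ.natAbs)
    (hχ : ∀ Δ : ℤ, IsFundamentalDiscriminant Δ →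
          χ Δ ≠ 1 ∧ (χ Δ) ^ 2 = 1 ∧ DirichletCharacter.IsPrimitive (χ Δ) ∧
            χ Δ (-1) = (if 0 < Δ then 1 else -1)) (Y : ℝ) (hY : 1 ≤ Y) (I : Finset ℤ)
    (hI : I = (Finset.Icc 1 ⌊Y⌋₊).image fun k : ℕ => s * (k : ℤ)) :
    ‖(∑ Δ ∈ I,
        if h : IsFundamentalDiscriminant Δ then
          (letI : NeZero Δ.natAbs := ⟨h.natAbs_ne_zero⟩;
            DirichletCharacter.LFunction (χ Δ) 1) ^ t
        else 0) - (momentConst t : ℂ) * (Y : ℂ)‖ ≤ (C + |momentConst t|) * Y ^ ((2 : ℝ) / 3 + ε) := by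
  have hN1 : 1 ≤ ⌊Y⌋₊ := Nat.le_floor (by simpa using hY)
  have hNY : (⌊Y⌋₊ : ℝ) ≤ Y := Nat.floor_le (by linarith)
  have hYN : Y < ⌊Y⌋₊ + 1 := Nat.lt_floor_add_one Y
  generalize ⌊Y⌋₊ = N at *
  have hs0 : s ≠ 0 := by rcases hs1 with rfl | rfl <;> norm_num
  have hF : ∀ k ∈ FD s N, FEP s k := fun k hk => by
    have hf := (mem_FD.mp hk).2
    have : NeZero (s * (k : ℤ)).natAbs := ⟨hf.natAbs_ne_zero⟩
    obtain ⟨h1, h2, h3, h4⟩ := hχ _ hf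
    exact FEP_of hs1 rfl hf (χ (s * k)) h2 h3 h4
  have hm := hmain N hN1 hF
  have hsum : (∑ Δ ∈ I,
        if h : IsFundamentalDiscriminant Δ then
          (letI : NeZero Δ.natAbs := ⟨h.natAbs_ne_zero⟩;
            DirichletCharacter.LFunction (χ Δ) 1) ^ t
        else 0) = ((∑ k ∈ FD s N, (Lr s k) ^ t : ℝ) : ℂ) := by
    rw [hI, Finset.sum_image (by
      intro a _ b _ hab
      simp only at hab
      exact_mod_cast mul_left_cancel₀ hs0 hab)]
    push_cast
    symm
    refine (Finset.sum_congr rfl fun k hk => ?_).trans (Finset.sum_subset (s₁ := FD s N) ?_ ?_)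
    · have hf := (mem_FD.mp hk).2
      have : NeZero (s * (k : ℤ)).natAbs := ⟨hf.natAbs_ne_zero⟩
      obtain ⟨h1, h2, h3, h4⟩ := hχ _ hf
      rw [dif_pos hf, ← L_eq hs1 rfl hf (χ (s * k)) h1 h2 h3 h4]
    · intro k hk
      rw [Finset.mem_Icc]; exact (mem_FD.mp hk).1
    · intro k hk hk2
      rw [Finset.mem_Icc] at hk
      rw [dif_neg]
      exact fun hf => hk2 (mem_FD.mpr ⟨hk, hf⟩)
  rw [hsum, ← Complex.ofReal_mul, ← Complex.ofReal_sub, Complex.norm_real, Real.norm_eq_abs]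
  rw [show 3 / Real.pi ^ 2 * N * Mn (bb ^ t) = momentConst t * N by rw [← Mn_const]; ring] at hm
  have hp : (N : ℝ) ^ (2 / 3 + ε) ≤ Y ^ ((2 : ℝ) / 3 + ε) :=
    Real.rpow_le_rpow (Nat.cast_nonneg _) hNY (by linarith)
  have hp1 : 1 ≤ Y ^ ((2 : ℝ) / 3 + ε) := Real.one_le_rpow hY (by linarith)
  have h3 : |momentConst t * N - momentConst t * Y| ≤ |momentConst t| * Y ^ ((2 : ℝ) / 3 + ε) := by
    rw [← mul_sub, abs_mul]
    refine mul_le_mul_of_nonneg_left ?_ (abs_nonneg _)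
    refine le_trans ?_ hp1
    rw [abs_le]; constructor <;> linarith
  calc _ ≤ |∑ k ∈ FD s N, (Lr s k) ^ t - momentConst t * N| + |momentConst t * N - momentConst t * Y| :=
        abs_sub_le _ _ _
    _ ≤ C * Y ^ ((2 : ℝ) / 3 + ε) + |momentConst t| * Y ^ ((2 : ℝ) / 3 + ε) :=
        add_le_add (hm.trans (mul_le_mul_of_nonneg_left hp (by linarith))) h3
    _ = _ := by ring

open scoped Classical in
theorem statement_3 (t : ℕ) (ht : 1 ≤ t) (ε : ℝ) (hε : 0 < ε) :
    ∃ C : ℝ, 0 < C ∧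
      ∀ χ : (Δ : ℤ) → DirichletCharacter ℂ Δ.natAbs,
        (∀ Δ : ℤ, IsFundamentalDiscriminant Δ →
          χ Δ ≠ 1 ∧ (χ Δ) ^ 2 = 1 ∧ DirichletCharacter.IsPrimitive (χ Δ) ∧
            χ Δ (-1) = (if 0 < Δ then 1 else -1)) →
        ∀ Y : ℝ, 1 ≤ Y →
          ‖(∑ Δ ∈ Finset.Icc (1 : ℤ) ⌊Y⌋,
              if h : IsFundamentalDiscriminant Δ then
                (letI : NeZero Δ.natAbs := ⟨h.natAbs_ne_zero⟩;
                  DirichletCharacter.LFunction (χ Δ) 1) ^ t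
              else 0) - (momentConst t : ℂ) * (Y : ℂ)‖ ≤ C * Y ^ ((2 : ℝ) / 3 + ε) ∧
          ‖(∑ Δ ∈ Finset.Icc ⌈-Y⌉ (-1 : ℤ),
              if h : IsFundamentalDiscriminant Δ then
                (letI : NeZero Δ.natAbs := ⟨h.natAbs_ne_zero⟩;
                  DirichletCharacter.LFunction (χ Δ) 1) ^ t
              else 0) - (momentConst t : ℂ) * (Y : ℂ)‖ ≤ C * Y ^ ((2 : ℝ) / 3 + ε) := by
  obtain ⟨C, hC, hmain⟩ := main_sum t ht ε hε
  refine ⟨C + |momentConst t|, by positivity, fun χ hχ Y hY => ?_⟩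
  have hfl : ⌊Y⌋ = (⌊Y⌋₊ : ℤ) := (Int.natCast_floor_eq_floor (by linarith)).symm
  constructor
  · refine half_moment (Or.inl rfl) t C ε hε hC (fun N hN h => hmain 1 N (Or.inl rfl) hN h) χ hχ Y hY _ ?_
    ext x
    simp only [Finset.mem_Icc, Finset.mem_image, hfl]
    constructor
    · rintro ⟨h1, h2⟩
      exact ⟨x.toNat, by omega, by omega⟩
    · rintro ⟨k, hk, rfl⟩
      omega
  · refine half_moment (Or.inr rfl) t C ε hε hC (fun N hN h => hmain (-1) N (Or.inr rfl) hN h) χ hχ Y hY _ ?_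
    ext x
    simp only [Finset.mem_Icc, Finset.mem_image, Int.ceil_neg, hfl]
    constructor
    · rintro ⟨h1, h2⟩
      exact ⟨(-x).toNat, by omega, by omega⟩
    · rintro ⟨k, hk, rfl⟩
      omega
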